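/- arXiv:2207.01957 — 2 statements merged into one kernel-verified Lean document; each statement's English description precedes it below -/
import Mathlib

section
/- Let R be a W*-algebra with center Z, let Δ be the maximal ideal space of Z, and for each t ∈ Δ let M_t be the unique maximal norm-closed two-sided ideal of R containing t. A bounded Z-module map φ: R → Z ⊆ R preserves all norm-closed two-sided ideals of R (i.e. φ(J) ⊆ J for every such ideal J) if and only if φ(M_t) ⊆ t for every t ∈ Δ. If R is properly infinite, these conditions are equivalent to φ(J_R) = 0, where J_R is the strong radical of R. -/
universe u

open scoped ComplexConjugate ComplexOrder

noncomputable section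

variable {H : Type u} [NormedAddCommGroup H] [InnerProductSpace ℂ H] [CompleteSpace H]

local notation "⟪" x ", " y "⟫" => @inner ℂ _ _ x y

namespace VonNeumannAlgebraPaper

/-- Scalar multiples of elements of a von Neumann algebra stay in it. -/
instance : SMulMemClass (VonNeumannAlgebra H) ℂ (H →L[ℂ] H) where
  smul_mem {S} z x hx := by
    have h : z • x = algebraMap ℂ (H →L[ℂ] H) z * x := Algebra.smul_def z x
    rw [h]
    exact mul_mem (S.toStarSubalgebra.algebraMap_mem z) hx

instance (M : VonNeumannAlgebra H) : Algebra ℂ ↥M :=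
  Algebra.ofModule
    (fun r x y => Subtype.ext (smul_mul_assoc r (x : H →L[ℂ] H) (y : H →L[ℂ] H)))
    (fun r x y => Subtype.ext (mul_smul_comm r (x : H →L[ℂ] H) (y : H →L[ℂ] H)))

instance (M : VonNeumannAlgebra H) : NormedAlgebra ℂ ↥M where
  norm_smul_le r x := norm_smul_le r (x : H →L[ℂ] H)

variable {M : VonNeumannAlgebra H}

/-- A linear functional on `M` is positive if it is nonnegative on all
elements `a* a`. -/
def IsPositiveFunctional (ω : ↥M →L[ℂ] ℂ) : Prop :=
  ∀ a : ↥M, 0 ≤ ω (star a * a)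

/-- A state is a positive unital linear functional. -/
def IsState (ω : ↥M →L[ℂ] ℂ) : Prop :=
  IsPositiveFunctional ω ∧ ω 1 = 1

/-- A hermitian (self-adjoint) linear functional. -/
def IsHermitianFunctional (ω : ↥M →L[ℂ] ℂ) : Prop :=
  ∀ a : ↥M, ω (star a) = conj (ω a)

/-- `ωp`, `ωm` form the Jordan decomposition of the hermitian functional `ω`. -/
def IsJordanDecomposition (ω ωp ωm : ↥M →L[ℂ] ℂ) : Prop :=
  IsPositiveFunctional ωp ∧ IsPositiveFunctional ωm ∧ ω = ωp - ωm ∧ ‖ω‖ = ‖ωp‖ + ‖ωm‖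

/-- An element of a C*-algebra is positive iff it is of the form `b* b`. -/
def IsPositiveElem (c : ↥M) : Prop :=
  ∃ b : ↥M, c = star b * b

/-- A normal (= weak* continuous) functional on the von Neumann algebra `M`:
it is given by a pair of ℓ²-sequences of vectors. -/
def IsNormalFunctional (ω : ↥M →L[ℂ] ℂ) : Prop :=
  ∃ x y : ℕ → H, Summable (fun n => ‖x n‖ ^ 2) ∧ Summable (fun n => ‖y n‖ ^ 2) ∧
    ∀ a : ↥M, HasSum (fun n => ⟪x n, (a : H →L[ℂ] H) (y n)⟫) (ω a)

/-- `E(M)`: the unital completely positive elementary maps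
`x ↦ ∑ i, (a i)* x (a i)` with `∑ i, (a i)* (a i) = 1`. -/
def IsElementaryUCP (φ : ↥M →L[ℂ] ↥M) : Prop :=
  ∃ (n : ℕ) (a : Fin n → ↥M), (∑ i, star (a i) * a i) = 1 ∧
    ∀ x : ↥M, φ x = ∑ i, star (a i) * x * a i

/-- The set `ω ∘ E(M) = {ω ∘ φ : φ ∈ E(M)}`. -/
def mixSet (ω : ↥M →L[ℂ] ℂ) : Set (↥M →L[ℂ] ℂ) :=
  {ρ | ∃ φ : ↥M →L[ℂ] ↥M, IsElementaryUCP φ ∧ ρ = ω.comp φ}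

/-- Membership in the weak* closure of a set of functionals on `M`. -/
def InWeakStarClosure (S : Set (↥M →L[ℂ] ℂ)) (ρ : ↥M →L[ℂ] ℂ) : Prop :=
  ∀ ε : ℝ, 0 < ε → ∀ (n : ℕ) (x : Fin n → ↥M), ∃ σ ∈ S, ∀ i, ‖ρ (x i) - σ (x i)‖ < ε

/-- Membership in the point-weak* closure of a set `S` of maps on `M`: at
finitely many points, finitely many normal functionals are simultaneously
approximated by some member of `S`. -/
def InPointWeakStarClosure (S : Set (↥M →L[ℂ] ↥M)) (ψ : ↥M →L[ℂ] ↥M) : Prop :=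
  ∀ ε : ℝ, 0 < ε → ∀ (n : ℕ) (x : Fin n → ↥M) (g : Fin n → (↥M →L[ℂ] ℂ)),
    (∀ i, IsNormalFunctional (g i)) →
    ∃ φ ∈ S, ∀ i j, ‖g i (ψ (x j)) - g i (φ (x j))‖ < ε

/-- A map on `M` is normal if pre-composition preserves normal functionals. -/
def IsNormalMap (ψ : ↥M →L[ℂ] ↥M) : Prop :=
  ∀ ω : ↥M →L[ℂ] ℂ, IsNormalFunctional ω → IsNormalFunctional (ω.comp ψ)

/-- Complete positivity of a map on `M`. -/
def IsCompletelyPositiveMap (ψ : ↥M →L[ℂ] ↥M) : Prop :=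
  ∀ (n : ℕ) (a : Fin n → ↥M) (v : Fin n → H),
    0 ≤ ∑ i, ∑ j, ⟪v i, ((ψ (star (a i) * a j) : ↥M) : H →L[ℂ] H) (v j)⟫

/-- The norm `‖cω‖` of the functional `x ↦ ω (c * x)`. -/
def mulNorm (ω : ↥M →L[ℂ] ℂ) (c : ↥M) : ℝ :=
  sSup {r : ℝ | ∃ x : ↥M, ‖x‖ ≤ 1 ∧ r = ‖ω (c * x)‖}

/-- Norm-closed two-sided ideals of `M`. -/
def IsClosedIdeal (J : Set ↥M) : Prop :=
  IsClosed J ∧ (0 : ↥M) ∈ J ∧ (∀ x ∈ J, ∀ y ∈ J, x + y ∈ J) ∧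
    (∀ (c : ℂ), ∀ x ∈ J, c • x ∈ J) ∧ (∀ (a : ↥M), ∀ x ∈ J, a * x ∈ J ∧ x * a ∈ J)

/-- The norm `‖ω|J‖` of the restriction of a functional `ω` to a subset `J`. -/
def normRestrict (ω : ↥M →L[ℂ] ℂ) (J : Set ↥M) : ℝ :=
  sSup {r : ℝ | ∃ x ∈ J, ‖x‖ ≤ 1 ∧ r = ‖ω x‖}

/-- Maximal (norm-closed two-sided) ideals of `M`. -/
def IsMaximalIdeal (N : Set ↥M) : Prop :=
  IsClosedIdeal N ∧ N ≠ Set.univ ∧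
    ∀ N' : Set ↥M, IsClosedIdeal N' → N' ≠ Set.univ → N ⊆ N' → N' = N

/-- The strong radical of `M`: the intersection of all maximal ideals. -/
def strongRadical (M : VonNeumannAlgebra H) : Set ↥M :=
  ⋂₀ {N : Set ↥M | IsMaximalIdeal N}

/-- A state `ω` is maximally mixed if every state `ρ` in the weak* closure of
`ω ∘ E(M)` satisfies in turn that `ω` is in the weak* closure of `ρ ∘ E(M)`. -/
def IsMaximallyMixed (ω : ↥M →L[ℂ] ℂ) : Prop :=
  IsState ω ∧ ∀ ρ : ↥M →L[ℂ] ℂ, IsState ρ →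
    InWeakStarClosure (mixSet ω) ρ → InWeakStarClosure (mixSet ρ) ω

/-- `p` is a central projection of `M`. -/
def IsCentralProjection (p : ↥M) : Prop :=
  p ∈ Set.center ↥M ∧ IsSelfAdjoint p ∧ IsIdempotentElem p

/-- A projection `p` is finite if it is not Murray–von Neumann equivalent to a
proper subprojection of itself. -/
def IsFiniteProjection (p : ↥M) : Prop :=
  IsSelfAdjoint p ∧ IsIdempotentElem p ∧
    ∀ v : ↥M, star v * v = p → p * (v * star v) = v * star v → v * star v = p

/-- `M` is properly infinite: it contains no nonzero finite central
projection. -/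
def ProperlyInfinite (M : VonNeumannAlgebra H) : Prop :=
  ∀ p : ↥M, IsCentralProjection p → IsFiniteProjection p → p = 0

/-- An ideal of the center `Z` of `M` (a norm-closed subspace of the center,
stable under multiplication by central elements). -/
def IsCenterIdeal (t : Set ↥M) : Prop :=
  t ⊆ Set.center ↥M ∧ IsClosed t ∧ (0 : ↥M) ∈ t ∧
    (∀ x ∈ t, ∀ y ∈ t, x + y ∈ t) ∧ (∀ (c : ℂ), ∀ x ∈ t, c • x ∈ t) ∧
    ∀ z ∈ Set.center ↥M, ∀ x ∈ t, z * x ∈ t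

/-- A maximal ideal of the center `Z` of `M`, i.e. a point of the maximal ideal
space `Δ` of `Z`. -/
def IsMaxCenterIdeal (t : Set ↥M) : Prop :=
  IsCenterIdeal t ∧ t ≠ Set.center ↥M ∧
    ∀ s : Set ↥M, IsCenterIdeal s → s ≠ Set.center ↥M → t ⊆ s → s = t

open ContinuousLinearMap in
theorem polar_op (x : H →L[ℂ] H) : ∃ U P T : H →L[ℂ] H, star U * U = P ∧ U * P = U ∧
    star P = P ∧ P * P = P ∧ x * P = x ∧ T = CFC.abs x ∧ U * T = x ∧
    (∀ y : H →L[ℂ] H, x * y = 0 → P * y = 0) ∧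
    (∀ a b : H →L[ℂ] H, a * T = b * T → a * P = b * P) := by
  set T := CFC.abs x with hT
  have hTsa : star T = T := (CFC.abs_nonneg x).isSelfAdjoint
  have hTT : T * T = star x * x := CFC.abs_mul_abs x
  have hnorm : ∀ ξ, ‖x ξ‖ = ‖T ξ‖ := by
    intro ξ
    have h1 : inner ℂ (x ξ) (x ξ) = inner ℂ (T ξ) (T ξ) := by
      rw [← adjoint_inner_left, ← adjoint_inner_left, ← star_eq_adjoint, ← star_eq_adjoint,
        ← mul_apply_eq_comp, ← mul_apply_eq_comp, hTsa, hTT]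
    rw [inner_self_eq_norm_sq_to_K, inner_self_eq_norm_sq_to_K] at h1
    have h2 : ‖x ξ‖ ^ 2 = ‖T ξ‖ ^ 2 := by exact_mod_cast h1
    exact (pow_left_inj₀ (norm_nonneg _) (norm_nonneg _) two_ne_zero).1 h2
  set K : Submodule ℂ H := (LinearMap.range T.toLinearMap).topologicalClosure with hK
  have hKc : IsClosed (K : Set H) := Submodule.isClosed_topologicalClosure _
  have : CompleteSpace K := hKc.completeSpace_coe
  have hmem : ∀ ξ, T ξ ∈ K := fun ξ => Submodule.le_topologicalClosure _ ⟨ξ, rfl⟩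
  let e : H →ₗ[ℂ] K := T.toLinearMap.codRestrict K hmem
  have hed : DenseRange e := by
    intro k
    rw [Metric.mem_closure_iff]
    intro ε hε
    have hk : (k : H) ∈ closure (Set.range T) := by
      have h0 : (K : Set H) = closure (Set.range T) := by
        rw [hK, Submodule.topologicalClosure_coe]; rfl
      rw [← h0]; exact k.2
    obtain ⟨_, ⟨ξ, rfl⟩, h⟩ := Metric.mem_closure_iff.1 hk ε hε
    exact ⟨e ξ, ⟨ξ, rfl⟩, h⟩
  have hb : ∀ ξ, ‖x.toLinearMap ξ‖ ≤ 1 * ‖e ξ‖ := by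
    intro ξ; rw [one_mul]; exact (hnorm ξ).le
  let W : K →L[ℂ] H := x.toLinearMap.extendOfNorm e
  have hW : ∀ ξ, W (e ξ) = x ξ := fun ξ => LinearMap.extendOfNorm_eq hed ⟨1, hb⟩ ξ
  have hWn : ∀ k, ‖W k‖ = ‖k‖ := by
    intro k
    have : IsClosed {k : K | ‖W k‖ = ‖k‖} := isClosed_eq (by fun_prop) (by fun_prop)
    refine this.closure_subset_iff.2 ?_ (hed k)
    rintro _ ⟨ξ, rfl⟩
    show ‖W (e ξ)‖ = ‖e ξ‖
    rw [hW, hnorm]; rfl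
  let P := K.starProjection
  let U : H →L[ℂ] H := W ∘L K.orthogonalProjectionOnto
  have hPsa : star P = P := isSelfAdjoint_starProjection K
  have hPP : P * P = P := K.isIdempotentElem_starProjection
  have hPmem : ∀ ζ ∈ K, P ζ = ζ := fun ζ h => Submodule.starProjection_eq_self_iff.2 h
  have hPT : P * T = T := by ext ξ; exact hPmem _ (hmem ξ)
  have hTP : T * P = T := by
    have := congrArg star hPT
    rwa [star_mul, hTsa, hPsa] at this
  have hUT : U * T = x := by
    ext ξ
    show W (K.orthogonalProjectionOnto (T ξ)) = x ξ
    rw [← hW]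
    congr 1
    have := Submodule.orthogonalProjectionOnto_mem_subspace_eq_self (K := K) (e ξ)
    exact this
  refine ⟨U, P, T, ?_, ?_, hPsa, hPP, ?_, rfl, hUT, ?_, ?_⟩
  · rw [ContinuousLinearMap.ext_iff]
    have : (star U * U).toLinearMap = P.toLinearMap := by
      rw [← ext_inner_map]
      intro ξ
      show inner ℂ (star U (U ξ)) ξ = inner ℂ (P ξ) ξ
      have h3 : P ξ = star P (P ξ) := by rw [hPsa, ← mul_apply_eq_comp, hPP]
      rw [h3, star_eq_adjoint, star_eq_adjoint, adjoint_inner_left, adjoint_inner_left,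
        inner_self_eq_norm_sq_to_K, inner_self_eq_norm_sq_to_K]
      congr 2
      show ‖W (K.orthogonalProjectionOnto ξ)‖ = _
      rw [hWn]; rfl
    intro ξ
    exact LinearMap.congr_fun this ξ
  · ext ξ
    show W (K.orthogonalProjectionOnto (K.starProjection ξ)) = W (K.orthogonalProjectionOnto ξ)
    congr 1
    exact Submodule.orthogonalProjectionOnto_mem_subspace_eq_self (K := K) _
  · rw [← hUT, mul_assoc, hTP]
  · intro y hy
    have hTy : T * y = 0 := by
      ext ξ
      have := hnorm (y ξ)
      have h0 : x (y ξ) = 0 := by rw [← mul_apply_eq_comp, hy]; rfl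
      rw [h0, norm_zero] at this
      exact norm_eq_zero.1 this.symm
    ext ξ
    show K.starProjection (y ξ) = 0
    rw [Submodule.starProjection_apply_eq_zero_iff, hK, Submodule.orthogonal_closure,
      Submodule.mem_orthogonal]
    rintro _ ⟨η, rfl⟩
    show inner ℂ (T η) (y ξ) = 0
    rw [← hTsa, star_eq_adjoint, adjoint_inner_left, ← mul_apply_eq_comp, hTy]
    simp
  · intro a b hab
    have hcl : IsClosed {k : H | a k = b k} := isClosed_eq (by fun_prop) (by fun_prop)
    have hsub : (K : Set H) ⊆ {k : H | a k = b k} := by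
      rw [hK, Submodule.topologicalClosure_coe]
      refine hcl.closure_subset_iff.2 ?_
      rintro _ ⟨ξ, rfl⟩
      show (a * T) ξ = (b * T) ξ
      rw [hab]
    ext ξ
    exact hsub (Submodule.starProjection_apply_mem K ξ)

theorem mem_of_comm {x : H →L[ℂ] H} (h : ∀ b ∈ M.commutant, b * x = x * b) : x ∈ M := by
  rw [← VonNeumannAlgebra.commutant_commutant M, VonNeumannAlgebra.mem_commutant_iff]
  exact h

theorem comm_of_mem {x b : H →L[ℂ] H} (hx : x ∈ M) (hb : b ∈ M.commutant) : b * x = x * b :=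
  (VonNeumannAlgebra.mem_commutant_iff.1 hb x hx).symm

/-- Polar decomposition inside a von Neumann algebra. -/
theorem polar (x : ↥M) : ∃ U r : ↥M, star U * U = r ∧ U * r = U ∧ star r = r ∧ r * r = r ∧
    x * r = x ∧ (∀ y, x * y = 0 → r * y = 0) ∧ (∀ y, y * x = 0 → y * U = 0) := by
  obtain ⟨U, P, T, h1, h2, h3, h4, h5, hT, h6, h7, h8⟩ := polar_op (x : H →L[ℂ] H)
  have hTM : ∀ b ∈ M.commutant, b * T = T * b := by
    intro b hb
    have hbs : star b ∈ M.commutant := star_mem hb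
    rw [hT]
    exact ((Commute.cfcAbs_left (a := (x : H →L[ℂ] H)) (b := b)
      (comm_of_mem x.2 hb).symm (comm_of_mem x.2 hbs).symm)).symm
  have hTsa : star T = T := by rw [hT]; exact (CFC.abs_nonneg _).isSelfAdjoint
  have hPT : P * T = T := by
    have h9 : T * T = star (x : H →L[ℂ] H) * x := by rw [hT]; exact CFC.abs_mul_abs _
    rw [← h1, mul_assoc, h6]
    have e : star T * star U = star (x : H →L[ℂ] H) := by rw [← star_mul, h6]
    have e2 : (U * (1 - P)) = 0 := by rw [mul_sub, h2, mul_one, sub_self]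
    have e3 : ∀ a : H →L[ℂ] H, a * T = 0 → a * P = 0 := fun a ha => by
      simpa using h8 a 0 (by simpa using ha)
    have e4 : star U * (x : H →L[ℂ] H) = P * T := by rw [← h6, ← mul_assoc, h1]
    have e5 : (x : H →L[ℂ] H) * (1 - P) = 0 := by rw [mul_sub, h5, mul_one, sub_self]
    have e6 : T * (1 - P) = 0 := by
      have : star (T * (1 - P)) * (T * (1 - P)) = 0 := by
        rw [star_mul, hTsa, mul_assoc, ← mul_assoc T T, h9, mul_assoc, e5]; simp
      exact CStarRing.star_mul_self_eq_zero_iff _ |>.1 this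
    have e7 : T * P = T := by
      rw [mul_sub, mul_one] at e6; exact (sub_eq_zero.1 e6).symm
    have := congrArg star e7
    rw [star_mul, hTsa, h3] at this
    rw [e4, this]
  have hPM : P ∈ M := by
    refine mem_of_comm fun b hb => ?_
    have key : ∀ b ∈ M.commutant, b * P = P * b * P := by
      intro b hb
      refine h8 _ _ ?_
      rw [mul_assoc, hTM b hb, ← mul_assoc, hPT]
    have k1 := key b hb
    have k2 := congrArg star (key (star b) (star_mem hb))
    simp only [star_mul, star_star, h3] at k2
    rw [k1, mul_assoc, ← k2]
  have hUM : U ∈ M := by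
    refine mem_of_comm fun b hb => ?_
    have : b * U * P = U * b * P := by
      refine h8 _ _ ?_
      rw [mul_assoc, h6, mul_assoc, hTM b hb, ← mul_assoc, h6, comm_of_mem x.2 hb]
    rw [mul_assoc, h2, mul_assoc, comm_of_mem hPM hb, ← mul_assoc, h2] at this
    exact this
  refine ⟨⟨U, hUM⟩, ⟨P, hPM⟩, Subtype.ext h1, Subtype.ext h2, Subtype.ext h3, Subtype.ext h4,
    Subtype.ext h5, fun y hy => Subtype.ext (h7 y (congrArg Subtype.val hy)),
    fun y hy => Subtype.ext ?_⟩
  have h9 : (y : H →L[ℂ] H) * x = 0 := congrArg Subtype.val hy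
  have := h8 (y * U) 0 (by rw [mul_assoc, h6, h9, zero_mul])
  rw [mul_assoc, h2, zero_mul] at this
  exact this

open ContinuousLinearMap in
theorem glue_op {ι : Type*} (v : ι → (H →L[ℂ] H)) (hv : ∀ i, v i * (star (v i) * v i) = v i)
    (ho : ∀ i j, i ≠ j → v i * star (v j) = 0) (ho' : ∀ i j, i ≠ j → star (v i) * v j = 0) :
    ∃ V : H →L[ℂ] H, ∀ ξ, HasSum (fun i => v i ξ) (V ξ) := by
  classical
  have hin : ∀ i j, i ≠ j → ∀ a b, inner ℂ (v i a) (v j b) = 0 := by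
    intro i j hij a b
    rw [← adjoint_inner_right, ← star_eq_adjoint, ← mul_apply_eq_comp, ho' i j hij]
    simp
  have hV : OrthogonalFamily ℂ (fun i => ↥(LinearMap.range (v i).toLinearMap))
      (fun i => (LinearMap.range (v i).toLinearMap).subtypeₗᵢ) := by
    intro i j hij
    rintro ⟨_, a, rfl⟩ ⟨_, b, rfl⟩
    exact hin i j hij a b
  have hbes : ∀ ξ (s : Finset ι), ∑ i ∈ s, ‖v i ξ‖ ^ 2 ≤ ‖ξ‖ ^ 2 := by
    intro ξ s
    set E : H →L[ℂ] H := ∑ i ∈ s, star (v i) * v i with hE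
    have hEs : star E = E := by simp [hE, star_sum]
    have hEE : E * E = E := by
      rw [hE, Finset.sum_mul]
      refine Finset.sum_congr rfl fun i hi => ?_
      rw [Finset.mul_sum, Finset.sum_eq_single i]
      · rw [mul_assoc, hv]
      · intro j _ hj
        rw [mul_assoc, ← mul_assoc (v i), ho i j hj.symm]; simp
      · intro h; exact absurd hi h
    have h1 : ∑ i ∈ s, ‖v i ξ‖ ^ 2 = ‖E ξ‖ ^ 2 := by
      have : ((∑ i ∈ s, ‖v i ξ‖ ^ 2 : ℝ) : ℂ) = ((‖E ξ‖ ^ 2 : ℝ) : ℂ) := by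
        push_cast
        have h2 : inner ℂ (E ξ) (E ξ) = ((‖E ξ‖ : ℝ) : ℂ) ^ 2 := inner_self_eq_norm_sq_to_K _
        rw [← h2, ← adjoint_inner_left, ← star_eq_adjoint, hEs, ← mul_apply_eq_comp, hEE, hE,
          _root_.sum_apply, sum_inner]
        refine Finset.sum_congr rfl fun i _ => ?_
        rw [mul_apply_eq_comp, star_eq_adjoint, adjoint_inner_left]
        exact (inner_self_eq_norm_sq_to_K (𝕜 := ℂ) (v i ξ)).symm
      exact_mod_cast this
    have h3 : ‖E ξ‖ ^ 2 ≤ ‖ξ‖ * ‖E ξ‖ := by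
      have h2 : inner ℂ (E ξ) (E ξ) = ((‖E ξ‖ : ℝ) : ℂ) ^ 2 := inner_self_eq_norm_sq_to_K _
      have h4 : inner ℂ (E ξ) (E ξ) = inner ℂ (E ξ) ξ := by
        nth_rewrite 1 [← adjoint_inner_left]
        rw [← star_eq_adjoint, hEs, ← mul_apply_eq_comp, hEE]
      have h5 : ‖E ξ‖ ^ 2 = ‖inner ℂ (E ξ) ξ‖ := by
        rw [← h4, h2]; simp
      rw [h5, mul_comm]
      exact norm_inner_le_norm _ _
    rw [h1]
    have := norm_nonneg (E ξ)
    nlinarith [norm_nonneg ξ, sq_nonneg (‖ξ‖ - ‖E ξ‖)]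
  have hsum : ∀ ξ, Summable (fun i => v i ξ) := by
    intro ξ
    have := (hV.summable_iff_norm_sq_summable (fun i => ⟨v i ξ, ξ, rfl⟩)).2
      (summable_of_sum_le (c := ‖ξ‖ ^ 2) (fun i => by positivity) (fun s => hbes ξ s))
    exact this
  let L : H →ₗ[ℂ] H :=
    { toFun := fun ξ => ∑' i, v i ξ
      map_add' := fun a b => by
        simp only [map_add]; exact (hsum a).tsum_add (hsum b)
      map_smul' := fun c a => by
        simp only [map_smul, RingHom.id_apply]; exact (hsum a).tsum_const_smul c }
  refine ⟨L.mkContinuous 1 ?_, fun ξ => (hsum ξ).hasSum⟩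
  intro ξ
  rw [one_mul]
  refine le_of_tendsto ((hsum ξ).hasSum.norm) (Filter.Eventually.of_forall fun s => ?_)
  have h := hV.norm_sum (fun i => ⟨v i ξ, ξ, rfl⟩) s
  have h2 : ‖∑ i ∈ s, v i ξ‖ ^ 2 ≤ ‖ξ‖ ^ 2 := h.trans_le (hbes ξ s)
  exact (pow_le_pow_iff_left₀ (norm_nonneg _) (norm_nonneg _) two_ne_zero).1 h2

open ContinuousLinearMap in
/-- Strong sums of orthogonal partial isometries. -/
theorem glue {ι : Type*} (v : ι → ↥M) (hv : ∀ i, v i * (star (v i) * v i) = v i)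
    (ho : ∀ i j, i ≠ j → v i * star (v j) = 0) (ho' : ∀ i j, i ≠ j → star (v i) * v j = 0) :
    ∃ V : ↥M, (∀ i, V * star (v i) = v i * star (v i)) ∧
      (∀ i, star V * v i = star (v i) * v i) ∧
      (∀ y, (∀ i, y * v i = 0) → y * V = 0) ∧ (∀ y, (∀ i, v i * y = 0) → V * y = 0) := by
  obtain ⟨V, hV⟩ := glue_op (fun i => (v i : H →L[ℂ] H)) (fun i => congrArg Subtype.val (hv i))
    (fun i j h => congrArg Subtype.val (ho i j h)) (fun i j h => congrArg Subtype.val (ho' i j h))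
  have hv2 : ∀ i, star (v i) * (star (star (v i)) * star (v i)) = star (v i) := by
    intro i
    have := congrArg star (hv i)
    simpa [mul_assoc] using this
  obtain ⟨W, hW⟩ := glue_op (fun i => star (v i : H →L[ℂ] H))
    (fun i => congrArg Subtype.val (hv2 i))
    (fun i j h => by rw [star_star]; exact congrArg Subtype.val (ho' i j h))
    (fun i j h => by rw [star_star]; exact congrArg Subtype.val (ho i j h))
  have hVW : star V = W := by
    rw [star_eq_adjoint]
    refine ((eq_adjoint_iff W V).2 fun a b => ?_).symm
    have h1 : HasSum (fun i => inner ℂ (star (v i : H →L[ℂ] H) a) b) (inner ℂ (W a) b) :=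
      (hW a).map (AddMonoidHom.mk' (fun x => inner ℂ x b) (fun x y => inner_add_left x y b))
        (continuous_id.inner continuous_const)
    have h2 : HasSum (fun i => inner ℂ a ((v i : H →L[ℂ] H) b)) (inner ℂ a (V b)) :=
      (innerSL ℂ a).hasSum (hV b)
    have h3 : (fun i => inner ℂ (star (v i : H →L[ℂ] H) a) b) =
        fun i => inner ℂ a ((v i : H →L[ℂ] H) b) := by
      funext i
      rw [star_eq_adjoint, adjoint_inner_left]
    rw [h3] at h1
    exact h1.unique h2
  have hVM : V ∈ M := by
    refine mem_of_comm fun b hb => ?_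
    ext ξ
    have h1 : HasSum (fun i => b ((v i : H →L[ℂ] H) ξ)) (b (V ξ)) := b.hasSum (hV ξ)
    have h2 := hV (b ξ)
    have h3 : (fun i => b ((v i : H →L[ℂ] H) ξ)) = fun i => (v i : H →L[ℂ] H) (b ξ) := by
      funext i
      exact DFunLike.congr_fun (comm_of_mem (v i).2 hb) ξ
    rw [h3] at h1
    exact h1.unique h2
  have hy1 : ∀ y : ↥M, (∀ i, y * v i = 0) → y * ⟨V, hVM⟩ = 0 := by
    intro y hy
    refine Subtype.ext ?_
    ext ξ
    have h1 : HasSum (fun i => (y : H →L[ℂ] H) ((v i : H →L[ℂ] H) ξ)) ((y : H →L[ℂ] H) (V ξ)) :=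
      (y : H →L[ℂ] H).hasSum (hV ξ)
    have h3 : (fun i => (y : H →L[ℂ] H) ((v i : H →L[ℂ] H) ξ)) = fun i => 0 := by
      funext i
      exact DFunLike.congr_fun (congrArg Subtype.val (hy i)) ξ
    rw [h3] at h1
    exact h1.unique hasSum_zero
  have hy2 : ∀ y : ↥M, (∀ i, v i * y = 0) → ⟨V, hVM⟩ * y = 0 := by
    intro y hy
    refine Subtype.ext ?_
    ext ξ
    have h1 := hV ((y : H →L[ℂ] H) ξ)
    have h3 : (fun i => (v i : H →L[ℂ] H) ((y : H →L[ℂ] H) ξ)) = fun i => 0 := by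
      funext i
      exact DFunLike.congr_fun (congrArg Subtype.val (hy i)) ξ
    rw [h3] at h1
    exact h1.unique hasSum_zero
  refine ⟨⟨V, hVM⟩, fun i => Subtype.ext ?_, fun i => Subtype.ext ?_, hy1, hy2⟩
  · ext ξ
    have h1 := hV (star (v i : H →L[ℂ] H) ξ)
    have h2 := hasSum_single (f := fun j => (v j : H →L[ℂ] H) (star (v i : H →L[ℂ] H) ξ)) i
      (fun j hj => DFunLike.congr_fun (congrArg Subtype.val (ho j i hj)) ξ)
    exact h1.unique h2
  · ext ξ
    show star V _ = _
    rw [hVW]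
    have h1 := hW ((v i : H →L[ℂ] H) ξ)
    have h2 := hasSum_single (f := fun j => star (v j : H →L[ℂ] H) ((v i : H →L[ℂ] H) ξ)) i
      (fun j hj => DFunLike.congr_fun (congrArg Subtype.val (ho' j i hj)) ξ)
    exact h1.unique h2

open ContinuousLinearMap in
theorem central_support (q : ↥M) : ∃ f : ↥M, f ∈ Set.center ↥M ∧ star f = f ∧ f * f = f ∧
    f * q = q ∧ ∀ p : ↥M, (∀ x : ↥M, p * x * q = 0) → p * f = 0 := by
  set S : Set H := {ζ | ∃ (x : ↥M) (ξ : H), ζ = (x : H →L[ℂ] H) ((q : H →L[ℂ] H) ξ)} with hS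
  set K : Submodule ℂ H := (Submodule.span ℂ S).topologicalClosure with hK
  have hKc : IsClosed (K : Set H) := Submodule.isClosed_topologicalClosure _
  have : CompleteSpace K := hKc.completeSpace_coe
  have hinv : ∀ a : H →L[ℂ] H, (∀ ζ ∈ S, a ζ ∈ K) → ∀ ζ ∈ K, a ζ ∈ K := by
    intro a ha ζ hζ
    have h1 : Submodule.span ℂ S ≤ K.comap a.toLinearMap := Submodule.span_le.2 ha
    have h2 : IsClosed ((K.comap a.toLinearMap : Submodule ℂ H) : Set H) :=
      hKc.preimage a.continuous
    exact Submodule.topologicalClosure_minimal _ h1 h2 hζ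
  have hSK : ∀ ζ ∈ S, ζ ∈ K := fun ζ h =>
    Submodule.le_topologicalClosure _ (Submodule.subset_span h)
  set P := K.starProjection with hP
  have hPsa : star P = P := isSelfAdjoint_starProjection K
  have hPP : P * P = P := K.isIdempotentElem_starProjection
  have hPmem : ∀ ζ ∈ K, P ζ = ζ := fun ζ h => Submodule.starProjection_eq_self_iff.2 h
  have hcomm : ∀ a : H →L[ℂ] H, (∀ ζ ∈ S, a ζ ∈ K) → (∀ ζ ∈ S, star a ζ ∈ K) →
      a * P = P * a := by
    intro a h1 h2
    have e1 : P * a * P = a * P := by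
      ext ξ; exact hPmem _ (hinv a h1 _ (Submodule.starProjection_apply_mem K ξ))
    have e2 : P * star a * P = star a * P := by
      ext ξ; exact hPmem _ (hinv _ h2 _ (Submodule.starProjection_apply_mem K ξ))
    have e3 := congrArg star e2
    simp only [star_mul, star_star, hPsa] at e3
    rw [← e1, mul_assoc, e3]
  have hPM : P ∈ M := by
    refine mem_of_comm fun b hb => ?_
    have key : ∀ b ∈ M.commutant, ∀ ζ ∈ S, b ζ ∈ K := by
      rintro b hb _ ⟨x, ξ, rfl⟩
      refine hSK _ ⟨x, b ξ, ?_⟩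
      have := DFunLike.congr_fun (comm_of_mem (x * q).2 hb) ξ
      exact this
    exact hcomm b (key b hb) (key _ (star_mem hb))
  have hPz : ∀ x : ↥M, (x : H →L[ℂ] H) * P = P * x := by
    have key : ∀ x : ↥M, ∀ ζ ∈ S, (x : H →L[ℂ] H) ζ ∈ K := by
      rintro y _ ⟨x, ξ, rfl⟩
      exact hSK _ ⟨y * x, ξ, rfl⟩
    intro x
    exact hcomm x (key x) (key (star x))
  refine ⟨⟨P, hPM⟩, ?_, Subtype.ext hPsa, Subtype.ext hPP, Subtype.ext ?_, ?_⟩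
  · rw [Semigroup.mem_center_iff]
    intro g; exact Subtype.ext (hPz g)
  · ext ξ
    exact hPmem _ (hSK _ ⟨1, ξ, rfl⟩)
  · intro p hp
    refine Subtype.ext ?_
    ext ξ
    have hcl : IsClosed ((LinearMap.ker (p : H →L[ℂ] H).toLinearMap : Submodule ℂ H) : Set H) :=
      isClosed_singleton.preimage (p : H →L[ℂ] H).continuous
    have h1 : Submodule.span ℂ S ≤ LinearMap.ker (p : H →L[ℂ] H).toLinearMap := by
      refine Submodule.span_le.2 ?_
      rintro _ ⟨x, η, rfl⟩
      exact DFunLike.congr_fun (congrArg Subtype.val (hp x)) η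
    exact Submodule.topologicalClosure_minimal _ h1 hcl (Submodule.starProjection_apply_mem K ξ)

theorem inv_mem {x w : H →L[ℂ] H} (hx : x ∈ M) (h1 : w * x = 1) (h2 : x * w = 1) : w ∈ M := by
  refine mem_of_comm fun b hb => ?_
  have h := comm_of_mem hx hb
  calc b * w = w * x * (b * w) := by rw [h1, one_mul]
    _ = w * (x * b) * w := by simp only [mul_assoc]
    _ = w * (b * x) * w := by rw [h]
    _ = w * b * (x * w) := by simp only [mul_assoc]
    _ = w * b := by rw [h2, mul_one]

theorem inv_near_one (u : ↥M) (hu : ‖1 - u‖ < 1) : ∃ w : ↥M, w * u = 1 ∧ u * w = 1 := by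
  have hu' : ‖(1 : H →L[ℂ] H) - u‖ < 1 := hu
  let U := Units.oneSub (1 - (u : H →L[ℂ] H)) hu'
  have hU : (U : H →L[ℂ] H) = u := by simp [U]
  have h1 : ((U⁻¹ : (H →L[ℂ] H)ˣ) : H →L[ℂ] H) * u = 1 := by rw [← hU]; simp
  have h2 : (u : H →L[ℂ] H) * ((U⁻¹ : (H →L[ℂ] H)ˣ) : H →L[ℂ] H) = 1 := by rw [← hU]; simp
  exact ⟨⟨_, inv_mem u.2 h1 h2⟩, Subtype.ext h1, Subtype.ext h2⟩

theorem mem_center {z : ↥M} : z ∈ Set.center ↥M ↔ ∀ g : ↥M, g * z = z * g :=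
  Semigroup.mem_center_iff

theorem inv_center {u w : ↥M} (hu : u ∈ Set.center ↥M) (h1 : w * u = 1) (h2 : u * w = 1) :
    w ∈ Set.center ↥M := by
  rw [mem_center] at *
  intro b
  calc b * w = w * u * (b * w) := by rw [h1, one_mul]
    _ = w * (u * b) * w := by simp only [mul_assoc]
    _ = w * (b * u) * w := by rw [hu]
    _ = w * b * (u * w) := by simp only [mul_assoc]
    _ = w * b := by rw [h2, mul_one]

open ContinuousLinearMap in
theorem spectral_op (x : H →L[ℂ] H) (δ : ℝ) (hδ : 0 < δ) :
    ∃ b c d : H →L[ℂ] H, star x * x = algebraMap ℝ _ δ + b - c ∧ b * c = 0 ∧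
      (∀ y, (star x * x) * y = y * (star x * x) → b * y = y * b) ∧
      (∀ y, (star x * x) * y = y * (star x * x) → d * y = y * d) ∧
      d * (algebraMap ℝ _ δ + b) = 1 ∧ (algebraMap ℝ _ δ + b) * d = 1 ∧ 
      ∀ r : H →L[ℂ] H, star r = r → r * r = r → b * r = b → ‖x * (1 - r)‖ ^ 2 ≤ δ := by
  set a := star x * x with ha
  have hasa : IsSelfAdjoint a := IsSelfAdjoint.star_mul_self x
  set b0 := a - algebraMap ℝ _ δ with hb0
  have hsb0 : IsSelfAdjoint b0 := hasa.sub (IsSelfAdjoint.algebraMap _ (.all _))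
  have hpn := CFC.posPart_sub_negPart b0 hsb0
  have hcomm : ∀ y, a * y = y * a → b0⁺ * y = y * b0⁺ := by
    intro y hy
    have : Commute b0 y := by
      refine Commute.sub_left hy (Algebra.commutes _ _)
    exact this.cfcₙ_real _
  have hunit : IsUnit (algebraMap ℝ (H →L[ℂ] H) δ + b0⁺) := by
    have hs : IsStrictlyPositive (algebraMap ℝ (H →L[ℂ] H) δ) :=
      isStrictlyPositive_algebraMap hδ
    exact (hs.add_nonneg (CFC.posPart_nonneg b0)).isUnit
  obtain ⟨U, hU⟩ := hunit
  have e1 : ((U⁻¹ : (H →L[ℂ] H)ˣ) : H →L[ℂ] H) * (algebraMap ℝ _ δ + b0⁺) = 1 := by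
    rw [← hU]; simp
  have e2 : (algebraMap ℝ _ δ + b0⁺) * ((U⁻¹ : (H →L[ℂ] H)ˣ) : H →L[ℂ] H) = 1 := by
    rw [← hU]; simp
  have haeq : a = algebraMap ℝ _ δ + b0⁺ - b0⁻ := by
    rw [add_sub_assoc, hpn, hb0]; abel
  refine ⟨b0⁺, b0⁻, ((U⁻¹ : (H →L[ℂ] H)ˣ) : H →L[ℂ] H), haeq, CFC.posPart_mul_negPart b0, hcomm,
    ?_, e1, e2, ?_⟩
  · intro y hy
    have h1 : Commute (U : H →L[ℂ] H) y := by
      rw [hU]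
      exact Commute.add_left (Algebra.commutes _ _) (hcomm y hy)
    exact h1.units_inv_left
  · intro r hr hrr hbr
    have h0 : b0⁺ * (1 - r) = 0 := by rw [mul_sub, hbr, mul_one, sub_self]
    have hss : star (1 - r) = 1 - r := by rw [star_sub, star_one, hr]
    have h1 : star (x * (1 - r)) * (x * (1 - r)) ≤ algebraMap ℝ _ δ := by
      have e3 : star (x * (1 - r)) * (x * (1 - r)) = star (1 - r) * a * (1 - r) := by
        rw [star_mul, ha]; simp only [mul_assoc]
      have e4 : star (1 - r) * a * (1 - r) = algebraMap ℝ _ δ - algebraMap ℝ _ δ * r 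
          - star (1 - r) * b0⁻ * (1 - r) := by
        have e5 : (1 - r) * (1 - r) = 1 - r := by
          rw [mul_sub, mul_one, sub_mul, hrr]; simp
        have e6 : algebraMap ℝ (H →L[ℂ] H) δ * (1 - r) = (1 - r) * algebraMap ℝ (H →L[ℂ] H) δ :=
          Algebra.commutes _ _
        have e7 : algebraMap ℝ (H →L[ℂ] H) δ - algebraMap ℝ (H →L[ℂ] H) δ * r =
            algebraMap ℝ (H →L[ℂ] H) δ * (1 - r) := by rw [mul_sub, mul_one]
        rw [e7, haeq, hss]
        generalize (1 - r) = q at *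
        calc q * (algebraMap ℝ (H →L[ℂ] H) δ + b0⁺ - b0⁻) * q
            = q * algebraMap ℝ (H →L[ℂ] H) δ * q + q * (b0⁺ * q) - q * b0⁻ * q := by noncomm_ring
          _ = _ := by rw [h0, ← e6, mul_assoc, e5, mul_zero, add_zero]
      rw [e3, e4]
      have p1 : 0 ≤ star (1 - r) * b0⁻ * (1 - r) :=
        star_left_conjugate_nonneg (CFC.negPart_nonneg b0) _
      have p2 : 0 ≤ algebraMap ℝ (H →L[ℂ] H) δ * r := by
        rw [← Algebra.smul_def, ← hrr]
        nth_rewrite 1 [← hr]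
        exact smul_nonneg hδ.le (star_mul_self_nonneg r)
      have := add_nonneg p1 p2
      rw [← sub_nonneg]
      convert this using 1
      abel
    have h2 := (CStarAlgebra.norm_le_iff_le_algebraMap _ hδ.le (star_mul_self_nonneg _)).2 h1
    rwa [CStarRing.norm_star_mul_self, ← sq] at h2

/-- The right support of a central element is central. -/
theorem support_center {x r : ↥M} (hx : x ∈ Set.center ↥M) (hr : star r = r) (hxr : x * r = x)
    (h : ∀ y, x * y = 0 → r * y = 0) : r ∈ Set.center ↥M := by
  rw [mem_center] at *
  have key : ∀ m : ↥M, r * m = r * m * r := by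
    intro m
    have h1 : x * (m * (1 - r)) = 0 := by
      rw [← mul_assoc, ← hx, mul_assoc, mul_sub, hxr, mul_one, sub_self, mul_zero]
    have h2 := h _ h1
    rw [mul_sub, mul_one, mul_sub, sub_eq_zero] at h2
    rw [mul_assoc]; exact h2
  intro m
  have h1 := congrArg star (key (star m))
  simp only [star_mul, star_star, hr] at h1
  rw [h1, ← mul_assoc]; exact (key m).symm

/-- Spectral projections in a von Neumann algebra. -/
theorem spectral (x : ↥M) (ε : ℝ) (hε : 0 < ε) : ∃ r α β : ↥M, star r = r ∧ r * r = r ∧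
    r = α * x * β ∧ ‖x * (1 - r)‖ ≤ ε ∧
    (x ∈ Set.center ↥M → r ∈ Set.center ↥M ∧ ∃ γ ∈ Set.center ↥M, r = γ * x) := by
  obtain ⟨b, c, d, h1, h2, h3, h4, h5, h6, h7⟩ := spectral_op (x : H →L[ℂ] H) (ε ^ 2) (by positivity)
  have hcom : ∀ y ∈ M.commutant, (star (x : H →L[ℂ] H) * x) * y = y * (star (x : H →L[ℂ] H) * x) :=
    fun y hy => (comm_of_mem (star x * x).2 hy).symm
  have hbM : b ∈ M := mem_of_comm fun y hy => (h3 y (hcom y hy)).symm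
  have hdM : d ∈ M := mem_of_comm fun y hy => (h4 y (hcom y hy)).symm
  obtain ⟨U, r, -, -, hr, hrr, hbr, hsup, -⟩ := polar (⟨b, hbM⟩ : ↥M)
  have hbr' : b * (r : H →L[ℂ] H) = b := congrArg Subtype.val hbr
  have hcM : c ∈ M := by
    have : c = algebraMap ℝ (H →L[ℂ] H) (ε ^ 2) + b - star (x : H →L[ℂ] H) * x := by
      rw [h1]; abel
    rw [this]
    refine sub_mem (add_mem ?_ hbM) (star x * x).2
    exact mem_of_comm fun y _ => (Algebra.commutes _ _).symm
  have hrc : (r : H →L[ℂ] H) * c = 0 := congrArg Subtype.val (hsup ⟨c, hcM⟩ (Subtype.ext h2))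
  have hreq : r = r * star x * x * ⟨d, hdM⟩ := by
    apply Subtype.ext
    show (r : H →L[ℂ] H) = r * star (x : H →L[ℂ] H) * x * d
    rw [mul_assoc (r : H →L[ℂ] H), h1, mul_sub, hrc, sub_zero, mul_assoc, h6, mul_one]
  refine ⟨r, r * star x, ⟨d, hdM⟩, hr, hrr, hreq, ?_, ?_⟩
  · have := h7 r (congrArg Subtype.val hr) (congrArg Subtype.val hrr) hbr'
    exact (pow_le_pow_iff_left₀ (norm_nonneg _) hε.le two_ne_zero).1 this
  · intro hx
    have hx' := mem_center.1 hx
    have h8 : ∀ g : ↥M, g * star x = star x * g := by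
      intro g
      have := congrArg star (hx' (star g))
      simpa using this.symm
    have h9 : ∀ g : ↥M, (star (x : H →L[ℂ] H) * x) * g = g * (star (x : H →L[ℂ] H) * x) := by
      intro g
      have : star x * x * g = g * (star x * x) := by
        rw [mul_assoc, ← hx' g, ← mul_assoc, ← h8, mul_assoc]
      exact congrArg Subtype.val this
    have hrc : r ∈ Set.center ↥M :=
      support_center (mem_center.2 fun g => Subtype.ext (h3 g (h9 g)).symm) hr hbr hsup
    have hdc : (⟨d, hdM⟩ : ↥M) ∈ Set.center ↥M :=
      mem_center.2 fun g => Subtype.ext (h4 g (h9 g)).symm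
    refine ⟨hrc, r * star x * ⟨d, hdM⟩,
      Set.mul_mem_center (Set.mul_mem_center hrc (mem_center.2 h8)) hdc, ?_⟩
    rw [mul_assoc _ _ x, ← mem_center.1 hdc x, ← mul_assoc]
    exact hreq

/-- Algebraic ideals relative to a subset `S` (the algebra or its center). -/
structure AI (S D : Set ↥M) : Prop where
  sub : D ⊆ S
  zero : (0 : ↥M) ∈ D
  add : ∀ x ∈ D, ∀ y ∈ D, x + y ∈ D
  smul : ∀ c : ℂ, ∀ x ∈ D, c • x ∈ D
  mul : ∀ a ∈ S, ∀ x ∈ D, a * x ∈ D ∧ x * a ∈ D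

/-- Subsets to which the ideal machinery applies. -/
structure GoodS (S : Set ↥M) : Prop where
  closed : IsClosed S
  inv : ∀ u ∈ S, ∀ w : ↥M, w * u = 1 → u * w = 1 → w ∈ S

theorem good_univ : GoodS (Set.univ : Set ↥M) := ⟨isClosed_univ, fun _ _ _ _ _ => Set.mem_univ _⟩

theorem good_center : GoodS (Set.center ↥M) := by
  refine ⟨?_, fun u hu w h1 h2 => inv_center hu h1 h2⟩
  have : Set.center ↥M = ⋂ g : ↥M, {z : ↥M | g * z = z * g} := by
    ext z; simp only [mem_center, Set.mem_iInter, Set.mem_ofPred_eq]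
  rw [this]
  exact isClosed_iInter fun g => isClosed_eq (by fun_prop) (by fun_prop)

theorem AI.closure {S D : Set ↥M} (hS : GoodS S) (h : AI S D) : AI S (_root_.closure D) where
  sub := closure_minimal h.sub hS.closed
  zero := subset_closure h.zero
  add := fun x hx y hy => map_mem_closure₂ (f := fun a b : ↥M => a + b) (by fun_prop) hx hy h.add
  smul := fun c x hx => map_mem_closure (f := fun a : ↥M => c • a) (by fun_prop) hx (h.smul c)
  mul := fun a ha x hx =>
    ⟨map_mem_closure (f := fun y : ↥M => a * y) (by fun_prop) hx fun y hy => (h.mul a ha y hy).1,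
     map_mem_closure (f := fun y : ↥M => y * a) (by fun_prop) hx fun y hy => (h.mul a ha y hy).2⟩

theorem AI.one_closure {S D : Set ↥M} (hS : GoodS S) (h : AI S D) (h1 : (1 : ↥M) ∈ _root_.closure D) :
    (1 : ↥M) ∈ D := by
  obtain ⟨y, hy, hd⟩ := Metric.mem_closure_iff.1 h1 1 one_pos
  rw [dist_eq_norm] at hd
  obtain ⟨w, hw1, hw2⟩ := inv_near_one y hd
  rw [← hw1]
  exact (h.mul w (hS.inv y (h.sub hy) w hw1 hw2) y hy).1

theorem exists_max {S D : Set ↥M} (hS : GoodS S) (h : AI S D) (h1 : (1 : ↥M) ∉ D) :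
    ∃ N, D ⊆ N ∧ AI S N ∧ IsClosed N ∧ (1 : ↥M) ∉ N ∧
      ∀ N', AI S N' → (1 : ↥M) ∉ N' → N ⊆ N' → N' = N := by
  obtain ⟨N, hDN, hN⟩ := zorn_subset_nonempty {N : Set ↥M | AI S N ∧ (1 : ↥M) ∉ N} (by
    intro c hc hchain hne
    refine ⟨⋃₀ c, ⟨⟨?_, ?_, ?_, ?_, ?_⟩, ?_⟩, fun s hs => Set.subset_sUnion_of_mem hs⟩
    · exact Set.sUnion_subset fun s hs => (hc hs).1.sub
    · obtain ⟨s, hs⟩ := hne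
      exact ⟨s, hs, (hc hs).1.zero⟩
    · rintro x ⟨s, hs, hx⟩ y ⟨s', hs', hy⟩
      rcases hchain.total hs hs' with h | h
      · exact ⟨s', hs', (hc hs').1.add _ (h hx) _ hy⟩
      · exact ⟨s, hs, (hc hs).1.add _ hx _ (h hy)⟩
    · rintro a x ⟨s, hs, hx⟩
      exact ⟨s, hs, (hc hs).1.smul a x hx⟩
    · rintro a ha x ⟨s, hs, hx⟩
      exact ⟨⟨s, hs, ((hc hs).1.mul a ha x hx).1⟩, ⟨s, hs, ((hc hs).1.mul a ha x hx).2⟩⟩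
    · rintro ⟨s, hs, hx⟩
      exact (hc hs).2 hx) D ⟨h, h1⟩
  refine ⟨N, hDN, hN.prop.1, ?_, hN.prop.2, fun N' h1 h2 h3 => (hN.eq_of_subset ⟨h1, h2⟩ h3).symm⟩
  have : closure N = N := (hN.eq_of_subset ⟨hN.prop.1.closure hS, fun hh =>
    hN.prop.2 (hN.prop.1.one_closure hS hh)⟩ subset_closure).symm
  rw [← this]; exact isClosed_closure

theorem closedIdeal_iff {J : Set ↥M} : IsClosedIdeal J ↔ AI Set.univ J ∧ IsClosed J := by
  constructor
  · rintro ⟨h1, h2, h3, h4, h5⟩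
    exact ⟨⟨Set.subset_univ _, h2, h3, h4, fun a _ => h5 a⟩, h1⟩
  · rintro ⟨h, h1⟩
    exact ⟨h1, h.zero, h.add, h.smul, fun a => h.mul a trivial⟩

theorem centerIdeal_iff {J : Set ↥M} :
    IsCenterIdeal J ↔ AI (Set.center ↥M) J ∧ IsClosed J := by
  constructor
  · rintro ⟨h1, h2, h3, h4, h5, h6⟩
    refine ⟨⟨h1, h3, h4, h5, fun a ha x hx => ⟨h6 a ha x hx, ?_⟩⟩, h2⟩
    rw [mem_center.1 ha]; exact h6 a ha x hx
  · rintro ⟨h, h1⟩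
    exact ⟨h.sub, h1, h.zero, h.add, h.smul, fun a ha x hx => (h.mul a ha x hx).1⟩

theorem one_mem_centerM : (1 : ↥M) ∈ Set.center ↥M := Set.one_mem_center

theorem ne_univ_iff {J : Set ↥M} (h : AI Set.univ J) : J ≠ Set.univ ↔ (1 : ↥M) ∉ J := by
  rw [not_iff_not]
  refine ⟨fun h => h ▸ trivial, fun h1 => Set.eq_univ_of_forall fun x => ?_⟩
  simpa using (h.mul x trivial 1 h1).1

theorem ne_center_iff {J : Set ↥M} (h : AI (Set.center ↥M) J) :
    J ≠ Set.center ↥M ↔ (1 : ↥M) ∉ J := by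
  rw [not_iff_not]
  refine ⟨fun h => h ▸ one_mem_centerM, fun h1 => h.sub.antisymm fun x hx => ?_⟩
  simpa using (h.mul x hx 1 h1).1

theorem exists_maximalIdeal {D : Set ↥M} (h : AI Set.univ D) (h1 : (1 : ↥M) ∉ D) :
    ∃ N, D ⊆ N ∧ IsMaximalIdeal N := by
  obtain ⟨N, h2, h3, h4, h5, h6⟩ := exists_max good_univ h h1
  refine ⟨N, h2, closedIdeal_iff.2 ⟨h3, h4⟩, (ne_univ_iff h3).2 h5, fun N' h7 h8 h9 => ?_⟩
  have := (closedIdeal_iff.1 h7).1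
  exact h6 N' this ((ne_univ_iff this).1 h8) h9

theorem exists_maxCenterIdeal {D : Set ↥M} (h : AI (Set.center ↥M) D) (h1 : (1 : ↥M) ∉ D) :
    ∃ N, D ⊆ N ∧ IsMaxCenterIdeal N := by
  obtain ⟨N, h2, h3, h4, h5, h6⟩ := exists_max good_center h h1
  refine ⟨N, h2, centerIdeal_iff.2 ⟨h3, h4⟩, (ne_center_iff h3).2 h5, fun N' h7 h8 h9 => ?_⟩
  have := (centerIdeal_iff.1 h7).1
  exact h6 N' this ((ne_center_iff this).1 h8) h9

/-- maximality against algebraic ideals -/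
theorem max_alg {N N' : Set ↥M} (h : IsMaximalIdeal N) (h' : AI Set.univ N') (h1 : (1 : ↥M) ∉ N')
    (hs : N ⊆ N') : N' ⊆ N := by
  have h2 := h'.closure good_univ
  have := h.2.2 (closure N') (closedIdeal_iff.2 ⟨h2, isClosed_closure⟩)
    ((ne_univ_iff h2).2 fun hh => h1 (h'.one_closure good_univ hh)) (hs.trans subset_closure)
  exact subset_closure.trans this.le

theorem maxc_alg {N N' : Set ↥M} (h : IsMaxCenterIdeal N) (h' : AI (Set.center ↥M) N')
    (h1 : (1 : ↥M) ∉ N') (hs : N ⊆ N') : N' ⊆ N := by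
  have h2 := h'.closure good_center
  have := h.2.2 (closure N') (centerIdeal_iff.2 ⟨h2, isClosed_closure⟩)
    ((ne_center_iff h2).2 fun hh => h1 (h'.one_closure good_center hh)) (hs.trans subset_closure)
  exact subset_closure.trans this.le

theorem max_absorb {N K : Set ↥M} (h : IsMaximalIdeal N) (h' : AI Set.univ K)
    (h1 : ∀ n ∈ N, ∀ y ∈ K, n + y = 1 → False) : K ⊆ N := by
  have hN := (closedIdeal_iff.1 h.1).1
  have := max_alg (N' := {z | ∃ n ∈ N, ∃ y ∈ K, n + y = z}) h ?_ ?_ ?_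
  · intro y hy
    exact this ⟨0, hN.zero, y, hy, zero_add _⟩
  · refine ⟨Set.subset_univ _, ⟨0, hN.zero, 0, h'.zero, add_zero _⟩, ?_, ?_, ?_⟩
    · rintro _ ⟨n, hn, y, hy, rfl⟩ _ ⟨n', hn', y', hy', rfl⟩
      exact ⟨_, hN.add _ hn _ hn', _, h'.add _ hy _ hy', by abel⟩
    · rintro c _ ⟨n, hn, y, hy, rfl⟩
      exact ⟨_, hN.smul c _ hn, _, h'.smul c _ hy, (smul_add _ _ _).symm⟩
    · rintro a - _ ⟨n, hn, y, hy, rfl⟩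
      exact ⟨⟨_, (hN.mul a trivial _ hn).1, _, (h'.mul a trivial _ hy).1, (mul_add _ _ _).symm⟩,
        ⟨_, (hN.mul a trivial _ hn).2, _, (h'.mul a trivial _ hy).2, (add_mul _ _ _).symm⟩⟩
  · rintro ⟨n, hn, y, hy, h⟩
    exact h1 n hn y hy h
  · intro n hn
    exact ⟨n, hn, 0, h'.zero, add_zero _⟩

theorem AI.inter_center {J : Set ↥M} (h : AI Set.univ J) :
    AI (Set.center ↥M) (J ∩ Set.center ↥M) where
  sub := Set.inter_subset_right
  zero := ⟨h.zero, Set.zero_mem_center⟩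
  add := fun x hx y hy => ⟨h.add _ hx.1 _ hy.1, Set.add_mem_center hx.2 hy.2⟩
  smul := fun c x hx => ⟨h.smul _ _ hx.1, by
    rw [mem_center]; intro g
    rw [mul_smul_comm, smul_mul_assoc, mem_center.1 hx.2]⟩
  mul := fun a ha x hx => ⟨⟨(h.mul a trivial x hx.1).1, Set.mul_mem_center ha hx.2⟩,
    ⟨(h.mul a trivial x hx.1).2, Set.mul_mem_center hx.2 ha⟩⟩

theorem max_inter_center {N t : Set ↥M} (hN : IsMaximalIdeal N) (ht : IsMaxCenterIdeal t)
    (hs : t ⊆ N) {z : ↥M} (hz : z ∈ N) (hzc : z ∈ Set.center ↥M) : z ∈ t := by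
  have h := (closedIdeal_iff.1 hN.1).1
  exact maxc_alg ht h.inter_center (fun hh => (ne_univ_iff h).1 hN.2.1 hh.1)
    (fun x hx => ⟨hs hx, ht.1.1 hx⟩) ⟨hz, hzc⟩

theorem maxc_prime {t : Set ↥M} (ht : IsMaxCenterIdeal t) {e z : ↥M} (he : e ∈ Set.center ↥M)
    (hz : z ∈ Set.center ↥M) (het : e ∉ t) (h : e * z ∈ t) : z ∈ t := by
  have hA := (centerIdeal_iff.1 ht.1).1
  refine maxc_alg (N' := {z | z ∈ Set.center ↥M ∧ e * z ∈ t}) ht ?_ ?_ ?_ ⟨hz, h⟩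
  · refine ⟨fun x hx => hx.1, ⟨Set.zero_mem_center, by simpa using hA.zero⟩, ?_, ?_, ?_⟩
    · intro x hx y hy
      exact ⟨Set.add_mem_center hx.1 hy.1, by rw [mul_add]; exact hA.add _ hx.2 _ hy.2⟩
    · intro c x hx
      refine ⟨?_, by rw [mul_smul_comm]; exact hA.smul _ _ hx.2⟩
      rw [mem_center]; intro g
      rw [mul_smul_comm, smul_mul_assoc, mem_center.1 hx.1]
    · intro a ha x hx
      have h1 : e * (a * x) ∈ t := by
        rw [← mul_assoc, mem_center.1 ha, mul_assoc]; exact (hA.mul a ha _ hx.2).1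
      refine ⟨⟨Set.mul_mem_center ha hx.1, h1⟩, ⟨Set.mul_mem_center hx.1 ha, ?_⟩⟩
      rw [mem_center.1 ha]; exact h1
  · rintro ⟨-, h1⟩
    exact het (by simpa using h1)
  · intro x hx
    exact ⟨ht.1.1 hx, (hA.mul e he x hx).1⟩

/-- If `‖x (1 - r_ε)‖ ≤ ε` and `x r_ε ∈ J` then `x ∈ J`. -/
theorem mem_of_approx {J : Set ↥M} (hJ : IsClosed J) {x : ↥M}
    (h : ∀ ε > (0 : ℝ), ∃ r : ↥M, ‖x * (1 - r)‖ ≤ ε ∧ x * r ∈ J) : x ∈ J := by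
  rw [← hJ.closure_eq, Metric.mem_closure_iff]
  intro ε hε
  obtain ⟨r, h1, h2⟩ := h (ε / 2) (by positivity)
  refine ⟨_, h2, ?_⟩
  rw [dist_eq_norm]
  rw [mul_sub, mul_one] at h1
  linarith

theorem lemma_T {J t : Set ↥M} (hJ : IsClosedIdeal J) (ht : IsMaxCenterIdeal t)
    (hs : ∀ z ∈ J, z ∈ Set.center ↥M → z ∈ t) : ∃ N, IsMaximalIdeal N ∧ J ⊆ N ∧ t ⊆ N := by
  have hA := (centerIdeal_iff.1 ht.1).1
  have h1t : (1 : ↥M) ∉ t := (ne_center_iff hA).1 ht.2.1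
  have hI := (closedIdeal_iff.1 hJ).1
  obtain ⟨N, hN, hmax⟩ := exists_maximalIdeal
    (D := {y | ∃ e ∈ Set.center ↥M, e ∉ t ∧ e * y ∈ J}) (by
      refine ⟨Set.subset_univ _, ⟨1, one_mem_centerM, h1t, by simpa using hI.zero⟩, ?_, ?_, ?_⟩
      · rintro x ⟨e, he, het, hx⟩ y ⟨e', he', het', hy⟩
        refine ⟨e * e', Set.mul_mem_center he he', fun h => het' (maxc_prime ht he he' het h), ?_⟩
        have : e * e' * (x + y) = e' * (e * x) + e * (e' * y) := by
          rw [mul_add, ← mem_center.1 he e', mul_assoc, mem_center.1 he e', mul_assoc]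
        rw [this]
        exact hI.add _ (hI.mul _ trivial _ hx).1 _ (hI.mul _ trivial _ hy).1
      · rintro c x ⟨e, he, het, hx⟩
        exact ⟨e, he, het, by rw [mul_smul_comm]; exact hI.smul _ _ hx⟩
      · rintro a - x ⟨e, he, het, hx⟩
        refine ⟨⟨e, he, het, ?_⟩, ⟨e, he, het, ?_⟩⟩
        · rw [← mul_assoc, ← mem_center.1 he, mul_assoc]; exact (hI.mul _ trivial _ hx).1
        · rw [← mul_assoc]; exact (hI.mul _ trivial _ hx).2) (by
      rintro ⟨e, he, het, hx⟩
      rw [mul_one] at hx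
      exact het (hs e hx he))
  have hNA := closedIdeal_iff.1 hmax.1
  refine ⟨N, hmax, fun x hx => hN ⟨1, one_mem_centerM, h1t, by simpa using hx⟩, fun z hz => ?_⟩
  refine mem_of_approx hNA.2 fun ε hε => ?_
  obtain ⟨r, -, -, -, hrr, -, hn, hc⟩ := spectral z ε hε
  obtain ⟨hrc, γ, hγ, hr⟩ := hc (ht.1.1 hz)
  refine ⟨r, hn, hN ⟨1 - r, ?_, ?_, ?_⟩⟩
  · rw [mem_center] at *; intro g; rw [mul_sub, sub_mul, hrc, mul_one, one_mul]
  · intro h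
    apply h1t
    have hrt : r ∈ t := by rw [hr]; exact (hA.mul γ hγ z hz).1
    simpa using hA.add _ h _ hrt
  · rw [mem_center.1 hrc, ← mul_assoc, sub_mul, one_mul, hrr, sub_self, zero_mul]; exact hI.zero

theorem lemma_Sep {J : Set ↥M} (hJ : IsClosedIdeal J) {z : ↥M} (hz : z ∈ Set.center ↥M)
    (hzJ : z ∉ J) : ∃ t, IsMaxCenterIdeal t ∧ (∀ y ∈ J, y ∈ Set.center ↥M → y ∈ t) ∧ z ∉ t := by
  have hI := (closedIdeal_iff.1 hJ).1
  have : ∃ ε > (0 : ℝ), ∀ r : ↥M, ‖z * (1 - r)‖ ≤ ε → z * r ∉ J := by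
    by_contra! h
    exact hzJ (mem_of_approx hJ.1 h)
  obtain ⟨ε, hε, hr0⟩ := this
  obtain ⟨r, -, -, -, hrr, -, hn, hc⟩ := spectral z ε hε
  obtain ⟨hrc, γ, hγ, hr⟩ := hc hz
  have hrJ : r ∉ J := fun h => hr0 r hn (hI.mul _ trivial _ h).1
  obtain ⟨t, ht, hmax⟩ := exists_maxCenterIdeal
    (D := {y | y ∈ Set.center ↥M ∧ r * y ∈ J}) (by
      refine ⟨fun x hx => hx.1, ⟨Set.zero_mem_center, by simpa using hI.zero⟩, ?_, ?_, ?_⟩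
      · intro x hx y hy
        exact ⟨Set.add_mem_center hx.1 hy.1, by rw [mul_add]; exact hI.add _ hx.2 _ hy.2⟩
      · intro c x hx
        refine ⟨?_, by rw [mul_smul_comm]; exact hI.smul _ _ hx.2⟩
        rw [mem_center]; intro g
        rw [mul_smul_comm, smul_mul_assoc, mem_center.1 hx.1]
      · intro a ha x hx
        have h1 : r * (a * x) ∈ J := by
          rw [← mul_assoc, mem_center.1 ha, mul_assoc]; exact (hI.mul a trivial _ hx.2).1
        refine ⟨⟨Set.mul_mem_center ha hx.1, h1⟩, ⟨Set.mul_mem_center hx.1 ha, ?_⟩⟩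
        rw [mem_center.1 ha]; exact h1) (fun h => hrJ (by simpa using h.2))
  have hA := (centerIdeal_iff.1 hmax.1).1
  refine ⟨t, hmax, fun y hy hyc => ht ⟨hyc, (hI.mul _ trivial _ hy).1⟩, fun hzt => ?_⟩
  apply (ne_center_iff hA).1 hmax.2.1
  have h1 : r ∈ t := by rw [hr]; exact (hA.mul γ hγ z hzt).1
  have h2 : 1 - r ∈ t := by
    refine ht ⟨?_, ?_⟩
    · rw [mem_center] at *; intro g; rw [mul_sub, sub_mul, hrc, mul_one, one_mul]
    · rw [mul_sub, mul_one, hrr, sub_self]; exact hI.zero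
  simpa using hA.add _ h2 _ h1

theorem strongRadical_ideal : IsClosedIdeal (strongRadical M) := by
  have h : ∀ N ∈ {N : Set ↥M | IsMaximalIdeal N}, AI Set.univ N ∧ IsClosed N :=
    fun N hN => closedIdeal_iff.1 hN.1
  rw [closedIdeal_iff]
  refine ⟨⟨Set.subset_univ _, fun N hN => (h N hN).1.zero,
    fun x hx y hy N hN => (h N hN).1.add _ (hx N hN) _ (hy N hN),
    fun c x hx N hN => (h N hN).1.smul _ _ (hx N hN),
    fun a ha x hx => ⟨fun N hN => ((h N hN).1.mul a ha _ (hx N hN)).1,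
      fun N hN => ((h N hN).1.mul a ha _ (hx N hN)).2⟩⟩, isClosed_sInter fun N hN => (h N hN).2⟩

theorem part_one (φ : ↥M →L[ℂ] ↥M) (hrange : ∀ x : ↥M, φ x ∈ Set.center ↥M) :
    ((∀ J : Set ↥M, IsClosedIdeal J → ∀ x ∈ J, φ x ∈ J) ↔
      (∀ t Mt : Set ↥M, IsMaxCenterIdeal t → IsMaximalIdeal Mt → t ⊆ Mt →
        ∀ x ∈ Mt, φ x ∈ t)) := by
  constructor
  · intro h t N ht hN hs x hx
    exact max_inter_center hN ht hs (h N hN.1 x hx) (hrange x)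
  · intro h J hJ x hx
    by_contra hc
    obtain ⟨t, ht, h1, h2⟩ := lemma_Sep hJ (hrange x) hc
    obtain ⟨N, hN, h3, h4⟩ := lemma_T hJ ht h1
    exact h2 (h t N ht hN h4 x (h3 hx))

theorem part_two_mp (φ : ↥M →L[ℂ] ↥M) (hrange : ∀ x : ↥M, φ x ∈ Set.center ↥M)
    (h : ∀ J : Set ↥M, IsClosedIdeal J → ∀ x ∈ J, φ x ∈ J) :
    ∀ x ∈ strongRadical M, φ x = 0 := by
  intro x hx
  have h1 := h _ strongRadical_ideal x hx
  by_contra hc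
  have h0 : IsClosedIdeal ({0} : Set ↥M) := by
    refine ⟨isClosed_singleton, rfl, ?_, ?_, ?_⟩ <;> simp
  obtain ⟨t, ht, h2, h3⟩ := lemma_Sep h0 (hrange x) hc
  obtain ⟨N, hN, -, h4⟩ := lemma_T h0 ht h2
  exact h3 (max_inter_center hN ht h4 (h1 N hN) (hrange x))

/-- Central projections. -/
structure CP (f : ↥M) : Prop where
  c : ∀ g : ↥M, g * f = f * g
  s : star f = f
  i : f * f = f

theorem CP.compl {f : ↥M} (h : CP f) : CP (1 - f) where
  c g := by rw [mul_sub, sub_mul, h.c, mul_one, one_mul]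
  s := by rw [star_sub, star_one, h.s]
  i := by rw [mul_sub, mul_one, sub_mul, one_mul, h.i, sub_self, sub_zero]

theorem CP.mul {f g : ↥M} (h : CP f) (h' : CP g) : CP (f * g) where
  c x := by rw [← mul_assoc, h.c, mul_assoc, h'.c, mul_assoc]
  s := by rw [star_mul, h.s, h'.s, h.c]
  i := by rw [mul_assoc, ← mul_assoc g, h.c g, mul_assoc, h'.i, ← mul_assoc, h.i]

theorem CP.one : CP (1 : ↥M) := ⟨fun g => by simp, star_one _, one_mul _⟩
theorem CP.zero : CP (0 : ↥M) := ⟨fun g => by simp, star_zero _, zero_mul _⟩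

theorem CP.mem {f : ↥M} (h : CP f) : f ∈ Set.center ↥M := mem_center.2 h.c

/-- left-commutativity -/
theorem CP.lc {f : ↥M} (h : CP f) (a b : ↥M) : a * (f * b) = f * (a * b) := by
  rw [← mul_assoc, h.c, mul_assoc]

theorem CP.ii {f : ↥M} (h : CP f) (b : ↥M) : f * (f * b) = f * b := by
  rw [← mul_assoc, h.i]

theorem CP.cut {f : ↥M} (h : CP f) (V : ↥M) : star (f * V) * (f * V) = f * (star V * V) := by
  rw [star_mul, h.s, mul_assoc, h.ii, h.lc]

/-- `e` is equivalent to a subprojection of `p`. -/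
def Sub (e p : ↥M) : Prop := ∃ v : ↥M, star v * v = e ∧ p * v = v

theorem eq_zero_of_star_mul {x : ↥M} (h : star x * x = 0) : x = 0 := by
  have : star (x : H →L[ℂ] H) * x = 0 := congrArg Subtype.val h
  exact Subtype.ext (CStarRing.star_mul_self_eq_zero_iff _ |>.1 this)

theorem pi_of_proj {v e : ↥M} (h : star v * v = e) (he : e * e = e) : v * e = v := by
  have hs : star e = e := by rw [← h, star_mul, star_star]
  rw [← sub_eq_zero]
  apply eq_zero_of_star_mul
  have : star (v * e - v) * (v * e - v) = e * (star v * v) * e - e * (star v * v) 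
      - (star v * v) * e + star v * v := by
    rw [star_sub, star_mul, hs]; noncomm_ring
  rw [this, h, he, he]; simp

theorem comparison {p q : ↥M} (hps : star p = p) (hp : p * p = p) (hqs : star q = q)
    (hq : q * q = q) : ∃ f, CP f ∧ Sub (f * p) (f * q) ∧ Sub ((1 - f) * q) ((1 - f) * p) := by
  obtain ⟨S, -, hS⟩ := zorn_subset_nonempty {S : Set ↥M |
      (∀ v ∈ S, v * (star v * v) = v ∧ v * p = v ∧ q * v = v) ∧
      (∀ v ∈ S, ∀ w ∈ S, v ≠ w → v * star w = 0 ∧ star v * w = 0)} (by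
    intro c hc hchain hne
    refine ⟨⋃₀ c, ⟨?_, ?_⟩, fun s hs => Set.subset_sUnion_of_mem hs⟩
    · rintro v ⟨s, hs, hv⟩
      exact (hc hs).1 v hv
    · rintro v ⟨s, hs, hv⟩ w ⟨s', hs', hw⟩ hne
      rcases hchain.total hs hs' with h | h
      · exact (hc hs').2 v (h hv) w hw hne
      · exact (hc hs).2 v hv w (h hw) hne) ∅ (by simp)
  obtain ⟨hS1, hS2⟩ := hS.prop
  obtain ⟨V, hV1, hV2, hV3, hV4⟩ := glue (fun i : S => (i : ↥M)) (fun i => (hS1 i i.2).1)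
    (fun i j hij => (hS2 i i.2 j j.2 fun h => hij (Subtype.ext h)).1)
    (fun i j hij => (hS2 i i.2 j j.2 fun h => hij (Subtype.ext h)).2)
  have hVp : V * p = V := by
    have := hV4 (1 - p) fun i => by rw [mul_sub, mul_one, (hS1 i i.2).2.1, sub_self]
    rw [mul_sub, mul_one, sub_eq_zero] at this; exact this.symm
  have hqV : q * V = V := by
    have := hV3 (1 - q) fun i => by rw [sub_mul, one_mul, (hS1 i i.2).2.2, sub_self]
    rw [sub_mul, one_mul, sub_eq_zero] at this; exact this.symm
  have hpV : p * star V = star V := by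
    have := congrArg star hVp; rwa [star_mul, hps] at this
  have hVq : star V * q = star V := by
    have := congrArg star hqV; rwa [star_mul, hqs] at this
  have hVi : ∀ i : S, V * (star V * i) = i := by
    intro i; rw [hV2, ← mul_assoc, hV1, mul_assoc, (hS1 i i.2).1]
  have hVV : V * (star V * V) = V := by
    have := hV3 (V * star V - 1) fun i => by rw [sub_mul, one_mul, mul_assoc, hVi, sub_self]
    rw [sub_mul, one_mul, sub_eq_zero, mul_assoc] at this; exact this
  have hiV : ∀ i : S, (i : ↥M) * (star V * V) = i := by
    intro i
    have h1 : star V * (V * star (i : ↥M)) = star (i : ↥M) := by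
      rw [hV1, ← mul_assoc, hV2]
      have := congrArg star (hS1 i i.2).1
      simpa [star_mul] using this
    have := congrArg star h1
    simpa [star_mul, mul_assoc] using this
  have hVV' : star V * V * star V = star V := by
    have := congrArg star hVV; simpa [star_mul, mul_assoc] using this
  set p0 := p - star V * V with hp0
  set q0 := q - V * star V with hq0
  have hp0s : star p0 = p0 := by rw [hp0, star_sub, hps, star_mul, star_star]
  have hq0s : star q0 = q0 := by rw [hq0, star_sub, hqs, star_mul, star_star]
  have hp0p : p0 * p = p0 := by rw [hp0, sub_mul, hp, mul_assoc, hVp]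
  have hqq0 : q * q0 = q0 := by rw [hq0, mul_sub, hq, ← mul_assoc, hqV]
  have hp0i : p0 * p0 = p0 := by
    have h1 : p0 * (star V * V) = 0 := by
      rw [hp0, sub_mul, ← mul_assoc, hpV, ← mul_assoc, hVV', sub_self]
    nth_rewrite 2 [hp0]
    rw [mul_sub, h1, hp0p, sub_zero]
  have hq0i : q0 * q0 = q0 := by
    have h1 : (V * star V) * q0 = 0 := by
      rw [hq0, mul_sub, mul_assoc, hVq, ← mul_assoc, mul_assoc V, hVV, sub_self]
    nth_rewrite 1 [hq0]
    rw [sub_mul, h1, hqq0, sub_zero]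
  have hip0 : ∀ i : S, (i : ↥M) * p0 = 0 := by
    intro i; rw [hp0, mul_sub, hiV, (hS1 i i.2).2.1, sub_self]
  have hq0i' : ∀ i : S, q0 * (i : ↥M) = 0 := by
    intro i; rw [hq0, sub_mul, mul_assoc, hVi, (hS1 i i.2).2.2, sub_self]
  have hz : ∀ x, q0 * x * p0 = 0 := by
    intro x
    obtain ⟨U, r, h1, h2, h3, h4, h5, h6, h7⟩ := polar (q0 * x * p0)
    have hrp : r * p0 = r := by
      have := h6 (1 - p0) (by rw [mul_assoc, mul_sub, mul_one, hp0i, sub_self, mul_zero])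
      rw [mul_sub, mul_one, sub_eq_zero] at this; exact this.symm
    have hUp : U * p0 = U := by rw [← h2, mul_assoc, hrp]
    have hqU : q0 * U = U := by
      have := h7 (1 - q0) (by rw [← mul_assoc, ← mul_assoc, sub_mul, one_mul, hq0i, sub_self,
        zero_mul, zero_mul])
      rw [sub_mul, one_mul, sub_eq_zero] at this; exact this.symm
    have hUv : ∀ v ∈ S, U * star v = 0 := by
      intro v hv
      have := congrArg star (hip0 ⟨v, hv⟩)
      rw [star_mul, hp0s, star_zero] at this
      rw [← hUp, mul_assoc, this, mul_zero]
    have hUv' : ∀ v ∈ S, v * star U = 0 := by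
      intro v hv
      have := congrArg star (hUv v hv)
      simpa using this
    have hUw : ∀ v ∈ S, star U * v = 0 := by
      intro v hv
      rw [← hqU, star_mul, hq0s, mul_assoc, hq0i' ⟨v, hv⟩, mul_zero]
    have hUw' : ∀ v ∈ S, star v * U = 0 := by
      intro v hv
      have := congrArg star (hUw v hv)
      simpa using this
    have hmem : insert U S ∈ {S : Set ↥M |
      (∀ v ∈ S, v * (star v * v) = v ∧ v * p = v ∧ q * v = v) ∧
      (∀ v ∈ S, ∀ w ∈ S, v ≠ w → v * star w = 0 ∧ star v * w = 0)} := by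
      constructor
      · rintro v (rfl | hv)
        · refine ⟨by rw [h1, h2], by rw [← hUp, mul_assoc, hp0p], by rw [← hqU, ← mul_assoc, hqq0]⟩
        · exact hS1 v hv
      · rintro v (rfl | hv) w (rfl | hw) hne
        · exact absurd rfl hne
        · exact ⟨hUv w hw, hUw w hw⟩
        · exact ⟨hUv' v hv, hUw' v hv⟩
        · exact hS2 v hv w hw hne
    have heq := hS.eq_of_subset hmem (Set.subset_insert _ _)
    have hU : U ∈ S := by rw [heq]; exact Set.mem_insert _ _
    have hU0 : U = 0 := by rw [← hUp]; exact hip0 ⟨U, hU⟩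
    rw [← h5, ← h1, hU0, mul_zero, mul_zero]
  obtain ⟨f, hf1, hf2, hf3, hf4, hf5⟩ := central_support q0
  have hf : CP f := ⟨mem_center.1 hf1, hf2, hf3⟩
  have hpf : p0 * f = 0 := by
    refine hf5 p0 fun x => ?_
    have := congrArg star (hz (star x))
    simpa [star_mul, hp0s, hq0s, mul_assoc] using this
  have e1 : f * p = f * (star V * V) := by
    rw [← sub_eq_zero, ← mul_sub, ← hp0, ← hf.c, hpf]
  have e2 : (1 - f) * q = (1 - f) * (V * star V) := by
    rw [← sub_eq_zero, ← mul_sub, ← hq0, sub_mul, hf4, one_mul, sub_self]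
  refine ⟨f, hf, ⟨f * V, by rw [hf.cut, e1], ?_⟩, ⟨(1 - f) * star V, ?_, ?_⟩⟩
  · rw [mul_assoc, hf.lc, hqV, hf.ii]
  · rw [hf.compl.cut, e2, star_star]
  · rw [mul_assoc, hf.compl.lc, hpV, hf.compl.ii]

theorem Sub.trans {a b c : ↥M} (h : Sub a b) (h' : Sub b c) : Sub a c := by
  obtain ⟨v, h1, h2⟩ := h
  obtain ⟨w, h3, h4⟩ := h'
  refine ⟨w * v, ?_, ?_⟩
  · rw [star_mul, mul_assoc, ← mul_assoc (star w), h3, h2, h1]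
  · rw [← mul_assoc, h4]

theorem lemma_D {e p α β : ↥M} (hes : star e = e) (he : e * e = e) (hp : p * p = p)
    (h : e = α * p * β) : Sub e p := by
  obtain ⟨U, r, h1, h2, h3, h4, h5, h6, h7⟩ := polar (p * β * e)
  have hre : r * e = r := by
    have := h6 (1 - e) (by rw [mul_assoc, mul_sub, mul_one, he, sub_self, mul_zero])
    rw [mul_sub, mul_one, sub_eq_zero] at this; exact this.symm
  have her : e * r = e := by
    have h8 : e = α * (p * β * e) := by
      nth_rewrite 1 [← he, h]
      simp only [mul_assoc]
    nth_rewrite 1 [h8]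
    rw [mul_assoc, h5, ← h8]
  have : r = e := by
    have h9 := congrArg star her
    rw [star_mul, hes, h3, hre] at h9
    exact h9
  refine ⟨U, by rw [h1, this], ?_⟩
  have := h7 (1 - p) (by rw [← mul_assoc, ← mul_assoc, sub_mul, one_mul, hp, sub_self,
        zero_mul, zero_mul])
  rw [sub_mul, one_mul, sub_eq_zero] at this; exact this.symm

theorem piece {q e : ↥M} (hq : q * q = q) (hes : star e = e) (he : e * e = e) :
    ∃ U s : ↥M, star s = s ∧ s * s = s ∧ star U * U = e - s ∧ q * U = U ∧ q * s = 0 ∧ s * e = s ∧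
      ∀ y, y * (q * e) = 0 → y * U = 0 := by
  obtain ⟨U, r, h1, h2, h3, h4, h5, h6, h7⟩ := polar (q * e)
  have hre : r * e = r := by
    have := h6 (1 - e) (by rw [mul_assoc, mul_sub, mul_one, he, sub_self, mul_zero])
    rw [mul_sub, mul_one, sub_eq_zero] at this; exact this.symm
  have her : e * r = r := by
    have := congrArg star hre
    rwa [star_mul, hes, h3] at this
  have hqU : q * U = U := by
    have := h7 (1 - q) (by rw [← mul_assoc, sub_mul, one_mul, hq, sub_self, zero_mul])
    rw [sub_mul, one_mul, sub_eq_zero] at this; exact this.symm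
  refine ⟨U, e - r, by rw [star_sub, hes, h3], ?_, by rw [h1]; abel, hqU, ?_, ?_, h7⟩
  · rw [mul_sub, sub_mul, sub_mul, he, hre, her, h4]; abel
  · have : q * (e - r) = q * e - q * e * r := by rw [mul_sub, mul_assoc, her]
    rw [this, h5, sub_self]
  · rw [sub_mul, he, hre]

theorem half {f U s e s' w q v : ↥M} (hf : CP f) (h1 : star U * U = e - s) (h2 : q * U = U)
    (h3 : star w * w = f * s) (h4 : f * s' * w = w) (h5 : s' * U = 0) (h6 : star s' = s')
    (h7 : q * s' = s') (h8 : e * v = v) (h9 : star v * v = 1) : Sub f q := by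
  have hUw : star U * w = 0 := by
    have : star U * s' = 0 := by
      have := congrArg star h5; rwa [star_mul, h6, star_zero] at this
    rw [← h4, mul_assoc, hf.lc, ← mul_assoc (star U), this, zero_mul, mul_zero]
  have hwU : star w * U = 0 := by
    have := congrArg star hUw; simpa using this
  have hqw : q * w = w := by
    nth_rewrite 1 [← h4]
    rw [mul_assoc, hf.lc, ← mul_assoc q, h7, ← mul_assoc, h4]
  have hTT : star (f * U + w) * (f * U + w) = f * e := by
    have : star (f * U + w) * (f * U + w) = f * (star U * U) + f * (star U * w) 
        + f * (star w * U) + star w * w := by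
      rw [star_add, add_mul, mul_add, mul_add, hf.cut, hf.lc, star_mul, hf.s, hf.c, mul_assoc]
      abel
    rw [this, h1, hUw, hwU, h3, mul_sub]; simp
  refine ⟨(f * U + w) * v, ?_, ?_⟩
  · rw [star_mul, mul_assoc, ← mul_assoc (star (f * U + w)), hTT, mul_assoc, h8, hf.lc, h9, mul_one]
  · rw [← mul_assoc, mul_add, hf.lc, h2, hqw]

/-- The algebra contains two isometries with orthogonal ranges. -/
def Hv (f : ↥M) : Prop := ∃ v w : ↥M, star v * v = f ∧ star w * w = f ∧ star v * w = 0

theorem lemma_L (hH : Hv (1 : ↥M)) {p q : ↥M} (hps : star p = p) (hp : p * p = p)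
    (hpq : p + q = 1) : ∃ f, CP f ∧ Sub f q ∧ Sub (1 - f) p := by
  obtain ⟨v, w, hv, hw, hvw⟩ := hH
  obtain rfl : q = 1 - p := by rw [← hpq]; abel
  have hqs : star (1 - p) = 1 - p := by rw [star_sub, star_one, hps]
  have hq : (1 - p) * (1 - p) = 1 - p := by
    rw [mul_sub, mul_one, sub_mul, one_mul, hp, sub_self, sub_zero]
  set e := v * star v with he
  have hes : star e = e := by rw [he, star_mul, star_star]
  have hei : e * e = e := by
    rw [he, mul_assoc, ← mul_assoc (star v), hv, one_mul]
  have hes' : star (1 - e) = 1 - e := by rw [star_sub, star_one, hes]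
  have hei' : (1 - e) * (1 - e) = 1 - e := by
    rw [mul_sub, mul_one, sub_mul, one_mul, hei, sub_self, sub_zero]
  have hev : e * v = v := by rw [he, mul_assoc, hv, mul_one]
  have hew : (1 - e) * w = w := by rw [he, sub_mul, one_mul, mul_assoc, hvw, mul_zero, sub_zero]
  obtain ⟨U, s, a1, a2, a3, a4, a5, a6, a7⟩ := piece hq hes hei
  obtain ⟨U', s', b1, b2, b3, b4, b5, b6, b7⟩ := piece hp hes' hei'
  have a5' : p * s = s := by
    rw [sub_mul, one_mul, sub_eq_zero] at a5; exact a5.symm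
  have b5' : (1 - p) * s' = s' := by rw [sub_mul, one_mul, b5, sub_zero]
  have hsp : s * p = s := by
    have := congrArg star a5'; rwa [star_mul, hps, a1] at this
  have hsq : s' * (1 - p) = s' := by
    have := congrArg star b5'; rwa [star_mul, hqs, b1] at this
  have c1 : s' * U = 0 := by
    refine a7 _ ?_
    rw [← mul_assoc, hsq]
    rw [mul_sub, mul_one, sub_eq_self] at b6; exact b6
  have c2 : s * U' = 0 := by
    refine b7 _ ?_
    rw [← mul_assoc, hsp, mul_sub, mul_one, a6, sub_self]
  obtain ⟨f, hf, ⟨w1, d1, d2⟩, ⟨w2, d3, d4⟩⟩ := comparison a1 a2 b1 b2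
  exact ⟨f, hf, half hf a3 a4 d1 d2 c1 b1 b5' hev hv,
    half hf.compl b3 b4 d3 d4 c2 a1 a5' hew hw⟩

theorem lemma_Lop (hH : Hv (1 : ↥M)) {x y : ↥M} (hxy : x + y = 1) :
    ∃ f, CP f ∧ (∃ a b, f = a * x * b) ∧ (∃ a b, 1 - f = a * y * b) := by
  obtain ⟨r, α, β, hrs, hr, hre, hn, -⟩ := spectral x (1 / 2) (by norm_num)
  obtain ⟨w, hw, -⟩ := inv_near_one (1 - x * (1 - r)) (by
    rw [sub_sub_cancel]; linarith)
  have hq : (1 - r) * (1 - r) = 1 - r := by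
    rw [mul_sub, mul_one, sub_mul, one_mul, hr, sub_self, sub_zero]
  have hyq : 1 - r = w * (y * (1 - r)) := by
    have h1 : y * (1 - r) = (1 - x * (1 - r)) * (1 - r) := by
      rw [sub_mul, mul_assoc, hq, ← sub_mul, ← hxy, add_sub_cancel_left]
    rw [h1, ← mul_assoc, hw, one_mul]
  obtain ⟨f, hf, ⟨v, h1, h2⟩, ⟨v', h3, h4⟩⟩ := lemma_L hH hrs hr (add_sub_cancel r 1)
  refine ⟨1 - f, hf.compl, ⟨star v' * α, β * v', ?_⟩, ⟨star v * w, (1 - r) * v, ?_⟩⟩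
  · rw [← h3]
    nth_rewrite 2 [← h4]
    rw [hre]
    simp only [mul_assoc]
  · rw [sub_sub_cancel, ← h1]
    nth_rewrite 2 [← h2]
    nth_rewrite 1 [hyq]
    simp only [mul_assoc]

/-- Elements which can be dropped from full elements. -/
def N0 (y : ↥M) : Prop := ∀ x a b : ↥M, a * (x + y) * b = 1 → ∃ a' b', a' * x * b' = 1

theorem N_sub {y : ↥M} (hy : ∀ α β : ↥M, N0 (α * y * β)) : y ∈ strongRadical M := by
  have hA : AI Set.univ {y : ↥M | ∀ α β : ↥M, N0 (α * y * β)} := by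
    refine ⟨Set.subset_univ _, ?_, ?_, ?_, ?_⟩
    · intro α β x a b h
      exact ⟨a, b, by simpa using h⟩
    · intro y hy y' hy' α β x a b h
      have : x + α * (y + y') * β = (x + α * y * β) + α * y' * β := by noncomm_ring
      rw [this] at h
      obtain ⟨a', b', h'⟩ := hy' α β _ a b h
      exact hy α β _ a' b' h'
    · intro c y hy α β
      have : α * (c • y) * β = (c • α) * y * β := by
        rw [mul_smul_comm, smul_mul_assoc, smul_mul_assoc, smul_mul_assoc]
      rw [this]; exact hy _ _
    · intro c _ y hy
      refine ⟨fun α β => ?_, fun α β => ?_⟩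
      · rw [← mul_assoc]; exact hy _ _
      · rw [← mul_assoc, mul_assoc]; exact hy _ _
  intro N hN
  refine max_absorb hN hA ?_ hy
  intro n hn y hy h
  obtain ⟨a, b, h'⟩ := hy 1 1 n 1 1 (by simpa using h)
  have hI := (closedIdeal_iff.1 hN.1).1
  refine (ne_univ_iff hI).1 hN.2.1 ?_
  rw [← h']
  exact (hI.mul b trivial _ (hI.mul a trivial _ hn).1).2

theorem glueC {ι : Type*} (f v : ι → ↥M) (p : ↥M) (hf : ∀ i, CP (f i))
    (ho : ∀ i j, i ≠ j → f i * f j = 0) (hv : ∀ i, star (v i) * v i = f i)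
    (hp : ∀ i, p * v i = v i) : ∃ V : ↥M, CP (star V * V) ∧ p * V = V ∧ (∀ i, V * f i = v i) ∧
      (∀ i, (star V * V) * f i = f i) ∧ (∀ y, (∀ i, f i * y = 0) → V * y = 0) ∧
      (∀ y, (∀ i, y * v i = 0) → y * V = 0) := by
  have hvf : ∀ i, v i * f i = v i := fun i => pi_of_proj (hv i) (hf i).i
  have hfv : ∀ i, f i * star (v i) = star (v i) := by
    intro i
    have := congrArg star (hvf i); rwa [star_mul, (hf i).s] at this
  obtain ⟨V, h1, h2, h3, h4⟩ := glue v (fun i => by rw [hv, hvf]) (fun i j hij => by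
    rw [← hvf i, ← hfv j, mul_assoc, ← mul_assoc (f i), ho i j hij, zero_mul, mul_zero])
    (fun i j hij => by
      rw [← hfv i, ← hvf j, (hf j).c, mul_assoc, ← mul_assoc (star (v i)), (hf j).c, 
        ← mul_assoc, ← mul_assoc, ho i j hij, zero_mul, zero_mul])
  have hVf : ∀ i, V * f i = v i := by
    intro i
    rw [← hv, ← mul_assoc, h1, mul_assoc, hv, hvf]
  have hcf : ∀ i, (star V * V) * f i = f i := by
    intro i; rw [mul_assoc, hVf, h2, hv]
  have h4' : ∀ y, (∀ i, f i * y = 0) → V * y = 0 := by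
    intro y hy
    refine h4 y fun i => ?_
    rw [← hvf i, mul_assoc, hy, mul_zero]
  have hcs : star (star V * V) = star V * V := by rw [star_mul, star_star]
  have hVg : ∀ g, V * (g * (1 - star V * V)) = 0 := by
    intro g
    refine h4' _ fun i => ?_
    rw [← mul_assoc, ← (hf i).c, mul_assoc, mul_sub, mul_one, ← (hf i).c, hcf, sub_self, mul_zero]
  have hcg : ∀ g, (star V * V) * g = (star V * V) * g * (star V * V) := by
    intro g
    have := congrArg (star V * ·) (hVg g)
    simp only [mul_zero] at this
    rw [← mul_assoc, ← mul_assoc, mul_sub, mul_one, sub_eq_zero] at this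
    exact this
  refine ⟨V, ⟨?_, hcs, ?_⟩, ?_, hVf, hcf, h4', h3⟩
  · intro g
    have := congrArg star (hcg (star g))
    rw [star_mul _ (star g), star_mul _ (star V * V), star_mul _ (star g), star_star, hcs] at this
    rw [this, ← mul_assoc, ← hcg]
  · have := hcg 1
    rw [mul_one] at this; exact this.symm
  · have := h3 (1 - p) fun i => by rw [sub_mul, one_mul, hp, sub_self]
    rw [sub_mul, one_mul, sub_eq_zero] at this; exact this.symm

/-- Zorn: maximal orthogonal families of central projections with a property. -/
theorem zornCP (P : ↥M → Prop) : ∃ S : Set ↥M, (∀ f ∈ S, CP f ∧ P f) ∧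
    (∀ f ∈ S, ∀ g ∈ S, f ≠ g → f * g = 0) ∧
    ∀ e, CP e → P e → (∀ f ∈ S, f * e = 0) → e ∈ S := by
  obtain ⟨S, -, hS⟩ := zorn_subset_nonempty {S : Set ↥M |
      (∀ f ∈ S, CP f ∧ P f) ∧ (∀ f ∈ S, ∀ g ∈ S, f ≠ g → f * g = 0)} (by
    intro c hc hchain hne
    refine ⟨⋃₀ c, ⟨?_, ?_⟩, fun s hs => Set.subset_sUnion_of_mem hs⟩
    · rintro v ⟨s, hs, hv⟩
      exact (hc hs).1 v hv
    · rintro v ⟨s, hs, hv⟩ w ⟨s', hs', hw⟩ hne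
      rcases hchain.total hs hs' with h | h
      · exact (hc hs').2 v (h hv) w hw hne
      · exact (hc hs).2 v hv w (h hw) hne) ∅ (by simp)
  obtain ⟨hS1, hS2⟩ := hS.prop
  refine ⟨S, hS1, hS2, fun e he hPe h => ?_⟩
  have hmem : insert e S ∈ {S : Set ↥M |
      (∀ f ∈ S, CP f ∧ P f) ∧ (∀ f ∈ S, ∀ g ∈ S, f ≠ g → f * g = 0)} := by
    constructor
    · rintro f (rfl | hf)
      · exact ⟨he, hPe⟩
      · exact hS1 f hf
    · rintro f (rfl | hf) g (rfl | hg) hne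
      · exact absurd rfl hne
      · rw [← he.c]; exact h g hg
      · exact h f hf
      · exact hS2 f hf g hg hne
  rw [hS.eq_of_subset hmem (Set.subset_insert _ _)]
  exact Set.mem_insert _ _

theorem lemma_K (hH : Hv (1 : ↥M)) {p : ↥M} (hps : star p = p) (hp : p * p = p) :
    ∃ c, CP c ∧ Sub c p ∧ (1 - c) * p ∈ strongRadical M := by
  obtain ⟨S, h1, h2, h3⟩ := zornCP (fun e : ↥M => Sub e p)
  choose! v hv using fun f hf => (h1 f hf).2
  obtain ⟨V, hc, hpV, -, hcf, -, -⟩ := glueC (fun i : S => (i : ↥M)) (fun i => v i) p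
    (fun i => (h1 i i.2).1) (fun i j hij => h2 i i.2 j j.2 fun h => hij (Subtype.ext h))
    (fun i => (hv i i.2).1) (fun i => (hv i i.2).2)
  set c := star V * V with hcdef
  refine ⟨c, hc, ⟨V, rfl, hpV⟩, N_sub fun α β x a b h => ?_⟩
  obtain ⟨f, hf, ⟨a1, b1, hf1⟩, ⟨a2, b2, hf2⟩⟩ := lemma_Lop hH
    (x := a * x * b) (y := a * (α * ((1 - c) * p) * β) * b) (by rw [← add_mul, ← mul_add, h])
  have hp'i : ((1 - c) * p) * ((1 - c) * p) = (1 - c) * p := by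
    rw [mul_assoc, hc.compl.lc, hp, hc.compl.ii]
  obtain ⟨u, hu1, hu2⟩ := lemma_D hf.compl.s hf.compl.i hp'i
    (α := a2 * a * α) (β := β * b * b2) (by rw [hf2]; simp only [mul_assoc])
  have hcu : c * u = 0 := by
    rw [← hu2, ← mul_assoc, ← mul_assoc, mul_sub, mul_one, hc.i, sub_self, zero_mul, zero_mul]
  have hpu : p * u = u := by
    nth_rewrite 1 [← hu2]
    rw [← mul_assoc, hc.compl.lc, hp, hu2]
  have hcf0 : c * (1 - f) = 0 := by rw [← hu1, ← hc.lc, hcu, mul_zero]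
  have hmem : 1 - f ∈ S := by
    refine h3 _ hf.compl ⟨u, hu1, hpu⟩ fun g hg => ?_
    have := hcf ⟨g, hg⟩
    simp only at this
    rw [← this, mul_assoc, hf.compl.c, hf.compl.lc, ← mul_assoc, ← hf.compl.c, hcf0, zero_mul]
  have h0 : 1 - f = 0 := by
    have := hcf ⟨_, hmem⟩
    simp only at this
    rw [← this, hcf0]
  refine ⟨a1 * a, b * b1, ?_⟩
  rw [sub_eq_zero] at h0
  rw [h0, hf1]; simp only [mul_assoc]

theorem part_two_mpr (hH : Hv (1 : ↥M)) (φ : ↥M →L[ℂ] ↥M)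
    (hmod : ∀ z ∈ Set.center ↥M, ∀ x : ↥M, φ (z * x) = z * φ x)
    (h : ∀ x ∈ strongRadical M, φ x = 0) :
    ∀ J : Set ↥M, IsClosedIdeal J → ∀ x ∈ J, φ x ∈ J := by
  intro J hJ x hx
  have hI := (closedIdeal_iff.1 hJ).1
  have hR := (closedIdeal_iff.1 (strongRadical_ideal (M := M))).1
  have hcl : IsClosed (φ ⁻¹' J) := hJ.1.preimage φ.continuous
  refine mem_of_approx hcl fun ε hε => ?_
  obtain ⟨p, α, β, hps, hp, hpe, hn, -⟩ := spectral x ε hε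
  refine ⟨p, hn, ?_⟩
  have hpJ : p ∈ J := by
    rw [hpe]; exact (hI.mul _ trivial _ (hI.mul _ trivial _ hx).1).2
  obtain ⟨c, hc, ⟨v, hv1, hv2⟩, hcp⟩ := lemma_K hH hps hp
  have hcJ : c ∈ J := by
    rw [← hv1, ← hv2]; exact (hI.mul _ trivial _ (hI.mul _ trivial _ hpJ).2).1
  have h0 : φ ((1 - c) * (x * p)) = 0 := by
    apply h
    rw [← hc.compl.lc]
    exact (hR.mul _ trivial _ hcp).1
  rw [hmod _ hc.compl.mem, sub_mul, one_mul, sub_eq_zero] at h0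
  show φ (x * p) ∈ J
  rw [h0]
  exact (hI.mul _ trivial _ hcJ).2

theorem shift {ι : Type*} {u : ι → ↥M} {d E f g w : ↥M} (hd : d * d = d)
    (hu : ∀ i, star (u i) * u i = d) (ho : ∀ i j, i ≠ j → star (u i) * u j = 0)
    (hEs : star E = E) (hEu : ∀ i, E * u i = u i)
    (hE : ∀ y, (∀ i, y * u i = 0) → y * E = 0) (hf : CP f) (hfg : f * g = f)
    (hw : star w * w = f * (g - E)) (hdw : d * w = w)
    (a : Option ι → ι) (ha : Function.Injective a) :
    ∃ V, star V * V = f ∧ ∀ y, (∀ o, y * u (a o) = 0) → y * V = 0 := by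
  have hud : ∀ i, u i * d = u i := fun i => pi_of_proj (hu i) hd
  have huE : ∀ i, star (u i) * E = star (u i) := by
    intro i
    have := congrArg star (hEu i); rwa [star_mul, hEs] at this
  have hduu : ∀ i, d * star (u i) = star (u i) := by
    intro i
    have hds : star d = d := by rw [← hu i, star_mul, star_star]
    have := congrArg star (hud i); rwa [star_mul, hds] at this
  have htt : ∀ i j, star (u (a (some i)) * star (u i)) * (u (a (some j)) * star (u j)) =
      u i * (star (u (a (some i))) * u (a (some j))) * star (u j) := by
    intro i j
    rw [star_mul, star_star]; simp only [mul_assoc]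
  have htt' : ∀ i j, (u (a (some i)) * star (u i)) * star (u (a (some j)) * star (u j)) =
      u (a (some i)) * (star (u i) * u j) * star (u (a (some j))) := by
    intro i j
    rw [star_mul, star_star]; simp only [mul_assoc]
  have hP : ∀ i, star (u (a (some i)) * star (u i)) * (u (a (some i)) * star (u i)) =
      u i * star (u i) := by
    intro i; rw [htt, hu, hud]
  have htP : ∀ i, u (a (some i)) * star (u i) * (u i * star (u i)) =
      u (a (some i)) * star (u i) := by
    intro i
    rw [mul_assoc, ← mul_assoc (star (u i)), hu, hduu]
  obtain ⟨V1, h1, h2, h3, h4⟩ := glue (fun i => u (a (some i)) * star (u i))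
    (fun i => by rw [hP, htP])
    (fun i j hij => by rw [htt', ho i j hij, mul_zero, zero_mul])
    (fun i j hij => by
      rw [htt, ho _ _ (fun h => hij (Option.some_injective _ (ha h))), mul_zero, zero_mul])
  simp only [hP] at h2
  have hV1P : ∀ i, V1 * (u i * star (u i)) = u (a (some i)) * star (u i) := by
    intro i
    rw [← hP, ← mul_assoc, h1, mul_assoc, hP, htP]
  have hV1E : V1 * E = V1 := by
    have := h4 (1 - E) fun i => by rw [mul_sub, mul_one, mul_assoc, huE, sub_self]
    rw [mul_sub, mul_one, sub_eq_zero] at this; exact this.symm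
  have hVV : star V1 * V1 = E := by
    have h5 := hE (star V1 * V1 - 1) fun i => by
      have h6 : u i = u i * star (u i) * u i := by rw [mul_assoc, hu, hud]
      have h7 : star V1 * V1 * (u i * star (u i)) = u i * star (u i) := by
        rw [mul_assoc, hV1P, h2]
      rw [h6, ← mul_assoc, sub_mul, one_mul, h7, sub_self, zero_mul]
    rw [sub_mul, one_mul, mul_assoc, hV1E, sub_eq_zero] at h5
    exact h5
  have hy1 : ∀ y, (∀ o, y * u (a o) = 0) → y * V1 = 0 := by
    intro y hy
    refine h3 y fun i => ?_
    rw [← mul_assoc, hy, zero_mul]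
  have hcr : star (u (a none)) * V1 = 0 := by
    refine h3 _ fun i => ?_
    rw [← mul_assoc, ho _ _ (fun h => by simpa using ha h), zero_mul]
  have hcr' : star V1 * u (a none) = 0 := by
    have := congrArg star hcr; simpa using this
  refine ⟨f * V1 + u (a none) * w, ?_, ?_⟩
  · have e1 : star (f * V1 + u (a none) * w) * (f * V1 + u (a none) * w) =
        f * (star V1 * V1) + f * ((star V1 * u (a none)) * w) + 
        f * (star w * (star (u (a none)) * V1)) + star w * ((star (u (a none)) * u (a none)) * w) := by
      rw [star_add, add_mul, mul_add, mul_add, hf.cut, hf.lc, star_mul, star_mul, hf.s, hf.c]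
      simp only [mul_assoc]
      abel
    rw [e1, hVV, hcr, hcr', hu, hdw, hw, mul_sub, hfg]
    simp
  · intro y hy
    rw [mul_add, hf.lc, hy1 y hy, ← mul_assoc, hy, mul_zero, zero_mul, add_zero]

theorem two_inj (ι : Type*) [Infinite ι] : ∃ a b : Option ι → ι, Function.Injective a ∧
    Function.Injective b ∧ ∀ o o', a o ≠ b o' := by
  have : Cardinal.mk (Option ι ⊕ Option ι) = Cardinal.mk ι := by
    have h := Cardinal.aleph0_le_mk ι
    rw [Cardinal.mk_sum, Cardinal.mk_option, Cardinal.lift_id, Cardinal.add_one_of_aleph0_le h,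
      Cardinal.add_eq_self h]
  obtain ⟨e⟩ := Cardinal.eq.1 this
  refine ⟨fun o => e (Sum.inl o), fun o => e (Sum.inr o), ?_, ?_, ?_⟩
  · intro o o' h; simpa using h
  · intro o o' h; simpa using h
  · intro o o' h; simp at h

theorem claim_one (hM : ProperlyInfinite M) {g : ↥M} (hg : CP g) (hg0 : g ≠ 0) :
    ∃ f, CP f ∧ f ≠ 0 ∧ f * g = f ∧ Hv f := by
  have hnf : ¬ IsFiniteProjection g := fun h => hg0 (hM g ⟨hg.mem, hg.s, hg.i⟩ h)
  have : ∃ v : ↥M, star v * v = g ∧ g * (v * star v) = v * star v ∧ v * star v ≠ g := by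
    by_contra! h
    exact hnf ⟨hg.s, hg.i, h⟩
  obtain ⟨v, hv1, -, hv3⟩ := this
  have hvg : v * g = v := pi_of_proj hv1 hg.i
  have hgv : g * v = v := by rw [← hg.c, hvg]
  have hvgs : star v * g = star v := by
    have := congrArg star hgv; rwa [star_mul, hg.s] at this
  set d := g - v * star v with hd
  have hd0 : d ≠ 0 := fun h => hv3 (sub_eq_zero.1 h).symm
  have hds : star d = d := by rw [hd, star_sub, hg.s, star_mul, star_star]
  have hgd : g * d = d := by rw [hd, mul_sub, hg.i, ← mul_assoc, hgv]
  have hdv : d * v = 0 := by rw [hd, sub_mul, hgv, mul_assoc, hv1, hvg, sub_self]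
  have hdd : d * d = d := by
    nth_rewrite 2 [hd]
    rw [mul_sub, ← mul_assoc, hdv, zero_mul, sub_zero, hg.c, hgd]
  let u : ℕ → ↥M := fun n => v ^ n * d
  have hus : ∀ n, u (n + 1) = v * u n := fun n => by
    simp only [u]; rw [pow_succ', mul_assoc]
  have hu0 : u 0 = d := by simp [u]
  have hgu : ∀ n, g * u n = u n := by
    intro n
    cases n with
    | zero => rw [hu0, hgd]
    | succ n => rw [hus, ← mul_assoc, hgv]
  have hstep : ∀ m n, star (u (m + 1)) * u (n + 1) = star (u m) * u n := by
    intro m n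
    rw [hus, hus, star_mul, mul_assoc, ← mul_assoc (star v), hv1, hgu]
  have huu : ∀ n, star (u n) * u n = d := by
    intro n
    induction n with
    | zero => rw [hu0, hds, hdd]
    | succ n ih => rw [hstep, ih]
  have huo : ∀ m n, m < n → star (u m) * u n = 0 := by
    intro m
    induction m with
    | zero =>
      intro n hn
      obtain ⟨k, rfl⟩ : ∃ k, n = k + 1 := ⟨n - 1, by omega⟩
      rw [hu0, hus, hds, ← mul_assoc, hdv, zero_mul]
    | succ m ih =>
      intro n hn
      obtain ⟨k, rfl⟩ : ∃ k, n = k + 1 := ⟨n - 1, by omega⟩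
      rw [hstep]; exact ih k (by omega)
  have huo' : ∀ m n, m ≠ n → star (u m) * u n = 0 := by
    intro m n h
    rcases lt_or_gt_of_ne h with h | h
    · exact huo m n h
    · have := congrArg star (huo n m h); simpa using this
  have huinj : Function.Injective u := by
    intro m n h
    by_contra hne
    have h1 := huo' m n hne
    rw [← h, huu] at h1
    exact hd0 h1
  obtain ⟨S, hS0, hS⟩ := zorn_subset_nonempty {S : Set ↥M |
      (∀ x ∈ S, star x * x = d ∧ g * x = x) ∧ (∀ x ∈ S, ∀ y ∈ S, x ≠ y → star x * y = 0)} (by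
    intro c hc hchain hne
    refine ⟨⋃₀ c, ⟨?_, ?_⟩, fun s hs => Set.subset_sUnion_of_mem hs⟩
    · rintro v ⟨s, hs, hv⟩
      exact (hc hs).1 v hv
    · rintro v ⟨s, hs, hv⟩ w ⟨s', hs', hw⟩ hne
      rcases hchain.total hs hs' with h | h
      · exact (hc hs').2 v (h hv) w hw hne
      · exact (hc hs).2 v hv w (h hw) hne) (Set.range u) (by
    constructor
    · rintro _ ⟨n, rfl⟩
      exact ⟨huu n, hgu n⟩
    · rintro _ ⟨m, rfl⟩ _ ⟨n, rfl⟩ hne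
      exact huo' m n fun h => hne (by rw [h]))
  obtain ⟨hS1, hS2⟩ := hS.prop
  have hinf : Infinite S :=
    ((Set.infinite_range_of_injective huinj).mono hS0).to_subtype
  have hSo : ∀ i j : S, i ≠ j → star (i : ↥M) * j = 0 :=
    fun i j hij => hS2 i i.2 j j.2 fun h => hij (Subtype.ext h)
  have hSd : ∀ i : S, (i : ↥M) * d = i := fun i => pi_of_proj (hS1 i i.2).1 hdd
  have hPx : ∀ i : S, (i : ↥M) * star (i : ↥M) * i = i := by
    intro i; rw [mul_assoc, (hS1 i i.2).1, hSd]
  have hPs : ∀ i : S, star ((i : ↥M) * star (i : ↥M)) = i * star (i : ↥M) := by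
    intro i; rw [star_mul, star_star]
  have hPP : ∀ i : S, ((i : ↥M) * star (i : ↥M)) * (i * star (i : ↥M)) = i * star (i : ↥M) := by
    intro i; rw [← mul_assoc, hPx]
  have hPo : ∀ i j : S, i ≠ j → ((i : ↥M) * star (i : ↥M)) * (j * star (j : ↥M)) = 0 := by
    intro i j hij
    rw [mul_assoc, ← mul_assoc (star (i : ↥M)), hSo i j hij, zero_mul, mul_zero]
  obtain ⟨E, hE1, hE2, hE3, hE4⟩ := glue (fun i : S => (i : ↥M) * star (i : ↥M))
    (fun i => by rw [hPs, hPP, hPP]) (fun i j hij => by rw [hPs, hPo i j hij])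
    (fun i j hij => by rw [hPs, hPo i j hij])
  simp only [hPs, hPP] at hE1 hE2
  have hEs : star E * E = E := by
    have := hE3 (star E - 1) fun i => by rw [sub_mul, one_mul, hE2, sub_self]
    rwa [sub_mul, one_mul, sub_eq_zero] at this
  have hEsa : star E = E := by
    rw [← hEs, star_mul, star_star]
  have hEE : E * E = E := by rw [hEsa] at hEs; exact hEs
  have hEu : ∀ i : S, E * i = i := by
    intro i
    nth_rewrite 1 [← hPx i]
    rw [← mul_assoc, hE1, hPx]
  have hE : ∀ y, (∀ i : S, y * (i : ↥M) = 0) → y * E = 0 := by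
    intro y hy
    refine hE3 y fun i => ?_
    rw [← mul_assoc, hy, zero_mul]
  have hgE : g * E = E := by
    have := hE (1 - g) fun i => by rw [sub_mul, one_mul, (hS1 i i.2).2, sub_self]
    rw [sub_mul, one_mul, sub_eq_zero] at this; exact this.symm
  have hrs : star (g - E) = g - E := by rw [star_sub, hg.s, hEsa]
  have hri : (g - E) * (g - E) = g - E := by
    rw [mul_sub, sub_mul, sub_mul, hg.i, hg.c, hgE, hEE]; abel
  have hgr : g * (g - E) = g - E := by rw [mul_sub, hg.i, hgE]
  have hxr : ∀ i : S, star (i : ↥M) * (g - E) = 0 := by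
    intro i
    have : (g - E) * i = 0 := by rw [sub_mul, (hS1 i i.2).2, hEu, sub_self]
    have := congrArg star this
    rwa [star_mul, hrs, star_zero] at this
  obtain ⟨f0, hf0, ⟨w', hwp1, hwp2⟩, ⟨w, hw1, hw2⟩⟩ := comparison hds hdd hrs hri
  have hfd : (1 - f0) * d ≠ 0 := by
    intro h
    rw [sub_mul, one_mul, sub_eq_zero] at h
    rw [← h] at hwp1
    have hrw : (g - E) * w' = w' := by
      nth_rewrite 1 [← hwp2]
      rw [← mul_assoc, hf0.lc, hri, hwp2]
    have hxw : ∀ x ∈ S, star x * w' = 0 := by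
      intro x hx
      rw [← hrw, ← mul_assoc, hxr ⟨x, hx⟩, zero_mul]
    have hwx : ∀ x ∈ S, star w' * x = 0 := by
      intro x hx
      have := congrArg star (hxw x hx); simpa using this
    have hmem : insert w' S ∈ {S : Set ↥M |
      (∀ x ∈ S, star x * x = d ∧ g * x = x) ∧ (∀ x ∈ S, ∀ y ∈ S, x ≠ y → star x * y = 0)} := by
      constructor
      · rintro x (rfl | hx)
        · refine ⟨hwp1, ?_⟩
          rw [← hrw, ← mul_assoc, hgr]
        · exact hS1 x hx
      · rintro x (rfl | hx) y (rfl | hy) hne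
        · exact absurd rfl hne
        · exact hwx y hy
        · exact hxw x hx
        · exact hS2 x hx y hy hne
    have hwpS : w' ∈ S := by
      rw [hS.eq_of_subset hmem (Set.subset_insert _ _)]
      exact Set.mem_insert _ _
    exact hd0 (by rw [← hwp1]; exact hxw _ hwpS)
  have hf : CP ((1 - f0) * g) := hf0.compl.mul hg
  have hfg : (1 - f0) * g * g = (1 - f0) * g := by rw [mul_assoc, hg.i]
  have hdw : d * w = w := by
    nth_rewrite 1 [← hw2]
    rw [← mul_assoc, hf0.compl.lc, hdd, hw2]
  have hww : star w * w = (1 - f0) * g * (g - E) := by rw [hw1, mul_assoc, hgr]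
  obtain ⟨a, b, ha, hb, hab⟩ := two_inj S
  obtain ⟨V, hV1, hV2⟩ := shift (u := fun i : S => (i : ↥M)) hdd (fun i => (hS1 i i.2).1) hSo hEsa
    hEu hE hf hfg hww hdw a ha
  obtain ⟨W, hW1, hW2⟩ := shift (u := fun i : S => (i : ↥M)) hdd (fun i => (hS1 i i.2).1) hSo hEsa
    hEu hE hf hfg hww hdw b hb
  refine ⟨_, hf, fun h => hfd ?_, hfg, V, W, hV1, hW1, hW2 _ fun o => ?_⟩
  · rw [← hgd, ← mul_assoc, h, zero_mul]
  · have := hV2 (star (b o : ↥M)) fun o' => hSo _ _ (hab o' o).symm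
    have := congrArg star this
    simpa using this

theorem halving (hM : ProperlyInfinite M) : Hv (1 : ↥M) := by
  obtain ⟨S, h1, h2, h3⟩ := zornCP (fun e : ↥M => Hv e)
  choose! v w hv hw hvw using fun f hf => (h1 f hf).2
  have ho : ∀ i j : S, i ≠ j → (i : ↥M) * j = 0 :=
    fun i j hij => h2 i i.2 j j.2 fun h => hij (Subtype.ext h)
  obtain ⟨V, hc, -, hVf, hcf, hV0, hV1⟩ := glueC (fun i : S => (i : ↥M)) (fun i => v i) 1
    (fun i => (h1 i i.2).1) ho (fun i => hv i i.2) (fun i => one_mul _)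
  obtain ⟨W, hc', -, hWf, hcf', hW0, hW1⟩ := glueC (fun i : S => (i : ↥M)) (fun i => w i) 1
    (fun i => (h1 i i.2).1) ho (fun i => hw i i.2) (fun i => one_mul _)
  have hfc : ∀ i : S, (i : ↥M) * (star V * V) = i := fun i => by rw [hc.c, hcf]
  have hfc' : ∀ i : S, (i : ↥M) * (star W * W) = i := fun i => by rw [hc'.c, hcf']
  have e1 : star V * V * (star W * W) = star V * V := by
    have := hV0 (1 - star W * W) fun i => by rw [mul_sub, mul_one, hfc', sub_self]
    rw [mul_sub, mul_one, sub_eq_zero] at this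
    rw [mul_assoc, ← this]
  have e2 : star W * W * (star V * V) = star W * W := by
    have := hW0 (1 - star V * V) fun i => by rw [mul_sub, mul_one, hfc, sub_self]
    rw [mul_sub, mul_one, sub_eq_zero] at this
    rw [mul_assoc, ← this]
  have hcc : star W * W = star V * V := by rw [← e1, hc'.c, e2]
  have hVW : star V * W = 0 := by
    refine hW1 _ fun i => ?_
    have h4 : w i * (i : ↥M) = w i := pi_of_proj (hw i i.2) (h1 i i.2).1.i
    rw [← h4, ← mul_assoc, (h1 i i.2).1.c, ← mul_assoc]
    have h5 : (i : ↥M) * star V = star (v i) := by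
      have := congrArg star (hVf i)
      rwa [star_mul, (h1 i i.2).1.s] at this
    rw [h5, hvw i i.2]
  have h1c : 1 - star V * V = 0 := by
    by_contra hne
    obtain ⟨f, hf, hf0, hfg, hHf⟩ := claim_one hM hc.compl hne
    have hcf0 : (star V * V) * f = 0 := by
      rw [mul_sub, mul_one, sub_eq_self] at hfg
      rw [← hc.c, hfg]
    have hmem : f ∈ S := by
      refine h3 f hf hHf fun i hi => ?_
      have h5 : i * (star V * V) = i := hfc ⟨i, hi⟩
      rw [← h5, mul_assoc, hcf0, mul_zero]
    have h6 : star V * V * f = f := hcf ⟨f, hmem⟩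
    exact hf0 (h6.symm.trans hcf0)
  rw [sub_eq_zero] at h1c
  exact ⟨V, W, h1c.symm, by rw [hcc, h1c], hVW⟩

/-- **Lemma.** A bounded `Z`-module map `φ : M → Z ⊆ M` preserves all
norm-closed two-sided ideals of `M` iff `φ(M_t) ⊆ t` for every maximal ideal
`t` of the center `Z` (where `M_t` is the unique maximal ideal of `M`
containing `t`).  If `M` is properly infinite this is further equivalent to
`φ` vanishing on the strong radical. -/
theorem moduleMap_preserves_ideals_iff
    (φ : ↥M →L[ℂ] ↥M)
    (hrange : ∀ x : ↥M, φ x ∈ Set.center ↥M)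
    (hmod : ∀ z ∈ Set.center ↥M, ∀ x : ↥M, φ (z * x) = z * φ x) :
    ((∀ J : Set ↥M, IsClosedIdeal J → ∀ x ∈ J, φ x ∈ J) ↔
      (∀ t Mt : Set ↥M, IsMaxCenterIdeal t → IsMaximalIdeal Mt → t ⊆ Mt →
        ∀ x ∈ Mt, φ x ∈ t)) ∧
    (ProperlyInfinite M →
      ((∀ J : Set ↥M, IsClosedIdeal J → ∀ x ∈ J, φ x ∈ J) ↔
        ∀ x ∈ strongRadical M, φ x = 0)) := by
  exact ⟨part_one φ hrange, fun hM => ⟨part_two_mp φ hrange,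
    part_two_mpr (halving hM) φ hmod⟩⟩

end VonNeumannAlgebraPaper

end
end

section
/- Let R be a W*-algebra with center Z, Δ the maximal ideal space of Z, and for t ∈ Δ let M_t be the unique maximal norm-closed two-sided ideal of R containing t. A unital positive Z-module map φ: R → Z ⊆ R lies in the point-norm closure of E(R) if and only if φ(M_t) ⊆ t for every t ∈ Δ. -/
universe u

open scoped ComplexConjugate ComplexOrder

noncomputable section

variable {H : Type u} [NormedAddCommGroup H] [InnerProductSpace ℂ H] [CompleteSpace H]

local notation "⟪" x ", " y "⟫" => @inner ℂ _ _ x y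

namespace VonNeumannAlgebraPaper

variable {M : VonNeumannAlgebra H}

section Generic
open scoped Pointwise ComplexStarModule
set_option linter.unusedSectionVars false
variable {A : Type*} [CStarAlgebra A] [PartialOrder A] [StarOrderedRing A]

lemma cen_comm {z : A} (hz : z ∈ Set.center A) (a : A) : z * a = a * z :=
  ((Semigroup.mem_center_iff.1 hz) a).symm

lemma cen_posPart {q : A} (hq : q ∈ Set.center A) : q⁺ ∈ Set.center A := by
  rw [Semigroup.mem_center_iff]
  intro g
  have h : Commute q g := cen_comm hq g
  rw [CFC.posPart_def]
  exact (h.cfcₙ_real _).symm.eq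

lemma cen_negPart {q : A} (hq : q ∈ Set.center A) : q⁻ ∈ Set.center A := by
  rw [Semigroup.mem_center_iff]
  intro g
  have h : Commute q g := cen_comm hq g
  rw [CFC.negPart_def]
  exact (h.cfcₙ_real _).symm.eq

lemma cen_sqrt {q : A} (hq : q ∈ Set.center A) : CFC.sqrt q ∈ Set.center A := by
  rw [Semigroup.mem_center_iff]
  intro g
  have h : Commute q g := cen_comm hq g
  rw [CFC.sqrt]
  exact (h.cfcₙ_nnreal _).symm.eq

lemma cen_mul_nonneg {z a : A} (hz : z ∈ Set.center A) (h0 : 0 ≤ z) (ha : 0 ≤ a) :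
    0 ≤ z * a := by
  have h1 : z * a = star (CFC.sqrt z) * a * CFC.sqrt z := by
    have hs : IsSelfAdjoint (CFC.sqrt z) := (CFC.sqrt_nonneg z).isSelfAdjoint
    rw [hs.star_eq, mul_assoc, ← cen_comm (cen_sqrt hz) a, ← mul_assoc, CFC.sqrt_mul_sqrt_self z h0]
  rw [h1]
  exact star_left_conjugate_nonneg ha _

lemma cen_mul_le {z a b : A} (hz : z ∈ Set.center A) (h0 : 0 ≤ z) (hab : a ≤ b) :
    z * a ≤ z * b := by
  have := cen_mul_nonneg hz h0 (sub_nonneg.2 hab)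
  rw [mul_sub] at this
  exact sub_nonneg.1 this

lemma cen_smul {z : A} (hz : z ∈ Set.center A) (r : ℝ) : r • z ∈ Set.center A := by
  rw [Semigroup.mem_center_iff]
  intro g
  rw [mul_smul_comm, smul_mul_assoc, cen_comm hz]

lemma cen_add {z w : A} (hz : z ∈ Set.center A) (hw : w ∈ Set.center A) :
    z + w ∈ Set.center A := Set.add_mem_center hz hw

lemma cen_sub {z w : A} (hz : z ∈ Set.center A) (hw : w ∈ Set.center A) :
    z - w ∈ Set.center A := by
  rw [sub_eq_add_neg]; exact Set.add_mem_center hz (Set.neg_mem_center hw)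

/-- Elementary ucp maps. -/
def IsElem (ψ : A →L[ℂ] A) : Prop :=
  ∃ (n : ℕ) (a : Fin n → A), (∑ i, star (a i) * a i) = 1 ∧
    ∀ x : A, ψ x = ∑ i, star (a i) * x * a i

lemma isElem_of_fintype {ι : Type*} [Fintype ι] (a : ι → A) (h1 : (∑ i, star (a i) * a i) = 1)
    (ψ : A →L[ℂ] A) (h : ∀ x : A, ψ x = ∑ i, star (a i) * x * a i) : IsElem ψ := by
  refine ⟨Fintype.card ι, a ∘ (Fintype.equivFin ι).symm, ?_, ?_⟩
  · rw [← h1]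
    exact Equiv.sum_comp (Fintype.equivFin ι).symm (fun i => star (a i) * a i)
  · intro x
    rw [h]
    exact (Equiv.sum_comp (Fintype.equivFin ι).symm (fun i => star (a i) * x * a i)).symm

lemma IsElem.comb {κ : Type*} [Fintype κ] (c : κ → A) (hc : ∑ k, star (c k) * c k = 1)
    (ψ : κ → A →L[ℂ] A) (h : ∀ k, IsElem (ψ k)) :
    ∃ θ : A →L[ℂ] A, IsElem θ ∧ ∀ x, θ x = ∑ k, star (c k) * ψ k x * c k := by
  choose n a h1 h2 using h
  have key : ∀ x, (∑ k, (ContinuousLinearMap.mulLeftRight ℂ A (star (c k)) (c k)).comp (ψ k)) x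
      = ∑ k, star (c k) * ψ k x * c k := by
    intro x
    simp
  refine ⟨_, ?_, key⟩
  refine isElem_of_fintype (ι := Σ k, Fin (n k)) (fun p => a p.1 p.2 * c p.1) ?_ _ ?_
  · rw [Fintype.sum_sigma, ← hc]
    refine Finset.sum_congr rfl fun k _ => ?_
    have : star (c k) * (∑ i, star (a k i) * a k i) * c k = star (c k) * c k := by
      rw [h1, mul_one]
    rw [← this, Finset.mul_sum, Finset.sum_mul]
    simp [mul_assoc]
  · intro x
    rw [key, Fintype.sum_sigma]
    refine Finset.sum_congr rfl fun k _ => ?_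
    rw [h2, Finset.mul_sum, Finset.sum_mul]
    simp [mul_assoc]

lemma IsElem.comp {ψ θ : A →L[ℂ] A} (hψ : IsElem ψ) (hθ : IsElem θ) : IsElem (ψ.comp θ) := by
  obtain ⟨n, a, h1, h2⟩ := hψ
  obtain ⟨η, hη, h⟩ := IsElem.comb a h1 (fun _ => θ) (fun _ => hθ)
  have : ψ.comp θ = η := by
    ext x
    rw [h, ContinuousLinearMap.comp_apply, h2]
  rwa [this]

lemma IsElem.one {ψ : A →L[ℂ] A} (hψ : IsElem ψ) : ψ 1 = 1 := by
  obtain ⟨n, a, h1, h2⟩ := hψ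
  rw [h2]; simpa using h1

lemma IsElem.cen {ψ : A →L[ℂ] A} (hψ : IsElem ψ) {z : A} (hz : z ∈ Set.center A) (x : A) :
    ψ (z * x) = z * ψ x := by
  obtain ⟨n, a, h1, h2⟩ := hψ
  rw [h2, h2, Finset.mul_sum]
  refine Finset.sum_congr rfl fun k _ => ?_
  rw [← mul_assoc, ← mul_assoc, ← mul_assoc, cen_comm hz (star (a k))]

lemma IsElem.cen' {ψ : A →L[ℂ] A} (hψ : IsElem ψ) {z : A} (hz : z ∈ Set.center A) :
    ψ z = z := by
  have := hψ.cen hz 1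
  rwa [hψ.one, mul_one] at this

lemma IsElem.nonneg {ψ : A →L[ℂ] A} (hψ : IsElem ψ) {x : A} (hx : 0 ≤ x) : 0 ≤ ψ x := by
  obtain ⟨n, a, h1, h2⟩ := hψ
  rw [h2]
  exact Finset.sum_nonneg fun i _ => star_left_conjugate_nonneg hx _

lemma IsElem.mono {ψ : A →L[ℂ] A} (hψ : IsElem ψ) {x y : A} (hx : x ≤ y) : ψ x ≤ ψ y := by
  have := hψ.nonneg (sub_nonneg.2 hx)
  rw [map_sub] at this
  exact sub_nonneg.1 this

lemma IsElem.sa {ψ : A →L[ℂ] A} (hψ : IsElem ψ) {x : A} (hx : IsSelfAdjoint x) :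
    IsSelfAdjoint (ψ x) := by
  obtain ⟨n, a, h1, h2⟩ := hψ
  rw [h2]
  refine isSelfAdjoint_sum _ fun i _ => ?_
  have := hx.conjugate' (a i)
  exact this

lemma isElem_id : IsElem (ContinuousLinearMap.id ℂ A) :=
  ⟨1, fun _ => 1, by simp, by simp⟩

lemma IsElem.real_smul (ψ : A →L[ℂ] A) (r : ℝ) (x : A) : ψ (r • x) = r • ψ x := by
  simp

/-- Local states. -/
structure St (w : A →ₗ[ℝ] ℝ) : Prop where
  pos : ∀ a, 0 ≤ a → 0 ≤ w a
  one : w 1 = 1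
  mul : ∀ z ∈ Set.center A, 0 ≤ z → ∀ a, IsSelfAdjoint a → w (z * a) = w z * w a

lemma St.mono {w : A →ₗ[ℝ] ℝ} (hw : St w) {a b : A} (h : a ≤ b) : w a ≤ w b := by
  have := hw.pos _ (sub_nonneg.2 h)
  rw [map_sub] at this
  linarith

/-- `a` is at least `s` near the point. -/
def LB (w : A →ₗ[ℝ] ℝ) (a : A) (s : ℝ) : Prop :=
  ∃ z ∈ Set.center A, 0 ≤ z ∧ 0 < w z ∧ s • z ≤ z * a

lemma LB.add {w : A →ₗ[ℝ] ℝ} (hw : St w) {a b : A} {s r : ℝ} (h : LB w a s) (h' : LB w b r) :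
    LB w (a + b) (s + r) := by
  obtain ⟨z, hz, z0, z1, h⟩ := h
  obtain ⟨y, hy, y0, y1, h'⟩ := h'
  refine ⟨z * y, Set.mul_mem_center hz hy, cen_mul_nonneg hz z0 y0, ?_, ?_⟩
  · rw [hw.mul z hz z0 y y0.isSelfAdjoint]; positivity
  · have e1 := cen_mul_le hy y0 h
    have e2 := cen_mul_le hz z0 h'
    calc (s + r) • (z * y) = y * (s • z) + z * (r • y) := by
          rw [add_smul, mul_smul_comm, mul_smul_comm, cen_comm hy z]
      _ ≤ y * (z * a) + z * (y * b) := add_le_add e1 e2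
      _ = z * y * (a + b) := by rw [mul_add, ← mul_assoc, ← mul_assoc, cen_comm hy z]

lemma LB.smul {w : A →ₗ[ℝ] ℝ} {a : A} {s : ℝ} (h : LB w a s) {c : ℝ} (hc : 0 ≤ c) :
    LB w (c • a) (c * s) := by
  obtain ⟨z, hz, z0, z1, h⟩ := h
  refine ⟨z, hz, z0, z1, ?_⟩
  rw [mul_smul_comm, mul_smul]
  exact smul_le_smul_of_nonneg_left h hc

lemma LB.elem {w : A →ₗ[ℝ] ℝ} {a : A} {s : ℝ} (h : LB w a s) {ψ : A →L[ℂ] A} (hψ : IsElem ψ) :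
    LB w (ψ a) s := by
  obtain ⟨z, hz, z0, z1, h⟩ := h
  refine ⟨z, hz, z0, z1, ?_⟩
  have := hψ.mono h
  rwa [hψ.cen hz, IsElem.real_smul, hψ.cen' hz] at this

lemma LB.le {w : A →ₗ[ℝ] ℝ} (hw : St w) {a : A} (ha : IsSelfAdjoint a) {s : ℝ} (h : LB w a s) :
    s ≤ w a := by
  obtain ⟨z, hz, z0, z1, h⟩ := h
  have := hw.mono h
  rw [hw.mul z hz z0 a ha, map_smul, smul_eq_mul, mul_comm] at this
  exact le_of_mul_le_mul_left this z1

lemma LB.weaken {w : A →ₗ[ℝ] ℝ} {a : A} {s r : ℝ} (h : LB w a s) (hr : r ≤ s) : LB w a r := by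
  obtain ⟨z, hz, z0, z1, h⟩ := h
  exact ⟨z, hz, z0, z1, (smul_le_smul_of_nonneg_right hr z0).trans h⟩

lemma LB.of_le {w : A →ₗ[ℝ] ℝ} (hw : St w) {a : A} {s : ℝ} (h : s • (1 : A) ≤ a) : LB w a s :=
  ⟨1, Set.one_mem_center, zero_le_one, by rw [hw.one]; exact one_pos, by simpa using h⟩


/-- Algebraic two-sided ideals. -/
def AlgIdl (J : Set A) : Prop :=
  (0 : A) ∈ J ∧ (∀ x ∈ J, ∀ y ∈ J, x + y ∈ J) ∧ (∀ (a : A), ∀ x ∈ J, a * x ∈ J ∧ x * a ∈ J)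

/-- Closed two-sided ideals. -/
def ClosedIdl (J : Set A) : Prop :=
  IsClosed J ∧ (0 : A) ∈ J ∧ (∀ x ∈ J, ∀ y ∈ J, x + y ∈ J) ∧
    (∀ (c : ℂ), ∀ x ∈ J, c • x ∈ J) ∧ (∀ (a : A), ∀ x ∈ J, a * x ∈ J ∧ x * a ∈ J)

/-- Maximal closed two-sided ideals. -/
def MaxIdl (N : Set A) : Prop :=
  ClosedIdl N ∧ N ≠ Set.univ ∧
    ∀ N' : Set A, ClosedIdl N' → N' ≠ Set.univ → N ⊆ N' → N' = N

lemma AlgIdl.eq_univ {J : Set A} (hJ : AlgIdl J) (h : (1 : A) ∈ J) : J = Set.univ := by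
  refine Set.eq_univ_of_forall fun x => ?_
  have := (hJ.2.2 x 1 h).1
  rwa [mul_one] at this

lemma AlgIdl.one_not_mem_closure {J : Set A} (hJ : AlgIdl J) (h : (1 : A) ∉ J) :
    (1 : A) ∉ closure J := by
  intro h1
  obtain ⟨k, hk, hd⟩ := Metric.mem_closure_iff.1 h1 1 one_pos
  rw [dist_eq_norm] at hd
  have hu : IsUnit k := by
    have := isUnit_one_sub_of_norm_lt_one hd
    rwa [sub_sub_cancel] at this
  obtain ⟨u, rfl⟩ := hu
  apply h
  have := (hJ.2.2 (↑u⁻¹ : A) _ hk).1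
  rwa [Units.inv_mul] at this

lemma AlgIdl.closure {J : Set A} (hJ : AlgIdl J) : AlgIdl (closure J) := by
  refine ⟨subset_closure hJ.1, fun x hx y hy => ?_, fun a x hx => ⟨?_, ?_⟩⟩
  · exact map_mem_closure₂ continuous_add hx hy (fun a ha b hb => hJ.2.1 a ha b hb)
  · exact map_mem_closure (continuous_const_mul a) hx (fun b hb => (hJ.2.2 a b hb).1)
  · exact map_mem_closure (f := fun b => b * a) (continuous_mul_const a) hx (fun b hb => (hJ.2.2 a b hb).2)

lemma exists_maxIdl {I : Set A} (hI : AlgIdl I) (h1 : (1 : A) ∉ I) :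
    ∃ K, MaxIdl K ∧ I ⊆ K := by
  obtain ⟨K, hIK, hK⟩ := zorn_subset_nonempty {K : Set A | AlgIdl K ∧ (1 : A) ∉ K} (by
    intro c hc hchain hne
    refine ⟨⋃₀ c, ⟨⟨?_, ?_, ?_⟩, ?_⟩, fun s hs => Set.subset_sUnion_of_mem hs⟩
    · obtain ⟨s, hs⟩ := hne
      exact ⟨s, hs, (hc hs).1.1⟩
    · rintro x ⟨s, hs, hx⟩ y ⟨t, ht, hy⟩
      rcases hchain.total hs ht with h | h
      · exact ⟨t, ht, (hc ht).1.2.1 x (h hx) y hy⟩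
      · exact ⟨s, hs, (hc hs).1.2.1 x hx y (h hy)⟩
    · rintro a x ⟨s, hs, hx⟩
      exact ⟨⟨s, hs, ((hc hs).1.2.2 a x hx).1⟩, ⟨s, hs, ((hc hs).1.2.2 a x hx).2⟩⟩
    · rintro ⟨s, hs, hx⟩
      exact (hc hs).2 hx) I ⟨hI, h1⟩
  have hKa : AlgIdl K := hK.prop.1
  have hcl : closure K = K := by
    have := hK.eq_of_subset (t := closure K)
      ⟨hKa.closure, hKa.one_not_mem_closure hK.prop.2⟩ subset_closure
    exact this.symm
  refine ⟨K, ⟨⟨?_, hKa.1, hKa.2.1, ?_, hKa.2.2⟩, ?_, ?_⟩, hIK⟩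
  · rw [← hcl]; exact isClosed_closure
  · intro c x hx
    have := (hKa.2.2 (c • (1 : A)) x hx).1
    rwa [smul_mul_assoc, one_mul] at this
  · intro h
    exact hK.prop.2 (h ▸ Set.mem_univ _)
  · intro N hN hne hKN
    have hNa : AlgIdl N := ⟨hN.2.1, hN.2.2.1, hN.2.2.2.2⟩
    exact (hK.eq_of_subset (t := N) ⟨hNa, fun h => hne (hNa.eq_univ h)⟩ hKN).symm

/-- Central bump elements. -/
def Bump (w : A →ₗ[ℝ] ℝ) (u : A) : Prop := u ∈ Set.center A ∧ 0 ≤ u ∧ u ≤ 1 ∧ w u = 1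

lemma St.parts {w : A →ₗ[ℝ] ℝ} (hw : St w) {q : A} (hq : q ∈ Set.center A)
    (hs : IsSelfAdjoint q) (h : 0 < w q) : w q⁺ = w q := by
  have h1 : w (q⁺ * q⁻) = w q⁺ * w q⁻ :=
    hw.mul _ (cen_posPart hq) (CFC.posPart_nonneg q) _ (CFC.negPart_nonneg q).isSelfAdjoint
  rw [CFC.posPart_mul_negPart, map_zero] at h1
  have h2 : w q⁺ - w q⁻ = w q := by rw [← map_sub, CFC.posPart_sub_negPart q hs]
  have h3 := hw.pos _ (CFC.negPart_nonneg q)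
  rcases mul_eq_zero.1 h1.symm with h4 | h4
  · linarith
  · linarith

lemma posPart_mul_self' {q : A} (hs : IsSelfAdjoint q) : q⁺ * q = q⁺ * q⁺ := by
  have h := CFC.posPart_sub_negPart q hs
  calc q⁺ * q = q⁺ * (q⁺ - q⁻) := by rw [h]
    _ = q⁺ * q⁺ := by rw [mul_sub, CFC.posPart_mul_negPart, sub_zero]

lemma exists_bump {w : A →ₗ[ℝ] ℝ} (hw : St w) {q : A} (hq : q ∈ Set.center A) (h0 : 0 ≤ q)
    (h : w q = 0) {ε : ℝ} (hε : 0 < ε) : ∃ u, Bump w u ∧ u * q ≤ ε • (1 : A) := by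
  set p : A := 1 - ε⁻¹ • q with hp
  have hpc : p ∈ Set.center A := cen_sub Set.one_mem_center (cen_smul hq _)
  have hps : IsSelfAdjoint p :=
    (IsSelfAdjoint.one A).sub ((smul_nonneg (inv_nonneg.2 hε.le) h0).isSelfAdjoint)
  have hwp : w p = 1 := by rw [hp, map_sub, map_smul, h, hw.one]; simp
  have hv0 : 0 ≤ p⁺ := CFC.posPart_nonneg p
  have hvc := cen_posPart hpc
  have hvv := posPart_mul_self' hps
  have hp1 : 0 ≤ 1 - p := by
    rw [hp, sub_sub_cancel]; exact smul_nonneg (inv_nonneg.2 hε.le) h0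
  have h1 : p⁺ * p⁺ ≤ p⁺ := by
    have := cen_mul_nonneg hvc hv0 hp1
    rw [mul_sub, mul_one, hvv] at this
    exact sub_nonneg.1 this
  have hle : p⁺ ≤ 1 := by
    have h2 : 0 ≤ star (1 - p⁺) * (1 - p⁺) := star_mul_self_nonneg _
    have h3 : star (1 - p⁺) = 1 - p⁺ := ((IsSelfAdjoint.one A).sub hv0.isSelfAdjoint).star_eq
    rw [h3] at h2
    have h4 := add_nonneg h2 (sub_nonneg.2 h1)
    have h5 : (1 - p⁺) * (1 - p⁺) + (p⁺ - p⁺ * p⁺) = 1 - p⁺ := by noncomm_ring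
    rw [h5] at h4
    exact sub_nonneg.1 h4
  refine ⟨p⁺, ⟨hvc, hv0, hle, ?_⟩, ?_⟩
  · rw [hw.parts hpc hps (by rw [hwp]; exact one_pos), hwp]
  · have hqe : q = ε • (1 - p) := by
      rw [hp, sub_sub_cancel, smul_smul, mul_inv_cancel₀ hε.ne', one_smul]
    rw [hqe, mul_smul_comm]
    refine smul_le_smul_of_nonneg_left ?_ hε.le
    rw [mul_sub, mul_one, hvv]
    have : 0 ≤ p⁺ * p⁺ := cen_mul_nonneg hvc hv0 hv0
    exact (sub_le_self _ this).trans hle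

lemma Bump.mul {w : A →ₗ[ℝ] ℝ} (hw : St w) {u v : A} (hu : Bump w u) (hv : Bump w v) :
    Bump w (u * v) := by
  refine ⟨Set.mul_mem_center hu.1 hv.1, cen_mul_nonneg hu.1 hu.2.1 hv.2.1, ?_, ?_⟩
  · calc u * v ≤ u * 1 := cen_mul_le hu.1 hu.2.1 hv.2.2.1
      _ = u := mul_one _
      _ ≤ 1 := hu.2.2.1
  · rw [hw.mul u hu.1 hu.2.1 v hv.2.1.isSelfAdjoint, hu.2.2.2, hv.2.2.2, one_mul]

lemma Bump.mul_le {w : A →ₗ[ℝ] ℝ} {u a : A} (hu : Bump w u) (ha : 0 ≤ a) : u * a ≤ a := by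
  have := cen_mul_nonneg (cen_sub Set.one_mem_center hu.1) (sub_nonneg.2 hu.2.2.1) ha
  rw [sub_mul, one_mul] at this
  exact sub_nonneg.1 this

lemma Bump.one {w : A →ₗ[ℝ] ℝ} (hw : St w) : Bump w 1 :=
  ⟨Set.one_mem_center, zero_le_one, le_rfl, hw.one⟩

/-- Finite sums of conjugates of `h * h`. -/
def Cone (h B : A) : Prop := ∃ (n : ℕ) (b : Fin n → A), B = ∑ i, star (b i) * (h * h) * b i

lemma Cone.add {h B C : A} (hB : Cone h B) (hC : Cone h C) : Cone h (B + C) := by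
  obtain ⟨n, b, rfl⟩ := hB
  obtain ⟨m, c, rfl⟩ := hC
  refine ⟨n + m, Fin.append b c, ?_⟩
  rw [Fin.sum_univ_add]
  simp

lemma Cone.conj {h B : A} (hB : Cone h B) (c : A) : Cone h (star c * B * c) := by
  obtain ⟨n, b, rfl⟩ := hB
  refine ⟨n, fun i => b i * c, ?_⟩
  rw [Finset.mul_sum, Finset.sum_mul]
  simp [mul_assoc]

lemma Cone.smul {h B : A} (hB : Cone h B) {r : ℝ} (hr : 0 ≤ r) : Cone h (r • B) := by
  have := hB.conj (Real.sqrt r • (1 : A))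
  simpa [smul_smul, Real.mul_self_sqrt hr] using this

lemma Cone.zero (h : A) : Cone h 0 := ⟨0, fun _ => 0, by simp⟩

lemma Cone.nonneg {h B : A} (hh : IsSelfAdjoint h) (hB : Cone h B) : 0 ≤ B := by
  obtain ⟨n, b, rfl⟩ := hB
  refine Finset.sum_nonneg fun i _ => star_left_conjugate_nonneg ?_ _
  have := star_mul_self_nonneg h
  rwa [hh.star_eq] at this

/-- The ideal of elements dominated by `h` near the point. -/
def Dom (w : A →ₗ[ℝ] ℝ) (h : A) : Set A :=
  {a | ∀ ε : ℝ, 0 < ε → ∃ B, Cone h B ∧ ∃ u, Bump w u ∧ u * (star a * a) ≤ B + ε • (1 : A)}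

lemma star_mul_le_smul (c : A) : star c * c ≤ (‖c‖ ^ 2 + 1) • (1 : A) := by
  have h := CStarAlgebra.star_mul_le_algebraMap_norm_sq (a := c)
  rw [Algebra.algebraMap_eq_smul_one] at h
  exact h.trans (smul_le_smul_of_nonneg_right (by linarith) zero_le_one)

lemma dom_algIdl {w : A →ₗ[ℝ] ℝ} (hw : St w) {h : A} (hh : IsSelfAdjoint h) :
    AlgIdl (Dom w h) := by
  refine ⟨?_, ?_, ?_⟩
  · intro ε hε
    refine ⟨0, Cone.zero h, 1, Bump.one hw, ?_⟩
    simpa using smul_nonneg hε.le (zero_le_one (α := A))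
  · intro a ha b hb ε hε
    obtain ⟨B, hB, u, hu, h1⟩ := ha (ε / 4) (by positivity)
    obtain ⟨C, hC, v, hv, h2⟩ := hb (ε / 4) (by positivity)
    refine ⟨(2 : ℝ) • (B + C), (hB.add hC).smul (by norm_num), u * v, hu.mul hw hv, ?_⟩
    have e1 : star (a + b) * (a + b) ≤ (2 : ℝ) • (star a * a + star b * b) := by
      rw [← sub_nonneg]
      have := star_mul_self_nonneg (a - b)
      convert this using 1
      rw [two_smul, star_add, star_sub]
      noncomm_ring
    have e2 : u * v * (star a * a) ≤ B + (ε / 4) • (1 : A) := by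
      have h3 := cen_mul_le hv.1 hv.2.1 h1
      rw [← mul_assoc, cen_comm hv.1 u] at h3
      refine h3.trans (hv.mul_le ?_)
      exact add_nonneg (hB.nonneg hh) (smul_nonneg (by positivity) zero_le_one)
    have e3 : u * v * (star b * b) ≤ C + (ε / 4) • (1 : A) := by
      have h3 := cen_mul_le hu.1 hu.2.1 h2
      rw [← mul_assoc] at h3
      refine h3.trans (hu.mul_le ?_)
      exact add_nonneg (hC.nonneg hh) (smul_nonneg (by positivity) zero_le_one)
    have e4 := cen_mul_le (hu.mul hw hv).1 (hu.mul hw hv).2.1 e1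
    refine e4.trans ?_
    rw [mul_smul_comm, mul_add]
    refine (smul_le_smul_of_nonneg_left (add_le_add e2 e3) (by norm_num : (0:ℝ) ≤ 2)).trans ?_
    apply le_of_eq
    module
  · intro c a ha
    have hr : 0 < ‖c‖ ^ 2 + 1 := by positivity
    set r := ‖c‖ ^ 2 + 1 with hrd
    have hcc : star c * c ≤ r • (1 : A) := star_mul_le_smul c
    constructor
    · intro ε hε
      obtain ⟨B, hB, u, hu, h1⟩ := ha (ε / r) (by positivity)
      refine ⟨r • B, hB.smul hr.le, u, hu, ?_⟩
      have e1 : star (c * a) * (c * a) ≤ r • (star a * a) := by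
        have := star_left_conjugate_le_conjugate hcc a
        simpa [mul_assoc] using this
      refine (cen_mul_le hu.1 hu.2.1 e1).trans ?_
      rw [mul_smul_comm]
      refine (smul_le_smul_of_nonneg_left h1 hr.le).trans (le_of_eq ?_)
      rw [smul_add, smul_smul, mul_div_cancel₀ _ hr.ne']
    · intro ε hε
      obtain ⟨B, hB, u, hu, h1⟩ := ha (ε / r) (by positivity)
      refine ⟨star c * B * c, hB.conj c, u, hu, ?_⟩
      have e1 := star_left_conjugate_le_conjugate h1 c
      have e2 : star c * (u * (star a * a)) * c = u * (star (a * c) * (a * c)) := by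
        rw [← mul_assoc (star c) u, ← cen_comm hu.1]
        simp [mul_assoc]
      rw [e2] at e1
      refine e1.trans ?_
      rw [mul_add, add_mul]
      refine add_le_add le_rfl ?_
      rw [mul_smul_comm, mul_one, smul_mul_assoc]
      refine (smul_le_smul_of_nonneg_left hcc (by positivity)).trans (le_of_eq ?_)
      rw [smul_smul, div_mul_cancel₀ _ hr.ne']

lemma key_lemma {w : A →ₗ[ℝ] ℝ} (hw : St w)
    (hP : ∀ K : Set A, MaxIdl K → (∀ z ∈ Set.center A, w (star z * z) = 0 → z ∈ K) →
      ∀ a ∈ K, w a = 0)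
    {y : A} (hy : IsSelfAdjoint y) {s' : ℝ} (hs' : s' < w y) :
    ∃ ψ : A →L[ℂ] A, IsElem ψ ∧ LB w (ψ y) s' := by
  obtain ⟨s, hss, hsy⟩ := exists_between hs'
  set x : A := y - s • (1 : A) with hx
  have hxs : IsSelfAdjoint x := hy.sub ((IsSelfAdjoint.all s).smul (IsSelfAdjoint.one A))
  set h : A := x⁺ with hh
  have h0 : 0 ≤ h := CFC.posPart_nonneg x
  have hsa : IsSelfAdjoint h := h0.isSelfAdjoint
  have hwh : 0 < w h := by
    have h1 := hw.mono (CFC.le_posPart hxs)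
    rw [hx, map_sub, map_smul, hw.one, smul_eq_mul, mul_one] at h1
    rw [hh]; linarith
  have hhx : 0 ≤ h * x * h := by
    rw [hh, posPart_mul_self' hxs, ← hh]
    have := star_left_conjugate_nonneg h0 h
    rwa [hsa.star_eq] at this
  have hone : (1 : A) ∈ Dom w h := by
    by_contra hcon
    obtain ⟨K, hK, hIK⟩ := exists_maxIdl (dom_algIdl hw hsa) hcon
    have hhK : h ∈ K := by
      apply hIK
      intro ε hε
      refine ⟨h * h, ⟨1, fun _ => 1, by simp⟩, 1, Bump.one hw, ?_⟩
      rw [one_mul, hsa.star_eq]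
      exact le_add_of_nonneg_right (smul_nonneg hε.le zero_le_one)
    have := hP K hK (fun z hz hwz => by
      apply hIK
      intro ε hε
      obtain ⟨u, hu, hle⟩ := exists_bump hw (Set.mul_mem_center (Set.star_mem_center hz) hz)
        (star_mul_self_nonneg z) hwz hε
      exact ⟨0, Cone.zero h, u, hu, by rwa [zero_add]⟩) h hhK
    linarith
  obtain ⟨B, hB, u, hu, hle⟩ := hone (1 / 4) (by norm_num)
  rw [star_one, mul_one, mul_one] at hle
  set B' : A := B + (1 - u) with hB'
  have hB'le : (3 / 4 : ℝ) • (1 : A) ≤ B' := by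
    have : B' - (3 / 4 : ℝ) • (1 : A) = (B + (1 / 4 : ℝ) • (1 : A)) - u := by
      rw [hB']; module
    rw [← sub_nonneg, this]
    exact sub_nonneg.2 hle
  have hB'pos : IsStrictlyPositive B' := by
    refine IsStrictlyPositive.of_le (a := (3 / 4 : ℝ) • (1 : A)) ?_ hB'le
    exact IsStrictlyPositive.smul (by norm_num) isStrictlyPositive_one
  obtain ⟨g, g0, hg⟩ : ∃ g : A, 0 ≤ g ∧ g * B' * g = 1 :=
    ⟨B' ^ (-(1 / 2) : ℝ), CFC.rpow_nonneg, by
      have := CFC.conjugate_rpow_neg_one_half B' hB'pos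
      exact this⟩
  have hgs : star g = g := g0.isSelfAdjoint.star_eq
  have hgg : (3 / 4 : ℝ) • (g * g) ≤ 1 := by
    have := star_left_conjugate_le_conjugate hB'le g
    rw [hgs, hg] at this
    simpa using this
  obtain ⟨n, b, hb⟩ := hB
  have hm0 : 0 ≤ 1 - u := sub_nonneg.2 hu.2.2.1
  have hmc : 1 - u ∈ Set.center A := cen_sub Set.one_mem_center hu.1
  set m : A := CFC.sqrt (1 - u) with hm
  have hmm : m * m = 1 - u := CFC.sqrt_mul_sqrt_self _ hm0
  have hms : star m = m := (CFC.sqrt_nonneg (1 - u)).isSelfAdjoint.star_eq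
  have hmcen : m ∈ Set.center A := cen_sqrt hmc
  let a : Option (Fin n) → A := fun o => o.elim (m * g) (fun i => h * b i * g)
  have hsum : ∀ t : A, ∑ o, star (a o) * t * a o =
      (1 - u) * (g * t * g) + ∑ i, star (h * b i * g) * t * (h * b i * g) := by
    intro t
    rw [Fintype.sum_option]
    congr 1
    show star (m * g) * t * (m * g) = _
    rw [star_mul, hms, hgs, ← hmm, ← cen_comm hmcen g]
    simp only [mul_assoc]
    rw [← mul_assoc t m g, ← cen_comm hmcen t, mul_assoc, ← mul_assoc g m, ← cen_comm hmcen g]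
    simp only [mul_assoc]
  have hunit : ∑ o, star (a o) * a o = 1 := by
    have h1 := hsum 1
    simp only [mul_one] at h1
    rw [h1]
    refine Eq.trans ?_ hg
    rw [hB', hb, mul_add g, add_mul _ _ g, Finset.mul_sum, Finset.sum_mul, add_comm]
    congr 1
    · refine Finset.sum_congr rfl fun i _ => ?_
      simp only [star_mul, hgs, hsa.star_eq, mul_assoc]
    · rw [← mul_assoc, cen_comm hmc g]
  let ψ : A →L[ℂ] A := ∑ o, ContinuousLinearMap.mulLeftRight ℂ A (star (a o)) (a o)
  have hψ : ∀ t, ψ t = ∑ o, star (a o) * t * a o := by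
    intro t
    simp [ψ]
  have hE : IsElem ψ := isElem_of_fintype a hunit ψ hψ
  refine ⟨ψ, hE, ?_⟩
  set C : ℝ := ‖x‖ * (4 / 3) with hC
  have hlow : -(C • (1 - u)) ≤ ψ x := by
    rw [hψ, hsum]
    have e1 : 0 ≤ ∑ i, star (h * b i * g) * x * (h * b i * g) := by
      refine Finset.sum_nonneg fun i _ => ?_
      have := star_left_conjugate_nonneg hhx (b i * g)
      simpa [mul_assoc, hsa.star_eq] using this
    have e2 : -(C • (1 : A)) ≤ g * x * g := by
      have h1 := hxs.neg_algebraMap_norm_le_self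
      rw [Algebra.algebraMap_eq_smul_one] at h1
      have h2 := star_left_conjugate_le_conjugate h1 g
      rw [hgs] at h2
      refine le_trans ?_ h2
      have h3 : g * -(‖x‖ • (1 : A)) * g = -(‖x‖ • (g * g)) := by simp
      rw [h3, neg_le_neg_iff]
      have h4 := smul_le_smul_of_nonneg_left hgg (show 0 ≤ C by positivity)
      refine le_trans (le_of_eq ?_) h4
      rw [smul_smul, hC]; congr 1; ring
    have e3 := cen_mul_le hmc hm0 e2
    have e4 : (1 - u) * -(C • (1 : A)) = -(C • (1 - u)) := by simp
    rw [e4] at e3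
    exact e3.trans (le_add_of_nonneg_right e1)
  set q : A := (s - s') • (1 : A) - C • (1 - u) with hq
  have hqc : q ∈ Set.center A := cen_sub (cen_smul Set.one_mem_center _) (cen_smul hmc _)
  have hqs : IsSelfAdjoint q :=
    ((IsSelfAdjoint.all _).smul (IsSelfAdjoint.one A)).sub
      ((IsSelfAdjoint.all _).smul hm0.isSelfAdjoint)
  have hwq : w q = s - s' := by
    rw [hq, map_sub, map_smul, map_smul, map_sub, hw.one, hu.2.2.2]; simp
  have hqc' := cen_posPart hqc
  have hq0 : 0 ≤ q⁺ := CFC.posPart_nonneg q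
  refine ⟨q⁺, hqc', hq0, ?_, ?_⟩
  · rw [hw.parts hqc hqs (by rw [hwq]; linarith), hwq]; linarith
  · have hyx : ψ y = ψ x + s • (1 : A) := by
      rw [hx, map_sub, IsElem.real_smul, hE.one, sub_add_cancel]
    have e1 : q + s' • (1 : A) ≤ ψ y := by
      rw [hyx]
      refine le_trans (le_of_eq ?_) (add_le_add hlow le_rfl)
      rw [hq]; module
    have e2 := cen_mul_le hqc' hq0 e1
    refine le_trans ?_ e2
    rw [mul_add, mul_smul_comm, mul_one, posPart_mul_self' hqs]
    exact le_add_of_nonneg_left (cen_mul_nonneg hqc' hq0 hq0)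


/-- Point at which everything works. -/
structure Good (w : A →ₗ[ℝ] ℝ) : Prop where
  st : St w
  prop : ∀ K : Set A, MaxIdl K → (∀ z ∈ Set.center A, w (star z * z) = 0 → z ∈ K) →
      ∀ a ∈ K, w a = 0

/-- `a` is within `ε` of the scalar `l` near the point. -/
def Near (w : A →ₗ[ℝ] ℝ) (a : A) (l ε : ℝ) : Prop := LB w a (l - ε) ∧ LB w (-a) (-l - ε)

lemma Near.elem {w : A →ₗ[ℝ] ℝ} {a : A} {l ε : ℝ} (h : Near w a l ε) {ψ : A →L[ℂ] A}
    (hψ : IsElem ψ) : Near w (ψ a) l ε := by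
  refine ⟨h.1.elem hψ, ?_⟩
  have := h.2.elem hψ
  rwa [map_neg] at this

lemma Near.add {w : A →ₗ[ℝ] ℝ} (hw : St w) {a b : A} {l k ε δ : ℝ} (h : Near w a l ε)
    (h' : Near w b k δ) : Near w (a + b) (l + k) (ε + δ) := by
  refine ⟨(h.1.add hw h'.1).weaken (by linarith), ?_⟩
  rw [neg_add]
  exact (h.2.add hw h'.2).weaken (by linarith)

lemma Near.smul {w : A →ₗ[ℝ] ℝ} {a : A} {l ε c : ℝ} (h : Near w a l ε) (hc : 0 ≤ c) :
    Near w (c • a) (c * l) (c * ε) := by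
  refine ⟨(h.1.smul hc).weaken (by linarith), ?_⟩
  rw [← smul_neg]
  exact (h.2.smul hc).weaken (by linarith)

lemma Near.abs_le {w : A →ₗ[ℝ] ℝ} (hw : St w) {a : A} (ha : IsSelfAdjoint a) {l ε : ℝ}
    (h : Near w a l ε) : |w a - l| ≤ ε := by
  have h1 := h.1.le hw ha
  have h2 := h.2.le hw ha.neg
  rw [map_neg] at h2
  rw [_root_.abs_le]; constructor <;> linarith

lemma single {w : A →ₗ[ℝ] ℝ} (hw : Good w) {x : A} (hx : IsSelfAdjoint x) {δ : ℝ} (hδ : 0 < δ) :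
    ∃ ψ : A →L[ℂ] A, IsElem ψ ∧ ∃ l, Near w (ψ x) l δ := by
  set S : Set ℝ := {r | ∃ ψ : A →L[ℂ] A, IsElem ψ ∧ w (ψ x) = r} with hS
  have hne : S.Nonempty := ⟨_, _, isElem_id, rfl⟩
  have hbd : BddAbove S := by
    refine ⟨‖x‖, ?_⟩
    rintro r ⟨ψ, hψ, rfl⟩
    have h1 := hx.le_algebraMap_norm_self
    rw [Algebra.algebraMap_eq_smul_one] at h1
    have h2 := hw.st.mono (hψ.mono h1)
    rwa [IsElem.real_smul, hψ.one, map_smul, hw.st.one, smul_eq_mul, mul_one] at h2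
  obtain ⟨r, ⟨ψ, hψ, rfl⟩, hr⟩ := exists_lt_of_lt_csSup hne (sub_lt_self (sSup S) hδ)
  obtain ⟨ψ₁, hψ₁, h1⟩ := key_lemma hw.st hw.prop (hψ.sa hx) hr
  have hle : w (ψ₁ (ψ x)) ≤ sSup S := le_csSup hbd ⟨ψ₁.comp ψ, hψ₁.comp hψ, rfl⟩
  have hsa := hψ₁.sa (hψ.sa hx)
  obtain ⟨ψ₂, hψ₂, h2⟩ := key_lemma hw.st hw.prop (y := -(ψ₁ (ψ x))) hsa.neg
    (s' := -sSup S - δ) (by rw [map_neg]; linarith)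
  refine ⟨ψ₂.comp (ψ₁.comp ψ), hψ₂.comp (hψ₁.comp hψ), sSup S, h1.elem hψ₂, ?_⟩
  rw [map_neg] at h2
  exact h2

lemma multi {w : A →ₗ[ℝ] ℝ} (hw : Good w) {ι : Type*} (x : ι → A)
    (hx : ∀ i, IsSelfAdjoint (x i)) {δ : ℝ} (hδ : 0 < δ) (s : Finset ι) :
    ∃ ψ : A →L[ℂ] A, IsElem ψ ∧ ∃ l : ι → ℝ, ∀ i ∈ s, Near w (ψ (x i)) (l i) δ := by
  classical
  induction s using Finset.induction_on with
  | empty => exact ⟨_, isElem_id, fun _ => 0, by simp⟩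
  | insert j s hj ih =>
    obtain ⟨ψ, hψ, l, hl⟩ := ih
    obtain ⟨θ, hθ, k, hk⟩ := single hw (hψ.sa (hx j)) hδ
    refine ⟨θ.comp ψ, hθ.comp hψ, Function.update l j k, ?_⟩
    intro i hi
    rcases Finset.mem_insert.1 hi with rfl | hi
    · simpa using hk
    · have hne : i ≠ j := fun h => hj (h ▸ hi)
      rw [Function.update_of_ne hne]
      exact (hl i hi).elem hθ

lemma IsElem.convex {ψ θ : A →L[ℂ] A} (hψ : IsElem ψ) (hθ : IsElem θ) {s r : ℝ} (hs : 0 ≤ s)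
    (hr : 0 ≤ r) (h : s + r = 1) :
    ∃ η : A →L[ℂ] A, IsElem η ∧ ∀ x, η x = s • ψ x + r • θ x := by
  obtain ⟨η, hη, h2⟩ := IsElem.comb (κ := Bool)
    (fun b => cond b (Real.sqrt s • (1 : A)) (Real.sqrt r • (1 : A)))
    (by
      simp [smul_smul, Real.mul_self_sqrt hs, Real.mul_self_sqrt hr]
      rw [← add_smul, h, one_smul])
    (fun b => cond b ψ θ) (by intro b; cases b <;> assumption)
  refine ⟨η, hη, fun x => ?_⟩
  rw [h2]
  simp [smul_smul, Real.mul_self_sqrt hs, Real.mul_self_sqrt hr]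

lemma local_thm {w : A →ₗ[ℝ] ℝ} (hw : Good w) {ι : Type*} [Fintype ι] (x : ι → A)
    (hx : ∀ i, IsSelfAdjoint (x i)) {ε : ℝ} (hε : 0 < ε) :
    ∃ ψ : A →L[ℂ] A, IsElem ψ ∧ ∀ i, Near w (ψ (x i)) (w (x i)) (2 * ε) := by
  classical
  set S : Set (ι → ℝ) := {l | ∃ ψ : A →L[ℂ] A, IsElem ψ ∧ ∀ i, Near w (ψ (x i)) (l i) ε} with hS
  have hconv : Convex ℝ S := by
    rintro l ⟨ψ, hψ, hl⟩ k ⟨θ, hθ, hk⟩ a b ha hb hab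
    obtain ⟨η, hη, h⟩ := hψ.convex hθ ha hb hab
    refine ⟨η, hη, fun i => ?_⟩
    rw [h]
    have := ((hl i).smul ha).add hw.st ((hk i).smul hb)
    rwa [← add_mul, hab, one_mul] at this
  have hopen : IsOpen (S + Metric.ball (0 : ι → ℝ) ε) := Metric.isOpen_ball.add_left
  have hconv' : Convex ℝ (S + Metric.ball (0 : ι → ℝ) ε) := hconv.add (convex_ball _ _)
  have hmem : (fun i => w (x i)) ∈ S + Metric.ball (0 : ι → ℝ) ε := by
    by_contra hcon
    obtain ⟨f, hf⟩ := geometric_hahn_banach_open_point hconv' hopen hcon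
    have hfe : ∀ l : ι → ℝ, f l = ∑ i, f (Pi.single i 1) * l i := by
      intro l
      conv_lhs => rw [pi_eq_sum_univ' l]
      rw [map_sum]
      refine Finset.sum_congr rfl fun i _ => ?_
      rw [map_smul, smul_eq_mul, mul_comm]
    set c : ι → ℝ := fun i => f (Pi.single i 1) with hc
    set y : A := ∑ i, c i • x i with hy
    have hysa : IsSelfAdjoint y :=
      isSelfAdjoint_sum _ fun i _ => (IsSelfAdjoint.all (c i)).smul (hx i)
    have hwy : ∀ L : A →L[ℂ] A, w (L y) = ∑ i, c i * w (L (x i)) := by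
      intro L
      rw [hy, map_sum, map_sum]
      refine Finset.sum_congr rfl fun i _ => ?_
      rw [IsElem.real_smul, map_smul, smul_eq_mul]
    have hwy0 : w y = f (fun i => w (x i)) := by
      rw [hfe]; exact hwy (ContinuousLinearMap.id ℂ A)
    have happ : ∀ δ : ℝ, 0 < δ → δ ≤ ε → ∃ l ∈ S, w y - δ - (∑ i, |c i|) * δ ≤ f l := by
      intro δ hδ hδε
      obtain ⟨ψ, hψ, h1⟩ := key_lemma hw.st hw.prop hysa (sub_lt_self (w y) hδ)
      obtain ⟨θ, hθ, l, hl⟩ := multi hw (fun i => ψ (x i)) (fun i => hψ.sa (hx i)) hδ Finset.univ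
      refine ⟨l, ⟨θ.comp ψ, hθ.comp hψ, fun i => ?_⟩, ?_⟩
      · have := hl i (Finset.mem_univ i)
        exact ⟨this.1.weaken (by linarith), this.2.weaken (by linarith)⟩
      · have h2 := (h1.elem hθ).le hw.st (hθ.sa (hψ.sa hysa))
        have h3 := hwy (θ.comp ψ)
        rw [hfe]
        have h4 : |∑ i, c i * w (θ (ψ (x i))) - ∑ i, c i * l i| ≤ (∑ i, |c i|) * δ := by
          rw [← Finset.sum_sub_distrib, Finset.sum_mul]
          refine (Finset.abs_sum_le_sum_abs _ _).trans (Finset.sum_le_sum fun i _ => ?_)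
          rw [← mul_sub, abs_mul]
          refine mul_le_mul_of_nonneg_left ?_ (abs_nonneg _)
          exact (hl i (Finset.mem_univ i)).abs_le hw.st (hθ.sa (hψ.sa (hx i)))
        have h5 := (abs_le.1 h4).2
        have h6 : w (θ (ψ y)) = ∑ i, c i * w (θ (ψ (x i))) := h3
        linarith
    have hsmall : ∀ v ∈ Metric.ball (0 : ι → ℝ) ε, f v ≤ 0 := by
      intro v hv
      by_contra hpos
      push Not at hpos
      set T : ℝ := 1 + ∑ i, |c i| with hT
      have hT0 : 0 < T := by
        have : 0 ≤ ∑ i, |c i| := Finset.sum_nonneg fun i _ => abs_nonneg _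
        linarith
      obtain ⟨l, hl, hle⟩ := happ (min ε (f v / T)) (lt_min hε (by positivity)) (min_le_left _ _)
      have h1 := hf (l + v) (Set.add_mem_add hl hv)
      rw [map_add, ← hwy0] at h1
      have h2 : min ε (f v / T) * T ≤ f v := by
        have := mul_le_mul_of_nonneg_right (min_le_right ε (f v / T)) hT0.le
        rwa [div_mul_cancel₀ _ hT0.ne'] at this
      rw [hT] at h2
      nlinarith
    have hf0 : ∀ v, f v ≤ 0 := by
      intro v
      have h1 : 0 < ε / (‖v‖ + 1) := by positivity
      have h2 := hsmall ((ε / (‖v‖ + 1)) • v) (by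
        rw [mem_ball_zero_iff, norm_smul, Real.norm_of_nonneg h1.le, div_mul_eq_mul_div,
          div_lt_iff₀ (by positivity)]
        nlinarith [norm_nonneg v])
      rw [map_smul, smul_eq_mul] at h2
      by_contra h3
      push Not at h3
      have := mul_pos h1 h3
      linarith
    have hf00 : ∀ v, f v = 0 := by
      intro v
      have := hf0 (-v)
      rw [map_neg] at this
      linarith [hf0 v]
    obtain ⟨l, hl, _⟩ := happ ε hε le_rfl
    have := hf (l + 0) (Set.add_mem_add hl (Metric.mem_ball_self hε))
    rw [hf00, hf00] at this
    exact lt_irrefl _ this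
  obtain ⟨l, ⟨ψ, hψ, hl⟩, v, hv, hlv⟩ := Set.mem_add.1 hmem
  refine ⟨ψ, hψ, fun i => ?_⟩
  have h1 : l i + v i = w (x i) := congrFun hlv i
  have h2 : |v i| < ε := by
    have := norm_le_pi_norm v i
    rw [Real.norm_eq_abs] at this
    rw [mem_ball_zero_iff] at hv
    linarith
  have h3 := abs_lt.1 h2
  exact ⟨(hl i).1.weaken (by linarith), (hl i).2.weaken (by linarith)⟩


lemma LB.common {w : A →ₗ[ℝ] ℝ} (hw : St w) {κ : Type*} (a : κ → A) (r : κ → ℝ) (s : Finset κ)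
    (h : ∀ k ∈ s, LB w (a k) (r k)) :
    ∃ z ∈ Set.center A, 0 ≤ z ∧ 0 < w z ∧ ∀ k ∈ s, r k • z ≤ z * a k := by
  classical
  induction s using Finset.induction_on with
  | empty => exact ⟨1, Set.one_mem_center, zero_le_one, by rw [hw.one]; exact one_pos, by simp⟩
  | insert j s hj ih =>
    obtain ⟨z, hz, z0, z1, h1⟩ := ih fun k hk => h k (Finset.mem_insert_of_mem hk)
    obtain ⟨y, hy, y0, y1, h2⟩ := h j (Finset.mem_insert_self _ _)
    refine ⟨z * y, Set.mul_mem_center hz hy, cen_mul_nonneg hz z0 y0, ?_, ?_⟩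
    · rw [hw.mul z hz z0 y y0.isSelfAdjoint]; positivity
    · intro k hk
      rcases Finset.mem_insert.1 hk with rfl | hk
      · have := cen_mul_le hz z0 h2
        rwa [mul_smul_comm, ← mul_assoc] at this
      · have := cen_mul_le hy y0 (h1 k hk)
        rwa [mul_smul_comm, ← mul_assoc, cen_comm hy z] at this

variable (A) in
/-- The center as a star subalgebra. -/
def Zc : StarSubalgebra ℂ A :=
  { Subalgebra.center ℂ A with star_mem' := fun h => Set.star_mem_center h }

lemma mem_Zc {a : A} : a ∈ Zc A ↔ a ∈ Set.center A := Iff.rfl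

instance Zc_closed : IsClosed ((Zc A : StarSubalgebra ℂ A) : Set A) := by
  have : ((Zc A : StarSubalgebra ℂ A) : Set A) = ⋂ g : A, {a | g * a = a * g} := by
    ext a
    simp only [SetLike.mem_coe, mem_Zc, Semigroup.mem_center_iff, Set.mem_iInter, Set.mem_ofPred_eq]
  rw [this]
  exact isClosed_iInter fun g =>
    isClosed_eq (continuous_const_mul g) (continuous_mul_const g)

noncomputable instance Zc_comm : CommCStarAlgebra (Zc A) :=
  { (inferInstance : CStarAlgebra (Zc A)) with
    mul_comm := fun a b => Subtype.ext (cen_comm a.2 b.1) }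

open WeakDual in
lemma char_real (χ : characterSpace ℂ (Zc A)) (c : Zc A) (hc : IsSelfAdjoint (c : A)) :
    (χ c).im = 0 := by
  have h1 : star c = c := Subtype.ext hc
  have h2 := map_star χ c
  rw [h1] at h2
  exact Complex.conj_eq_iff_im.1 h2.symm

open WeakDual in
lemma char_nonneg (χ : characterSpace ℂ (Zc A)) (c : Zc A) (hc : 0 ≤ (c : A)) :
    0 ≤ (χ c).re := by
  set m : Zc A := ⟨CFC.sqrt (c : A), cen_sqrt c.2⟩
  have hm : c = m * m := Subtype.ext (CFC.sqrt_mul_sqrt_self _ hc).symm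
  have h1 := char_real χ m (CFC.sqrt_nonneg _).isSelfAdjoint
  rw [hm, map_mul, Complex.mul_re, h1]
  nlinarith [mul_self_nonneg (χ m).re]

/-- Center ideals. -/
def CenIdl (t : Set A) : Prop :=
  t ⊆ Set.center A ∧ IsClosed t ∧ (0 : A) ∈ t ∧
    (∀ x ∈ t, ∀ y ∈ t, x + y ∈ t) ∧ (∀ (c : ℂ), ∀ x ∈ t, c • x ∈ t) ∧
    ∀ z ∈ Set.center A, ∀ x ∈ t, z * x ∈ t

/-- Maximal center ideals. -/
def MaxCenIdl (t : Set A) : Prop :=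
  CenIdl t ∧ t ≠ Set.center A ∧
    ∀ s : Set A, CenIdl s → s ≠ Set.center A → t ⊆ s → s = t

open WeakDual in
lemma ker_maxCenIdl (χ : characterSpace ℂ (Zc A)) :
    MaxCenIdl {a : A | ∃ h : a ∈ Zc A, χ ⟨a, h⟩ = 0} := by
  refine ⟨⟨?_, ?_, ?_, ?_, ?_, ?_⟩, ?_, ?_⟩
  · rintro a ⟨h, -⟩; exact h
  · have : {a : A | ∃ h : a ∈ Zc A, χ ⟨a, h⟩ = 0} = Subtype.val '' {c : Zc A | χ c = 0} := by
      ext a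
      constructor
      · rintro ⟨h, h'⟩; exact ⟨⟨a, h⟩, h', rfl⟩
      · rintro ⟨c, h', rfl⟩; exact ⟨c.2, h'⟩
    rw [this]
    refine (Topology.IsClosedEmbedding.isClosedMap (Zc_closed (A := A)).isClosedEmbedding_subtypeVal) _ ?_
    exact isClosed_eq (map_continuous χ) continuous_const
  · exact ⟨(Zc A).zero_mem, map_zero χ⟩
  · rintro x ⟨hx, h1⟩ y ⟨hy, h2⟩
    exact ⟨add_mem hx hy, by
      have := map_add χ ⟨x, hx⟩ ⟨y, hy⟩
      rw [h1, h2, add_zero] at this; exact this⟩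
  · rintro c x ⟨hx, h1⟩
    exact ⟨SMulMemClass.smul_mem c hx, by
      have := map_smul χ c ⟨x, hx⟩
      rw [h1, smul_zero] at this; exact this⟩
  · rintro z hz x ⟨hx, h1⟩
    exact ⟨mul_mem (show z ∈ Zc A from hz) hx, by
      have := map_mul χ ⟨z, hz⟩ ⟨x, hx⟩
      rw [h1, mul_zero] at this; exact this⟩
  · intro h
    have h1 : (1 : A) ∈ Set.center A := Set.one_mem_center
    rw [← h] at h1
    obtain ⟨h2, h3⟩ := h1
    have : χ (1 : Zc A) = 0 := h3
    rw [map_one] at this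
    exact one_ne_zero this
  · intro s hs hne hts
    refine Set.Subset.antisymm ?_ hts
    intro x hx
    have hxc : x ∈ Zc A := hs.1 hx
    refine ⟨hxc, ?_⟩
    by_contra h0
    apply hne
    refine Set.Subset.antisymm hs.1 ?_
    set k : ℂ := χ ⟨x, hxc⟩ with hk
    have h1 : (1 : A) - k⁻¹ • x ∈ s := by
      apply hts
      refine ⟨sub_mem (one_mem _) (SMulMemClass.smul_mem _ hxc), ?_⟩
      have : χ ((1 : Zc A) - k⁻¹ • ⟨x, hxc⟩) = 0 := by
        rw [map_sub, map_one, map_smul, ← hk, smul_eq_mul, inv_mul_cancel₀ h0, sub_self]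
      exact this
    have h2 : (1 : A) ∈ s := by
      have := hs.2.2.2.1 _ h1 _ (hs.2.2.2.2.1 k⁻¹ x hx)
      rwa [sub_add_cancel] at this
    intro z hz
    have := hs.2.2.2.2.2 z hz 1 h2
    rwa [mul_one] at this

lemma norm_le_of_bds {a : A} {r : ℝ} (hr : 0 ≤ r) (h1 : -(r • (1 : A)) ≤ a)
    (h2 : a ≤ r • (1 : A)) : ‖a‖ ≤ 3 * r := by
  rcases subsingleton_or_nontrivial A with hA | hA
  · rw [Subsingleton.elim a 0, norm_zero]; positivity
  have h3 : 0 ≤ a + r • (1 : A) := by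
    rw [neg_le_iff_add_nonneg] at h1; exact h1
  have h4 : ‖a + r • (1 : A)‖ ≤ 2 * r := by
    rw [CStarAlgebra.norm_le_iff_le_algebraMap _ (by positivity) h3,
      Algebra.algebraMap_eq_smul_one, two_mul, add_smul]
    exact add_le_add h2 le_rfl
  have h5 : ‖r • (1 : A)‖ = r := by
    rw [norm_smul, norm_one, mul_one, Real.norm_of_nonneg hr]
  calc ‖a‖ = ‖(a + r • (1 : A)) - r • (1 : A)‖ := by rw [add_sub_cancel_right]
    _ ≤ ‖a + r • (1 : A)‖ + ‖r • (1 : A)‖ := norm_sub_le _ _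
    _ ≤ 3 * r := by linarith

section Global
variable (φ : A →L[ℂ] A)

open WeakDual in
/-- The real state at a character. -/
noncomputable def wst (hrange : ∀ x : A, φ x ∈ Set.center A) (χ : characterSpace ℂ (Zc A)) : A →ₗ[ℝ] ℝ where
  toFun a := (χ ⟨φ a, hrange a⟩).re
  map_add' a b := by
    have h : (⟨φ (a + b), hrange (a + b)⟩ : Zc A) = ⟨φ a, hrange a⟩ + ⟨φ b, hrange b⟩ :=
      Subtype.ext (map_add φ a b)
    rw [h, map_add, Complex.add_re]
  map_smul' r a := by
    have h : (⟨φ (r • a), hrange (r • a)⟩ : Zc A) = (r : ℂ) • ⟨φ a, hrange a⟩ :=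
      Subtype.ext (by
        show φ (r • a) = (r : ℂ) • φ a
        rw [IsElem.real_smul]
        try exact (Complex.coe_smul r (φ a)).symm)
    rw [h, map_smul]
    simp

lemma phi_nonneg (hpos : ∀ a : A, ∃ b : A, φ (star a * a) = star b * b)
    {a : A} (ha : 0 ≤ a) : 0 ≤ φ a := by
  have h : a = star (CFC.sqrt a) * CFC.sqrt a := by
    rw [(CFC.sqrt_nonneg a).isSelfAdjoint.star_eq, CFC.sqrt_mul_sqrt_self a ha]
  obtain ⟨b, hb⟩ := hpos (CFC.sqrt a)
  rw [← h] at hb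
  rw [hb]
  exact star_mul_self_nonneg b

lemma phi_sa (hpos : ∀ a : A, ∃ b : A, φ (star a * a) = star b * b)
    {a : A} (ha : IsSelfAdjoint a) : IsSelfAdjoint (φ a) := by
  rw [← CFC.posPart_sub_negPart a ha, map_sub]
  exact (phi_nonneg φ hpos (CFC.posPart_nonneg a)).isSelfAdjoint.sub
    (phi_nonneg φ hpos (CFC.negPart_nonneg a)).isSelfAdjoint

open WeakDual in
lemma wst_st (hrange : ∀ x : A, φ x ∈ Set.center A)
    (hpos : ∀ a : A, ∃ b : A, φ (star a * a) = star b * b)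
    (hone : φ 1 = 1) (hmod : ∀ z ∈ Set.center A, ∀ x : A, φ (z * x) = z * φ x)
    (χ : characterSpace ℂ (Zc A)) : St (wst φ hrange χ) := by
  refine ⟨?_, ?_, ?_⟩
  · intro a ha
    exact char_nonneg χ _ (phi_nonneg φ hpos ha)
  · show (χ ⟨φ 1, hrange 1⟩).re = 1
    have h : (⟨φ 1, hrange 1⟩ : Zc A) = 1 := Subtype.ext hone
    rw [h, map_one, Complex.one_re]
  · intro z hz z0 a ha
    show (χ ⟨φ (z * a), _⟩).re = (χ ⟨φ z, _⟩).re * (χ ⟨φ a, _⟩).re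
    have hzz : φ z = z := by
      have := hmod z hz 1
      rwa [mul_one, hone, mul_one] at this
    have h : (⟨φ (z * a), hrange (z * a)⟩ : Zc A) = ⟨φ z, hrange z⟩ * ⟨φ a, hrange a⟩ :=
      Subtype.ext (by
        show φ (z * a) = φ z * φ a
        rw [hmod z hz, hzz])
    rw [h, map_mul, Complex.mul_re, char_real χ ⟨φ a, hrange a⟩ (phi_sa φ hpos ha)]
    ring

open WeakDual in
lemma wst_good (hrange : ∀ x : A, φ x ∈ Set.center A)
    (hpos : ∀ a : A, ∃ b : A, φ (star a * a) = star b * b)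
    (hone : φ 1 = 1) (hmod : ∀ z ∈ Set.center A, ∀ x : A, φ (z * x) = z * φ x)
    (hmax : ∀ t Mt : Set A, MaxCenIdl t → MaxIdl Mt → t ⊆ Mt → ∀ x ∈ Mt, φ x ∈ t)
    (χ : characterSpace ℂ (Zc A)) : Good (wst φ hrange χ) := by
  refine ⟨wst_st φ hrange hpos hone hmod χ, ?_⟩
  intro K hK hz a ha
  obtain ⟨h1, h2⟩ := hmax _ K (ker_maxCenIdl χ) hK (by
    rintro z ⟨hzc, h0⟩
    apply hz z hzc
    show (χ ⟨φ (star z * z), _⟩).re = 0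
    have h : (⟨φ (star z * z), hrange (star z * z)⟩ : Zc A) = star ⟨z, hzc⟩ * ⟨z, hzc⟩ :=
      Subtype.ext (by
        show φ (star z * z) = star z * z
        have := hmod (star z * z) (Set.mul_mem_center (Set.star_mem_center hzc) hzc) 1
        rwa [mul_one, hone, mul_one] at this)
    rw [h, map_mul, h0, mul_zero, Complex.zero_re]) a ha
  show (χ ⟨φ a, _⟩).re = 0
  rw [h2, Complex.zero_re]

open WeakDual in
lemma global_sa (hrange : ∀ x : A, φ x ∈ Set.center A)
    (hpos : ∀ a : A, ∃ b : A, φ (star a * a) = star b * b)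
    (hone : φ 1 = 1) (hmod : ∀ z ∈ Set.center A, ∀ x : A, φ (z * x) = z * φ x)
    (hmax : ∀ t Mt : Set A, MaxCenIdl t → MaxIdl Mt → t ⊆ Mt → ∀ x ∈ Mt, φ x ∈ t)
    {ι : Type*} [Fintype ι] (x : ι → A) (hx : ∀ i, IsSelfAdjoint (x i))
    (hx0 : ∀ i, φ (x i) = 0) {ε : ℝ} (hε : 0 < ε) :
    ∃ θ : A →L[ℂ] A, IsElem θ ∧ ∀ i, -((2 * ε) • (1 : A)) ≤ θ (x i) ∧
      θ (x i) ≤ (2 * ε) • (1 : A) := by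
  have hloc : ∀ χ : characterSpace ℂ (Zc A), ∃ ψ : A →L[ℂ] A, IsElem ψ ∧ ∃ z : Zc A,
      0 ≤ (z : A) ∧ 0 < (χ z).re ∧ ∀ i, -((2 * ε) • (z : A)) ≤ z * ψ (x i) ∧
        z * ψ (x i) ≤ (2 * ε) • (z : A) := by
    intro χ
    have hg := wst_good φ hrange hpos hone hmod hmax χ
    obtain ⟨ψ, hψ, h⟩ := local_thm hg x hx hε
    have hw0 : ∀ i, wst φ hrange χ (x i) = 0 := by
      intro i
      show (χ ⟨φ (x i), _⟩).re = 0
      have : (⟨φ (x i), hrange (x i)⟩ : Zc A) = 0 := Subtype.ext (hx0 i)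
      rw [this, map_zero, Complex.zero_re]
    obtain ⟨z, hz, z0, z1, h2⟩ := LB.common hg.st
      (fun p : ι × Bool => cond p.2 (ψ (x p.1)) (-ψ (x p.1))) (fun _ => -(2 * ε)) Finset.univ (by
        rintro ⟨i, b⟩ -
        have h3 := h i
        rw [hw0] at h3
        cases b
        · simpa using h3.2
        · simpa using h3.1)
    refine ⟨ψ, hψ, ⟨z, hz⟩, z0, ?_, ?_⟩
    · have hzz : φ z = z := by
        have := hmod z hz 1
        rwa [mul_one, hone, mul_one] at this
      have : (⟨φ z, hrange z⟩ : Zc A) = ⟨z, hz⟩ := Subtype.ext hzz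
      have h4 : 0 < (χ ⟨φ z, hrange z⟩).re := z1
      rwa [this] at h4
    · intro i
      have h5 := h2 (i, true) (Finset.mem_univ _)
      have h6 := h2 (i, false) (Finset.mem_univ _)
      simp only [cond_true, cond_false, neg_smul, mul_neg] at h5 h6
      exact ⟨h5, neg_le_neg_iff.1 h6⟩
  choose ψ hψ z z0 z1 hz using hloc
  obtain ⟨T, hT⟩ := isCompact_univ.elim_finite_subcover
    (fun χ : characterSpace ℂ (Zc A) => {χ' : characterSpace ℂ (Zc A) | 0 < (χ' (z χ)).re})
    (by
      intro χ
      refine isOpen_lt continuous_const (Complex.continuous_re.comp ?_)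
      exact (WeakDual.eval_continuous (z χ)).comp continuous_subtype_val)
    (by
      intro χ _
      exact Set.mem_iUnion.2 ⟨χ, z1 χ⟩)
  set zs : Zc A := ∑ χ ∈ T, z χ with hzs
  have hunit : IsUnit zs := by
    by_contra hn
    obtain ⟨χ', h'⟩ := WeakDual.CharacterSpace.exists_apply_eq_zero hn
    have h1 : (χ' zs).re = ∑ χ ∈ T, (χ' (z χ)).re := by
      rw [hzs, map_sum, Complex.re_sum]
    obtain ⟨χ, hχ⟩ := Set.mem_iUnion.1 (hT (Set.mem_univ χ'))
    obtain ⟨hχT, hχ⟩ := Set.mem_iUnion.1 hχ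
    have h2 : 0 < ∑ χ ∈ T, (χ' (z χ)).re :=
      Finset.sum_pos' (fun k _ => char_nonneg χ' _ (z0 k)) ⟨χ, hχT, hχ⟩
    rw [h', Complex.zero_re] at h1
    linarith
  obtain ⟨v', hv'⟩ := hunit.exists_left_inv
  set v : A := (v' : A) with hvd
  have hvc : v ∈ Set.center A := v'.2
  have hzsA : (zs : A) = ∑ χ ∈ T, (z χ : A) := by
    rw [hzs]; exact map_sum (Zc A).subtype _ _
  have hv : v * (zs : A) = 1 := congrArg Subtype.val hv'
  have hzs0 : 0 ≤ (zs : A) := by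
    rw [hzsA]; exact Finset.sum_nonneg fun k _ => z0 k
  have hv0 : 0 ≤ v := by
    have h1 := star_left_conjugate_nonneg hzs0 v
    rw [mul_assoc, cen_comm zs.2 v, hv, mul_one] at h1
    have h2 := h1.isSelfAdjoint.star_eq
    rw [star_star] at h2
    rwa [h2]
  have hc : ∀ χ, ∀ a : A, star (CFC.sqrt v * CFC.sqrt (z χ : A)) * a *
      (CFC.sqrt v * CFC.sqrt (z χ : A)) = v * (z χ * a) := by
    intro χ a
    have c1 := cen_sqrt hvc
    have c2 := cen_sqrt (z χ).2
    rw [star_mul, (CFC.sqrt_nonneg v).isSelfAdjoint.star_eq,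
      (CFC.sqrt_nonneg (z χ : A)).isSelfAdjoint.star_eq]
    conv_rhs => rw [← CFC.sqrt_mul_sqrt_self v hv0, ← CFC.sqrt_mul_sqrt_self (z χ : A) (z0 χ)]
    generalize CFC.sqrt v = p at *
    generalize CFC.sqrt (z χ : A) = q at *
    calc q * p * a * (p * q) = q * (p * a * p) * q := by simp only [mul_assoc]
      _ = q * (p * (p * a)) * q := by rw [cen_comm c1 (p * a)]
      _ = (p * (p * a)) * q * q := by rw [cen_comm c2]
      _ = p * p * (a * (q * q)) := by simp only [mul_assoc]
      _ = p * p * (q * q * a) := by rw [cen_comm (Set.mul_mem_center c2 c2) a]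
  have hsum1 : ∑ χ : T, v * (z χ : A) = 1 := by
    rw [← Finset.mul_sum, Finset.sum_coe_sort T (fun χ => (z χ : A)), ← hzsA, hv]
  obtain ⟨θ, hθ, hθx⟩ := IsElem.comb (κ := T)
    (fun χ => CFC.sqrt v * CFC.sqrt (z χ : A))
    (by
      rw [← hsum1]
      refine Finset.sum_congr rfl fun χ _ => ?_
      have := hc χ 1
      rwa [mul_one, mul_one] at this)
    (fun χ => ψ χ) (fun χ => hψ χ)
  refine ⟨θ, hθ, fun i => ?_⟩
  rw [hθx]
  simp only [hc]
  constructor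
  · rw [← hsum1, Finset.smul_sum, ← Finset.sum_neg_distrib]
    refine Finset.sum_le_sum fun χ _ => ?_
    have := cen_mul_le hvc hv0 (hz χ i).1
    rwa [mul_neg, mul_smul_comm] at this
  · rw [← hsum1, Finset.smul_sum]
    refine Finset.sum_le_sum fun χ _ => ?_
    have := cen_mul_le hvc hv0 (hz χ i).2
    rwa [mul_smul_comm] at this

theorem global_thm (hrange : ∀ x : A, φ x ∈ Set.center A)
    (hpos : ∀ a : A, ∃ b : A, φ (star a * a) = star b * b)
    (hone : φ 1 = 1) (hmod : ∀ z ∈ Set.center A, ∀ x : A, φ (z * x) = z * φ x)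
    (hmax : ∀ t Mt : Set A, MaxCenIdl t → MaxIdl Mt → t ⊆ Mt → ∀ x ∈ Mt, φ x ∈ t)
    {ε : ℝ} (hε : 0 < ε) (n : ℕ) (x : Fin n → A) :
    ∃ θ : A →L[ℂ] A, IsElem θ ∧ ∀ i, ‖φ (x i) - θ (x i)‖ < ε := by
  have hφφ : ∀ a, φ (φ a) = φ a := by
    intro a
    have := hmod (φ a) (hrange a) 1
    rwa [mul_one, hone, mul_one] at this
  set y : Fin n → A := fun i => x i - φ (x i) with hy
  have hy0 : ∀ i, φ (y i) = 0 := by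
    intro i; rw [hy]; simp only [map_sub, hφφ, sub_self]
  have hdec : ∀ i, (ℜ (y i) : A) + Complex.I • (ℑ (y i) : A) = y i :=
    fun i => realPart_add_I_smul_imaginaryPart (y i)
  have hparts : ∀ i, φ (ℜ (y i) : A) = 0 ∧ φ (ℑ (y i) : A) = 0 := by
    intro i
    have h1 : φ (ℜ (y i) : A) + Complex.I • φ (ℑ (y i) : A) = 0 := by
      rw [← map_smul, ← map_add, hdec, hy0]
    have hr := (phi_sa φ hpos (ℜ (y i)).2).star_eq
    have hi := (phi_sa φ hpos (ℑ (y i)).2).star_eq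
    have h2 := congrArg star h1
    rw [star_add, star_smul, hr, hi, star_zero] at h2
    have h3 : (star Complex.I : ℂ) = -Complex.I := Complex.conj_I
    rw [h3, neg_smul] at h2
    have h4 : (2 : ℂ) • φ (ℜ (y i) : A) = 0 := by
      have := congrArg₂ (· + ·) h1 h2
      simp only [add_zero] at this
      rw [← this]; module
    have h5 : φ (ℜ (y i) : A) = 0 := (smul_eq_zero.1 h4).resolve_left two_ne_zero
    refine ⟨h5, ?_⟩
    rw [h5, zero_add] at h1
    exact (smul_eq_zero.1 h1).resolve_left Complex.I_ne_zero
  obtain ⟨θ, hθ, h⟩ := global_sa φ hrange hpos hone hmod hmax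
    (fun p : Fin n × Bool => cond p.2 (ℜ (y p.1) : A) (ℑ (y p.1) : A))
    (by rintro ⟨i, b⟩; cases b; exacts [(ℑ (y i)).2, (ℜ (y i)).2])
    (by rintro ⟨i, b⟩; cases b; exacts [(hparts i).2, (hparts i).1])
    (show 0 < ε / 13 by positivity)
  refine ⟨θ, hθ, fun i => ?_⟩
  have h1 : φ (x i) - θ (x i) = -(θ (y i)) := by
    rw [hy]; simp only [map_sub]
    rw [hθ.cen' (hrange (x i)), neg_sub]
  have e1 := h (i, true)
  have e2 := h (i, false)
  simp only [cond_true, cond_false] at e1 e2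
  have n1 := norm_le_of_bds (by positivity) e1.1 e1.2
  have n2 := norm_le_of_bds (by positivity) e2.1 e2.2
  rw [h1, norm_neg, ← hdec i, map_add, map_smul]
  calc ‖θ (ℜ (y i) : A) + Complex.I • θ (ℑ (y i) : A)‖
      ≤ ‖θ (ℜ (y i) : A)‖ + ‖Complex.I • θ (ℑ (y i) : A)‖ := norm_add_le _ _
    _ = ‖θ (ℜ (y i) : A)‖ + ‖θ (ℑ (y i) : A)‖ := by rw [norm_smul, Complex.norm_I, one_mul]
    _ < ε := by linarith

end Global


end Generic

lemma vn_isClosed (M : VonNeumannAlgebra H) : IsClosed (M : Set (H →L[ℂ] H)) := by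
  rw [← M.centralizer_centralizer]
  exact Set.isClosed_centralizer _

lemma forward_aux (φ : ↥M →L[ℂ] ↥M)
    (hrange : ∀ x : ↥M, φ x ∈ Set.center ↥M)
    (h : ∀ ε : ℝ, 0 < ε → ∀ (n : ℕ) (x : Fin n → ↥M),
        ∃ ψ : ↥M →L[ℂ] ↥M, IsElementaryUCP ψ ∧ ∀ i, ‖φ (x i) - ψ (x i)‖ < ε)
    (t Mt : Set ↥M) (ht : IsMaxCenterIdeal t) (hM : IsMaximalIdeal Mt) (htM : t ⊆ Mt)
    (x : ↥M) (hx : x ∈ Mt) : φ x ∈ t := by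
  obtain ⟨⟨hcl, h0, hadd, hsm, hmul⟩, hne, -⟩ := hM
  have hsum : ∀ (n : ℕ) (f : Fin n → ↥M), (∀ i, f i ∈ Mt) → ∑ i, f i ∈ Mt := by
    intro n f hf
    exact Finset.sum_induction f (· ∈ Mt) (fun a b ha hb => hadd a ha b hb) h0
      (fun i _ => hf i)
  have hφ : φ x ∈ Mt := by
    rw [← hcl.closure_eq, Metric.mem_closure_iff]
    intro ε hε
    obtain ⟨ψ, ⟨n, a, -, hψ⟩, hd⟩ := h ε hε 1 (fun _ => x)
    refine ⟨ψ x, ?_, ?_⟩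
    · rw [hψ]
      exact hsum n _ fun i => (hmul (a i) _ (hmul (star (a i)) x hx).1).2
    · rw [dist_eq_norm]; exact hd 0
  have hcc : IsClosed (Set.center ↥M) := by
    have : Set.center ↥M = ⋂ g : ↥M, {a | g * a = a * g} := by
      ext a
      simp only [Semigroup.mem_center_iff, Set.mem_iInter, Set.mem_ofPred_eq]
    rw [this]
    exact isClosed_iInter fun g =>
      isClosed_eq (continuous_const_mul g) (continuous_mul_const g)
  have hs : IsCenterIdeal (Set.center ↥M ∩ Mt) := by
    refine ⟨Set.inter_subset_left, hcc.inter hcl, ⟨Set.zero_mem_center, h0⟩, ?_, ?_, ?_⟩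
    · rintro a ⟨ha, ha'⟩ b ⟨hb, hb'⟩
      exact ⟨Set.add_mem_center ha hb, hadd a ha' b hb'⟩
    · rintro c a ⟨ha, ha'⟩
      refine ⟨?_, hsm c a ha'⟩
      rw [Semigroup.mem_center_iff] at ha ⊢
      intro g
      rw [mul_smul_comm, smul_mul_assoc, ha g]
    · rintro z hz a ⟨ha, ha'⟩
      exact ⟨Set.mul_mem_center hz ha, (hmul z a ha').1⟩
  have hsne : Set.center ↥M ∩ Mt ≠ Set.center ↥M := by
    intro he
    have h1 : (1 : ↥M) ∈ Set.center ↥M ∩ Mt := by rw [he]; exact Set.one_mem_center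
    apply hne
    refine Set.eq_univ_of_forall fun y => ?_
    have := (hmul y 1 h1.2).1
    rwa [mul_one] at this
  rw [← ht.2.2 _ hs hsne (fun z hz => ⟨ht.1.1 hz, htM hz⟩)]
  exact ⟨hrange x, hφ⟩

/-- The C*-algebra structure of a von Neumann algebra. -/
@[reducible] def vnCStar (M : VonNeumannAlgebra H) : CStarAlgebra ↥M where
  toCompleteSpace := (vn_isClosed M).completeSpace_coe
  norm_mul_self_le x := CStarRing.norm_mul_self_le (x : H →L[ℂ] H)

lemma backward_aux (φ : ↥M →L[ℂ] ↥M)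
    (hrange : ∀ x : ↥M, φ x ∈ Set.center ↥M)
    (hpos : ∀ a : ↥M, ∃ b : ↥M, φ (star a * a) = star b * b)
    (hone : φ 1 = 1)
    (hmod : ∀ z ∈ Set.center ↥M, ∀ x : ↥M, φ (z * x) = z * φ x)
    (hmax : ∀ t Mt : Set ↥M, IsMaxCenterIdeal t → IsMaximalIdeal Mt → t ⊆ Mt →
        ∀ x ∈ Mt, φ x ∈ t) (ε : ℝ) (hε : 0 < ε) (n : ℕ) (x : Fin n → ↥M) :
        ∃ ψ : ↥M →L[ℂ] ↥M, IsElementaryUCP ψ ∧ ∀ i, ‖φ (x i) - ψ (x i)‖ < ε := by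
  let _ : CStarAlgebra ↥M := vnCStar M
  let _ : PartialOrder ↥M := CStarAlgebra.spectralOrder ↥M
  let _ : StarOrderedRing ↥M := CStarAlgebra.spectralOrderedRing ↥M
  exact global_thm (A := ↥M) φ hrange hpos hone hmod hmax hε n x

/-- **Corollary.** A unital positive `Z`-module map `φ : M → Z ⊆ M` lies in the
point-norm closure of `E(M)` iff `φ(M_t) ⊆ t` for every maximal ideal `t` of
the center `Z` (where `M_t` is the unique maximal ideal of `M` containing
`t`). -/
theorem unital_positive_moduleMap_mem_pointNormClosure_iff
    (φ : ↥M →L[ℂ] ↥M)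
    (hrange : ∀ x : ↥M, φ x ∈ Set.center ↥M)
    (hpos : ∀ a : ↥M, ∃ b : ↥M, φ (star a * a) = star b * b)
    (hone : φ 1 = 1)
    (hmod : ∀ z ∈ Set.center ↥M, ∀ x : ↥M, φ (z * x) = z * φ x) :
    ((∀ ε : ℝ, 0 < ε → ∀ (n : ℕ) (x : Fin n → ↥M),
        ∃ ψ : ↥M →L[ℂ] ↥M, IsElementaryUCP ψ ∧ ∀ i, ‖φ (x i) - ψ (x i)‖ < ε) ↔
      (∀ t Mt : Set ↥M, IsMaxCenterIdeal t → IsMaximalIdeal Mt → t ⊆ Mt →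
        ∀ x ∈ Mt, φ x ∈ t)) := by
  constructor
  · intro h t Mt ht hM htM x hx
    exact forward_aux φ hrange h t Mt ht hM htM x hx
  · intro h ε hε n x
    exact backward_aux φ hrange hpos hone hmod h ε hε n x

end VonNeumannAlgebraPaper

end
end
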